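/- Main theorem on commuting difference operators: assume axiom (C0): there exists a regular dominant ρ' ∈ V₀ such that for every λ ∈ Λ₊ there is a unique p ∈ P^W of degree ℓ(λ) with p(ρ'+μ) = δ_{λμ} for all μ ∈ Λ₊ with ℓ(μ) ≤ ℓ(λ). Let ρ ∈ V₀. Then: (b) the map h ↦ D_h from P^W into the algebra of difference operators with rational coefficients on V is a ℂ-algebra homomorphism; in particular D_{h₁}∘D_{h₂} = D_{h₂}∘D_{h₁} for all h₁, h₂ ∈ P^W. (c) If ρ is dominant, then for every h ∈ P^W and every λ ∈ Λ₊ one has D_h(p_λ) = h(ρ+λ)·p_λ. -/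

import Mathlib

/-
Common framework for F. Knop, "Construction of Commuting Difference Operators
for Multiplicity Free Spaces".

We identify `Γ` with `ι → ℤ` via its basis `Σ` (so `Σ` is the standard basis),
`Γ^∨` with `ι → ℤ` via the dual basis `Σ^∨`, and `V = Hom(Γ, ℂ)` with `ι → ℂ`.
-/

open scoped BigOperators Classical
open MvPolynomial

noncomputable section

namespace Knop

variable {ι : Type*} [Fintype ι] [DecidableEq ι]

/-- The `i`-th element of the basis `Σ` of `Γ` (resp. of `Σ^∨ ⊆ Γ^∨`), in coordinates. -/
def e (i : ι) : ι → ℤ := Pi.single i 1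

/-- The pairing between `Γ` and `Γ^∨` (in coordinates, the dot product);
`pairZ γ η = γ(η) = η(γ)`. -/
def pairZ (γ η : ι → ℤ) : ℤ := ∑ i, γ i * η i

/-- Evaluation of `γ ∈ Γ` as a linear function on `V = Hom(Γ,ℂ) ≅ ι → ℂ`. -/
def evalC (γ : ι → ℤ) (z : ι → ℂ) : ℂ := ∑ i, (γ i : ℂ) * z i

/-- The embedding `Γ^∨ ⊆ V`. -/
def toV (η : ι → ℤ) : ι → ℂ := fun i => (η i : ℂ)

/-- The action of `w ∈ Aut(Γ)` on `V = Hom(Γ, ℂ)`: `(w • z)(γ) = z(w⁻¹ γ)`, in coordinates. -/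
def actV (w : (ι → ℤ) ≃ₗ[ℤ] (ι → ℤ)) (z : ι → ℂ) : ι → ℂ :=
  fun i => evalC (w.symm (e i)) z

/-- The action of `w ∈ Aut(Γ)` on `Γ^∨ = Hom(Γ, ℤ)`: `(w • η)(γ) = η(w⁻¹ γ)`. -/
def actDual (w : (ι → ℤ) ≃ₗ[ℤ] (ι → ℤ)) (η : ι → ℤ) : ι → ℤ :=
  fun i => pairZ (w.symm (e i)) η

/-- `Λ₊`, the `ℕ`-span of `Σ^∨` inside `Γ^∨`. -/
def LamPlus : Set (ι → ℤ) := {η | ∀ i, 0 ≤ η i}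

/-- The reflection `s_α(x) = x - α^∨(x)·α` attached to a root `α` with coroot `αv`. -/
def reflMap (α αv : ι → ℤ) : (ι → ℤ) → (ι → ℤ) := fun x => x - pairZ x αv • α

/-- The data `(Γ, Σ, W, ℓ)` together with the axioms C1–C8 of Knop's paper
(in the coordinates given by `Σ`).  The root system `Δ` of `W`, the set
`Φ = W·Σ`, and `Λ₁ = W·Σ^∨₁` are carried along as `Finset`s with their
defining specifications. -/
structure Data (ι : Type*) [Fintype ι] [DecidableEq ι] where
  /-- the reflection group `W ⊆ Aut(Γ)` -/
  W : Subgroup ((ι → ℤ) ≃ₗ[ℤ] (ι → ℤ))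
  /-- `W` is finite -/
  W_finite : (W : Set ((ι → ℤ) ≃ₗ[ℤ] (ι → ℤ))).Finite
  /-- the element `ℓ ∈ Γ` -/
  ell : ι → ℤ
  /-- the set of roots `Δ ⊆ Γ` of `W` -/
  Δ : Finset (ι → ℤ)
  /-- the coroot `α^∨ ∈ Γ^∨` of a root `α` -/
  coroot : (ι → ℤ) → (ι → ℤ)
  /-- `Φ = W·Σ` -/
  Φ : Finset (ι → ℤ)
  /-- `Λ₁ = W·Σ^∨₁` -/
  Λ₁ : Finset (ι → ℤ)
  Φ_spec : ∀ ω, ω ∈ Φ ↔ ∃ w ∈ W, ∃ i, ω = w (e i)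
  Λ₁_spec : ∀ η, η ∈ Λ₁ ↔ ∃ w ∈ W, ∃ i, ell i = 1 ∧ η = actDual w (e i)
  /-- `Δ = -Δ` -/
  Δ_neg : ∀ α ∈ Δ, -α ∈ Δ
  /-- every root is a primitive vector of `Γ` -/
  Δ_prim : ∀ α ∈ Δ, ∀ (n : ℤ) (β : ι → ℤ), α = n • β → IsUnit n
  /-- the reflection `s_α` belongs to `W` -/
  refl_mem : ∀ α ∈ Δ, ∃ w ∈ W, ∀ x, w x = reflMap α (coroot α) x
  /-- `α^∨(α) = 2` -/
  coroot_pair : ∀ α ∈ Δ, pairZ α (coroot α) = 2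
  /-- C1: `W` is generated by the reflections `s_α`, `α ∈ Δ` -/
  C1 : W ≤ Subgroup.closure {w : (ι → ℤ) ≃ₗ[ℤ] (ι → ℤ) |
        ∃ α ∈ Δ, ∀ x, w x = reflMap α (coroot α) x}
  /-- C2: `Δ = Δ⁺ ∪ (-Δ⁺)` -/
  C2 : ∀ α ∈ Δ, (∀ i, 0 ≤ α i) ∨ (∀ i, α i ≤ 0)
  /-- C3: `Φ ⊆ Φ⁺ ∪ (-Φ⁺)` -/
  C3 : ∀ ω ∈ Φ, (∀ i, 0 ≤ ω i) ∨ (∀ i, ω i ≤ 0)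
  /-- C4: `ℓ ∈ Γ^W` -/
  C4 : ∀ w ∈ W, w ell = ell
  /-- C5: `Σ_{ω ∈ Φ⁺} ω - Σ_{α ∈ Δ⁺} α = ℓ` -/
  C5 : (∑ ω ∈ Φ.filter (fun ω => ∀ i, 0 ≤ ω i), ω)
        - (∑ α ∈ Δ.filter (fun α => ∀ i, 0 ≤ α i), α) = ell
  /-- C6: `ℓ(η) > 0` for all `η ∈ Σ^∨` -/
  C6 : ∀ i, 0 < ell i
  /-- C7: `ω(η) ∈ {-1,0,1}` for `η ∈ Σ^∨₁` and `ω ∈ Δ ∪ Φ` -/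
  C7 : ∀ i, ell i = 1 → ∀ ω, (ω ∈ Δ ∨ ω ∈ Φ) → ω i = -1 ∨ ω i = 0 ∨ ω i = 1
  /-- C8: a `W`-invariant linear function on `V` is determined by its restriction to `Σ^∨₁` -/
  C8 : ∀ c c' : ι → ℂ,
    (∀ w ∈ W, ∀ z : ι → ℂ, ∑ i, c i * actV w z i = ∑ i, c i * z i) →
    (∀ w ∈ W, ∀ z : ι → ℂ, ∑ i, c' i * actV w z i = ∑ i, c' i * z i) →
    (∀ i, ell i = 1 → c i = c' i) → c = c'

namespace Data

variable (D : Data ι)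

/-- `Δ⁺`, the positive roots. -/
def Δpos : Finset (ι → ℤ) := D.Δ.filter fun α => ∀ i, 0 ≤ α i

/-- `Φ⁺`. -/
def Φpos : Finset (ι → ℤ) := D.Φ.filter fun ω => ∀ i, 0 ≤ ω i

/-- The submonoid `Λ` of `Γ^∨` generated by `Λ₁`. -/
def Lam : AddSubmonoid (ι → ℤ) := AddSubmonoid.closure (D.Λ₁ : Set (ι → ℤ))

/-- `ρ ∈ V₀`: `ω₁(ρ) = ω₂(ρ)` whenever `ω₁, ω₂ ∈ Σ` lie in the same `±W`-orbit. -/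
def InV0 (ρ : ι → ℂ) : Prop :=
  ∀ i j : ι, (∃ w ∈ D.W, e i = w (e j) ∨ e i = -(w (e j))) → ρ i = ρ j

/-- `k` is the multiplicity-parameter function of `ρ ∈ V₀`:
`k_ω = ω₁(ρ)` for any `ω₁ ∈ (±W)·ω ∩ Σ`. -/
def IsK (ρ : ι → ℂ) (k : (ι → ℤ) → ℂ) : Prop :=
  ∀ (ω : ι → ℤ) (i : ι), (∃ w ∈ D.W, e i = w ω ∨ e i = -(w ω)) → k ω = ρ i

/-- `ρ` is dominant: `α(ρ) ∉ {-1,-2,…}` for all `α ∈ Δ⁺`. -/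
def Dominant (ρ : ι → ℂ) : Prop :=
  ∀ α ∈ D.Δpos, ∀ n : ℕ, evalC α ρ ≠ -((n : ℂ) + 1)

/-- `ρ` is regular: `α(ρ) ≠ 0` for all `α ∈ Δ⁺`. -/
def Regular (ρ : ι → ℂ) : Prop :=
  ∀ α ∈ D.Δpos, evalC α ρ ≠ 0

/-- `ρ` is non-integral: `α(ρ) ∉ ℤ` for all `α ∈ Δ`. -/
def NonIntegral (ρ : ι → ℂ) : Prop :=
  ∀ α ∈ D.Δ, ∀ n : ℤ, evalC α ρ ≠ (n : ℂ)

/-- `ρ` is strongly dominant (`k` being the parameter function of `ρ`). -/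
def StronglyDominant (ρ : ι → ℂ) (k : (ι → ℤ) → ℂ) : Prop :=
  D.Regular ρ ∧ D.Dominant ρ ∧
    ∀ ω ∈ D.Φpos, (∀ n : ℕ, evalC ω ρ - k ω ≠ -((n : ℂ) + 1)) ∧
      (∀ n : ℕ, evalC ω ρ + k ω ≠ -(n : ℂ))

/-- The rational function `f_η`, `η ∈ Λ₁`. -/
def f (k : (ι → ℤ) → ℂ) (η : ι → ℤ) (z : ι → ℂ) : ℂ :=
  (∏ ω ∈ D.Φ.filter (fun ω => 0 < pairZ ω η), (evalC ω z - k ω)) /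
  (∏ α ∈ D.Δ.filter (fun α => 0 < pairZ α η), evalC α z)

/-- The value at `z` of `L(p) = Σ_{η ∈ Λ₁} f_η T_η (p)`. -/
def Lval (k : (ι → ℤ) → ℂ) (p : MvPolynomial ι ℂ) (z : ι → ℂ) : ℂ :=
  ∑ η ∈ D.Λ₁, D.f k η z * eval (z - toV η) p

/-- `W`-invariance of a polynomial function on `V`. -/
def WInv (p : MvPolynomial ι ℂ) : Prop :=
  ∀ w ∈ D.W, ∀ z : ι → ℂ, eval (actV w z) p = eval z p

/-- The defining property of the Capelli polynomial `p_λ` (with shift `ρ`):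
`p` is `W`-invariant of degree `≤ ℓ(λ)` and `p(ρ+μ) = δ_{λμ}` for all
`μ ∈ Λ₊` with `ℓ(μ) ≤ ℓ(λ)`. -/
def CapelliAt (ρ : ι → ℂ) (lam : ι → ℤ) (p : MvPolynomial ι ℂ) : Prop :=
  D.WInv p ∧ (p.totalDegree : ℤ) ≤ pairZ D.ell lam ∧
    ∀ μ : ι → ℤ, μ ∈ LamPlus → pairZ D.ell μ ≤ pairZ D.ell lam →
      eval (ρ + toV μ) p = if μ = lam then 1 else 0

/-- Axiom C0: for some regular dominant `ρ' ∈ V₀` and every `λ ∈ Λ₊` there is a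
unique `W`-invariant polynomial of degree `ℓ(λ)` with `p(ρ'+μ) = δ_{λμ}` for all
`μ ∈ Λ₊` with `ℓ(μ) ≤ ℓ(λ)`. -/
def C0 : Prop :=
  ∃ ρ' : ι → ℂ, D.InV0 ρ' ∧ D.Regular ρ' ∧ D.Dominant ρ' ∧
    ∀ lam : ι → ℤ, lam ∈ LamPlus →
      ∃! p : MvPolynomial ι ℂ, D.WInv p ∧
        p.totalDegree = (pairZ D.ell lam).toNat ∧
        ∀ μ : ι → ℤ, μ ∈ LamPlus → pairZ D.ell μ ≤ pairZ D.ell lam →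
          eval (ρ' + toV μ) p = if μ = lam then 1 else 0

end Data

/-- The `m`-th point `τ_m` of the path starting at `lam` with step sequence `s`
(steps are meant to lie in `Λ₁`). -/
def pathPt (lam : ι → ℤ) {d : ℕ} (s : Fin d → ι → ℤ) (m : ℕ) : ι → ℤ :=
  lam + ∑ i ∈ Finset.univ.filter (fun i : Fin d => (i : ℕ) < m), s i

/-- All paths of length `d` from `lam` to `mu` (with steps in `Λ₁`), encoded by
their step sequences. -/
def paths (D : Data ι) (lam mu : ι → ℤ) (d : ℕ) : Finset (Fin d → ι → ℤ) :=
  (Fintype.piFinset fun _ : Fin d => D.Λ₁).filter fun s => pathPt lam s d = mu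

/-- All positive paths of length `d` from `lam` to `mu`. -/
def posPaths (D : Data ι) (lam mu : ι → ℤ) (d : ℕ) : Finset (Fin d → ι → ℤ) :=
  (Fintype.piFinset fun _ : Fin d => D.Λ₁).filter fun s =>
    (∀ m ≤ d, pathPt lam s m ∈ LamPlus) ∧ pathPt lam s d = mu

/-- The falling factorial `[x ↓ d] = x(x-1)⋯(x-d+1)`. -/
def ffall (x : ℂ) (d : ℤ) : ℂ := ∏ j ∈ Finset.range d.toNat, (x - (j : ℂ))

namespace Data

variable (D : Data ι)

/-- The generalized rational function `f_τ`, `τ ∈ Λ` (formula (Def-f-l)). -/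
def fgen (k : (ι → ℤ) → ℂ) (τ : ι → ℤ) (z : ι → ℂ) : ℂ :=
  (∏ ω ∈ D.Φ.filter (fun ω => 0 < pairZ ω τ), ffall (evalC ω z - k ω) (pairZ ω τ)) /
  (∏ α ∈ D.Δ.filter (fun α => 0 < pairZ α τ), ffall (evalC α z) (pairZ α τ))

/-- The virtual dimension `d_λ = (-1)^{ℓ(λ)} f_λ(-ρ) / f_λ(ρ+λ)`. -/
def vdim (k : (ι → ℤ) → ℂ) (ρ : ι → ℂ) (lam : ι → ℤ) : ℂ :=
  (-1 : ℂ) ^ (pairZ D.ell lam) * D.fgen k lam (-ρ) / D.fgen k lam (ρ + toV lam)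

/-- The rational function `b_τ^h` (formula (Def-b-t)); here the sum runs over
all paths from `0` to `τ` of length `d = ℓ(τ)`. -/
def bfun (k : (ι → ℤ) → ℂ) (h : MvPolynomial ι ℂ) (τ : ι → ℤ) (z : ι → ℂ) : ℂ :=
  ∑ s ∈ paths D 0 τ (pairZ D.ell τ).toNat,
    (∑ i ∈ Finset.range ((pairZ D.ell τ).toNat + 1),
      ((-1 : ℂ) ^ ((pairZ D.ell τ).toNat - i) /
        ((Nat.factorial i : ℂ) * (Nat.factorial ((pairZ D.ell τ).toNat - i) : ℂ))) *
        eval (z - toV (pathPt 0 s i)) h) *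
    ∏ i : Fin (pairZ D.ell τ).toNat, D.fgen k (s i) (z - toV (pathPt 0 s (i : ℕ)))

/-- The difference operator `D_h = Σ_{τ ∈ Λ} b_τ^h T_τ`, acting on functions on `V`. -/
def Dop (k : (ι → ℤ) → ℂ) (h : MvPolynomial ι ℂ) (F : (ι → ℂ) → ℂ) (z : ι → ℂ) : ℂ :=
  ∑ᶠ τ ∈ (D.Lam : Set (ι → ℤ)), D.bfun k h τ z * F (z - toV τ)

/-- The order relation on `Λ`: `τ₁ ≤ τ₂` iff `ℓ(τ₁) < ℓ(τ₂)`, or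
`ℓ(τ₁) = ℓ(τ₂)` and `τ₂ - τ₁` is a sum of positive coroots. -/
def ordLe (τ₁ τ₂ : ι → ℤ) : Prop :=
  pairZ D.ell τ₁ < pairZ D.ell τ₂ ∨
    (pairZ D.ell τ₁ = pairZ D.ell τ₂ ∧
      τ₂ - τ₁ ∈ AddSubmonoid.closure (D.coroot '' (D.Δpos : Set (ι → ℤ))))

end Data

set_option linter.unusedSectionVars false

/-! ### Pairings and actions -/

/-- The automorphism group of the lattice `ι → ℤ`. -/
abbrev LatAut (ι : Type*) := (ι → ℤ) ≃ₗ[ℤ] (ι → ℤ)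

lemma evalC_add (γ δ : ι → ℤ) (z : ι → ℂ) : evalC (γ + δ) z = evalC γ z + evalC δ z := by
  simp [evalC, add_mul, Finset.sum_add_distrib]

@[simp] lemma evalC_neg (γ : ι → ℤ) (z : ι → ℂ) : evalC (-γ) z = -evalC γ z := by
  simp [evalC]

lemma evalC_sub (γ δ : ι → ℤ) (z : ι → ℂ) : evalC (γ - δ) z = evalC γ z - evalC δ z := by
  simp [evalC, sub_mul, Finset.sum_sub_distrib]

@[simp] lemma evalC_zero (z : ι → ℂ) : evalC (0 : ι → ℤ) z = 0 := by
  simp [evalC]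

lemma evalC_smul (n : ℤ) (γ : ι → ℤ) (z : ι → ℂ) : evalC (n • γ) z = n * evalC γ z := by
  simp [evalC, Finset.mul_sum, mul_assoc]

lemma evalC_add_right (γ : ι → ℤ) (z x : ι → ℂ) : evalC γ (z + x) = evalC γ z + evalC γ x := by
  simp [evalC, mul_add, Finset.sum_add_distrib]

lemma evalC_sub_right (γ : ι → ℤ) (z x : ι → ℂ) : evalC γ (z - x) = evalC γ z - evalC γ x := by
  simp [evalC, mul_sub, Finset.sum_sub_distrib]

lemma evalC_smul_right (γ : ι → ℤ) (c : ℂ) (z : ι → ℂ) : evalC γ (c • z) = c * evalC γ z := by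
  simp only [evalC, Finset.mul_sum, Pi.smul_apply, smul_eq_mul]
  exact Finset.sum_congr rfl fun i _ => by ring

@[simp] lemma evalC_zero_right (γ : ι → ℤ) : evalC γ (0 : ι → ℂ) = 0 := by
  simp [evalC]

lemma evalC_e (i : ι) (z : ι → ℂ) : evalC (e i) z = z i := by
  simp [evalC, e, Pi.single_apply]

lemma evalC_sum {κ : Type*} (s : Finset κ) (g : κ → ι → ℤ) (z : ι → ℂ) :
    evalC (∑ j ∈ s, g j) z = ∑ j ∈ s, evalC (g j) z := by
  induction s using Finset.induction_on with
  | empty => simp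
  | insert a s ha ih => rw [Finset.sum_insert ha, Finset.sum_insert ha, evalC_add, ih]

@[simp] lemma evalC_toV (γ η : ι → ℤ) : evalC γ (toV η) = (pairZ γ η : ℂ) := by
  simp [evalC, toV, pairZ]

@[simp] lemma toV_zero : toV (0 : ι → ℤ) = 0 := by ext; simp [toV]

lemma toV_add (η τ : ι → ℤ) : toV (η + τ) = toV η + toV τ := by ext; simp [toV]

lemma toV_sub (η τ : ι → ℤ) : toV (η - τ) = toV η - toV τ := by ext; simp [toV]

@[simp] lemma toV_neg (η : ι → ℤ) : toV (-η) = -toV η := by ext; simp [toV]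

lemma toV_smul (n : ℤ) (η : ι → ℤ) : toV (n • η) = (n : ℂ) • toV η := by ext; simp [toV]

lemma pairZ_add (γ δ η : ι → ℤ) : pairZ (γ + δ) η = pairZ γ η + pairZ δ η := by
  simp [pairZ, add_mul, Finset.sum_add_distrib]

lemma pairZ_sub (γ δ η : ι → ℤ) : pairZ (γ - δ) η = pairZ γ η - pairZ δ η := by
  simp [pairZ, sub_mul, Finset.sum_sub_distrib]

lemma pairZ_smul (n : ℤ) (γ η : ι → ℤ) : pairZ (n • γ) η = n * pairZ γ η := by
  simp [pairZ, Finset.mul_sum, mul_assoc]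

@[simp] lemma pairZ_neg (γ η : ι → ℤ) : pairZ (-γ) η = -pairZ γ η := by
  simp [pairZ]

@[simp] lemma pairZ_zero (η : ι → ℤ) : pairZ 0 η = 0 := by
  simp [pairZ]

lemma pairZ_comm (γ η : ι → ℤ) : pairZ γ η = pairZ η γ := by
  simp [pairZ, mul_comm]

lemma pairZ_add_right (γ η τ : ι → ℤ) : pairZ γ (η + τ) = pairZ γ η + pairZ γ τ := by
  simp [pairZ, mul_add, Finset.sum_add_distrib]

lemma pairZ_sub_right (γ η τ : ι → ℤ) : pairZ γ (η - τ) = pairZ γ η - pairZ γ τ := by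
  simp [pairZ, mul_sub, Finset.sum_sub_distrib]

lemma pairZ_smul_right (n : ℤ) (γ η : ι → ℤ) : pairZ γ (n • η) = n * pairZ γ η := by
  rw [pairZ_comm, pairZ_smul, pairZ_comm]

@[simp] lemma pairZ_neg_right (γ η : ι → ℤ) : pairZ γ (-η) = -pairZ γ η := by
  simp [pairZ]

@[simp] lemma pairZ_zero_right (γ : ι → ℤ) : pairZ γ 0 = 0 := by
  simp [pairZ]

@[simp] lemma pairZ_e (i : ι) (η : ι → ℤ) : pairZ (e i) η = η i := by
  simp [pairZ, e, Pi.single_apply]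

@[simp] lemma pairZ_e_right (γ : ι → ℤ) (i : ι) : pairZ γ (e i) = γ i := by
  rw [pairZ_comm, pairZ_e]

lemma pairZ_sum_right {κ : Type*} (s : Finset κ) (γ : ι → ℤ) (g : κ → ι → ℤ) :
    pairZ γ (∑ j ∈ s, g j) = ∑ j ∈ s, pairZ γ (g j) := by
  induction s using Finset.induction_on with
  | empty => simp
  | insert a s ha ih => rw [Finset.sum_insert ha, Finset.sum_insert ha, pairZ_add_right, ih]

lemma pairZ_sum {κ : Type*} (s : Finset κ) (g : κ → ι → ℤ) (η : ι → ℤ) :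
    pairZ (∑ j ∈ s, g j) η = ∑ j ∈ s, pairZ (g j) η := by
  rw [pairZ_comm, pairZ_sum_right]
  exact Finset.sum_congr rfl fun _ _ => pairZ_comm _ _

lemma sum_smul_e (γ : ι → ℤ) : ∑ i, γ i • e i = γ := by
  ext j
  simp [e, Finset.sum_apply, Pi.single_apply]

lemma evalC_map (u : LatAut ι) (γ : ι → ℤ) (z : ι → ℂ) :
    evalC (u γ) z = ∑ i, (γ i : ℂ) * evalC (u (e i)) z := by
  conv_lhs => rw [← sum_smul_e γ]
  rw [map_sum, evalC_sum]
  exact Finset.sum_congr rfl fun i _ => by rw [map_smul, evalC_smul]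

lemma pairZ_map (u : LatAut ι) (γ η : ι → ℤ) :
    pairZ (u γ) η = ∑ i, γ i * pairZ (u (e i)) η := by
  conv_lhs => rw [← sum_smul_e γ]
  rw [map_sum, pairZ_sum]
  exact Finset.sum_congr rfl fun i _ => by rw [map_smul, pairZ_smul]

@[simp] lemma evalC_actV (w : LatAut ι) (γ : ι → ℤ) (z : ι → ℂ) :
    evalC γ (actV w z) = evalC (w.symm γ) z := by
  rw [evalC_map]; rfl

@[simp] lemma pairZ_actDual (w : LatAut ι) (γ η : ι → ℤ) :
    pairZ γ (actDual w η) = pairZ (w.symm γ) η := by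
  rw [pairZ_map]; rfl

lemma toV_actDual (w : LatAut ι) (η : ι → ℤ) : toV (actDual w η) = actV w (toV η) := by
  ext i
  simp [actV, toV, actDual]

lemma vec_ext {z x : ι → ℂ} (h : ∀ γ : ι → ℤ, evalC γ z = evalC γ x) : z = x := by
  ext i
  simpa [evalC_e] using h (e i)

lemma dual_ext {z x : ι → ℤ} (h : ∀ γ : ι → ℤ, pairZ γ z = pairZ γ x) : z = x := by
  ext i
  simpa using h (e i)

lemma actV_mul (u w : LatAut ι) (z : ι → ℂ) : actV (u * w) z = actV u (actV w z) :=
  vec_ext fun γ => by simp; rfl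

@[simp] lemma actV_one (z : ι → ℂ) : actV (1 : LatAut ι) z = z :=
  vec_ext fun γ => by simp; rfl

lemma actDual_mul (u w : LatAut ι) (z : ι → ℤ) : actDual (u * w) z = actDual u (actDual w z) :=
  dual_ext fun γ => by simp; rfl

@[simp] lemma actDual_one (z : ι → ℤ) : actDual (1 : LatAut ι) z = z :=
  dual_ext fun γ => by simp; rfl

@[simp] lemma actV_inv_actV (w : LatAut ι) (z : ι → ℂ) : actV w⁻¹ (actV w z) = z := by
  rw [← actV_mul]; simp

@[simp] lemma actV_actV_inv (w : LatAut ι) (z : ι → ℂ) : actV w (actV w⁻¹ z) = z := by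
  rw [← actV_mul]; simp

@[simp] lemma actDual_inv_actDual (w : LatAut ι) (z : ι → ℤ) : actDual w⁻¹ (actDual w z) = z := by
  rw [← actDual_mul]; simp

@[simp] lemma actDual_actDual_inv (w : LatAut ι) (z : ι → ℤ) : actDual w (actDual w⁻¹ z) = z := by
  rw [← actDual_mul]; simp

lemma actV_add (w : LatAut ι) (z x : ι → ℂ) : actV w (z + x) = actV w z + actV w x :=
  vec_ext fun γ => by simp [evalC_add_right]

lemma actV_sub (w : LatAut ι) (z x : ι → ℂ) : actV w (z - x) = actV w z - actV w x :=
  vec_ext fun γ => by simp [evalC_sub_right]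

lemma actV_smul (w : LatAut ι) (c : ℂ) (x : ι → ℂ) : actV w (c • x) = c • actV w x :=
  vec_ext fun γ => by simp [evalC_smul_right]

lemma actDual_add (w : LatAut ι) (z x : ι → ℤ) :
    actDual w (z + x) = actDual w z + actDual w x :=
  dual_ext fun γ => by simp [pairZ_add_right]

lemma actDual_sub (w : LatAut ι) (z x : ι → ℤ) :
    actDual w (z - x) = actDual w z - actDual w x :=
  dual_ext fun γ => by simp [pairZ_sub_right]

lemma actDual_smul (w : LatAut ι) (n : ℤ) (x : ι → ℤ) :
    actDual w (n • x) = n • actDual w x :=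
  dual_ext fun γ => by rw [pairZ_actDual, pairZ_smul_right, pairZ_smul_right, pairZ_actDual]

lemma symm_eq_inv (w : LatAut ι) : w.symm = w⁻¹ := rfl

lemma inv_apply_self' (w : LatAut ι) (γ : ι → ℤ) : w⁻¹ (w γ) = γ := w.symm_apply_apply γ

lemma apply_inv_self' (w : LatAut ι) (γ : ι → ℤ) : w (w⁻¹ γ) = γ := w.apply_symm_apply γ

/-! ### Polynomial functions -/

/-- The linear polynomial attached to a lattice vector. -/
def lin (γ : ι → ℤ) : MvPolynomial ι ℂ := ∑ i, C (γ i : ℂ) * X i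

@[simp] lemma eval_lin (γ : ι → ℤ) (z : ι → ℂ) : eval z (lin γ) = evalC γ z := by
  simp [lin, evalC]

/-- Translation of polynomials. -/
def trP (v : ι → ℂ) : MvPolynomial ι ℂ →ₐ[ℂ] MvPolynomial ι ℂ := bind₁ fun i => X i + C (v i)

lemma eval_bind₁' (g : ι → MvPolynomial ι ℂ) (p : MvPolynomial ι ℂ) (z : ι → ℂ) :
    eval z (bind₁ g p) = eval (fun i => eval z (g i)) p := by
  simp only [← coe_aeval_eq_eval]
  exact aeval_bind₁ z g p

@[simp] lemma eval_trP (v : ι → ℂ) (p : MvPolynomial ι ℂ) (z : ι → ℂ) :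
    eval z (trP v p) = eval (z + v) p := by
  rw [trP, eval_bind₁']
  congr 2
  ext i
  simp

/-- The action of lattice automorphisms on polynomials. -/
def actP (w : LatAut ι) : MvPolynomial ι ℂ →ₐ[ℂ] MvPolynomial ι ℂ :=
  bind₁ fun i => lin (w.symm (e i))

@[simp] lemma eval_actP (w : LatAut ι) (p : MvPolynomial ι ℂ) (z : ι → ℂ) :
    eval z (actP w p) = eval (actV w z) p := by
  rw [actP, eval_bind₁']
  simp only [eval_lin]
  rfl

/-- `DegLe p n` says that the total degree of `p` is at most the integer `n`
(so `p = 0` if `n < 0`). -/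
def DegLe (p : MvPolynomial ι ℂ) (n : ℤ) : Prop := p = 0 ∨ (p.totalDegree : ℤ) ≤ n

lemma degLe_zero (n : ℤ) : DegLe (0 : MvPolynomial ι ℂ) n := Or.inl rfl

lemma degLe_totalDegree (p : MvPolynomial ι ℂ) : DegLe p p.totalDegree := Or.inr le_rfl

lemma DegLe.mono {p : MvPolynomial ι ℂ} {n m : ℤ} (h : DegLe p n) (hnm : n ≤ m) : DegLe p m :=
  h.imp id fun h => h.trans hnm

lemma DegLe.add {p q : MvPolynomial ι ℂ} {n : ℤ} (hp : DegLe p n) (hq : DegLe q n) :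
    DegLe (p + q) n := by
  rcases hp with rfl | hp
  · simpa using hq
  rcases hq with rfl | hq
  · rw [add_zero]
    exact Or.inr hp
  · right
    have := totalDegree_add p q
    have := max_le (a := p.totalDegree) (b := q.totalDegree) (c := n.toNat)
      (by omega) (by omega)
    omega

lemma DegLe.mul {p q : MvPolynomial ι ℂ} {n m : ℤ} (hp : DegLe p n) (hq : DegLe q m) :
    DegLe (p * q) (n + m) := by
  rcases hp with rfl | hp
  · simp [degLe_zero]
  rcases hq with rfl | hq
  · simp [degLe_zero]
  · right
    have := totalDegree_mul p q
    omega

lemma degLe_C (c : ℂ) : DegLe (C c : MvPolynomial ι ℂ) 0 := Or.inr (by simp)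

lemma degLe_one : DegLe (1 : MvPolynomial ι ℂ) 0 := Or.inr (by simp)

lemma degLe_X (i : ι) : DegLe (X i : MvPolynomial ι ℂ) 1 := Or.inr (by simp)

lemma DegLe.C_mul {p : MvPolynomial ι ℂ} {n : ℤ} (hp : DegLe p n) (c : ℂ) : DegLe (C c * p) n := by
  simpa using (degLe_C c).mul hp

lemma DegLe.neg {p : MvPolynomial ι ℂ} {n : ℤ} (hp : DegLe p n) : DegLe (-p) n := by
  simpa using hp.C_mul (-1)

lemma DegLe.sub {p q : MvPolynomial ι ℂ} {n : ℤ} (hp : DegLe p n) (hq : DegLe q n) :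
    DegLe (p - q) n := by
  rw [sub_eq_add_neg]
  exact hp.add hq.neg

lemma DegLe.sum {κ : Type*} (s : Finset κ) {g : κ → MvPolynomial ι ℂ} {n : ℤ}
    (h : ∀ j ∈ s, DegLe (g j) n) : DegLe (∑ j ∈ s, g j) n := by
  induction s using Finset.induction_on with
  | empty => simp [degLe_zero]
  | insert a s ha ih =>
    rw [Finset.sum_insert ha]
    exact (h a (by simp)).add (ih fun j hj => h j (by simp [hj]))

lemma DegLe.prod {κ : Type*} (s : Finset κ) {g : κ → MvPolynomial ι ℂ} {n : κ → ℤ}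
    (h : ∀ j ∈ s, DegLe (g j) (n j)) : DegLe (∏ j ∈ s, g j) (∑ j ∈ s, n j) := by
  induction s using Finset.induction_on with
  | empty => simpa using degLe_one
  | insert a s ha ih =>
    rw [Finset.prod_insert ha, Finset.sum_insert ha]
    exact (h a (by simp)).mul (ih fun j hj => h j (by simp [hj]))

lemma degLe_lin (γ : ι → ℤ) : DegLe (lin γ) 1 :=
  DegLe.sum _ fun i _ => (degLe_X i).C_mul _

/-- An induction principle for polynomials with a degree bound. -/
lemma DegLe.induct {Q : MvPolynomial ι ℂ → ℤ → Prop}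
    (hC : ∀ c, Q (C c) 0) (hX : ∀ i, Q (X i) 1)
    (hmul : ∀ p q n m, Q p n → Q q m → Q (p * q) (n + m))
    (hadd : ∀ p q n, Q p n → Q q n → Q (p + q) n)
    (hmono : ∀ p n m, Q p n → n ≤ m → Q p m) (h0 : ∀ n, Q 0 n)
    {p : MvPolynomial ι ℂ} {n : ℤ} (hp : DegLe p n) : Q p n := by
  rcases hp with rfl | hp
  · exact h0 n
  have hpow : ∀ i : ι, ∀ m : ℕ, Q (X i ^ m) m := by
    intro i m
    induction m with
    | zero => simpa using hC 1
    | succ m ih =>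
      rw [pow_succ]
      push_cast
      exact hmul _ _ _ _ ih (hX i)
  have hmon : ∀ (d : ι →₀ ℕ) (c : ℂ), Q (monomial d c) ((d.sum fun _ n => n : ℕ) : ℤ) := by
    intro d c
    rw [monomial_eq]
    have hprod : ∀ s : Finset ι, Q (∏ i ∈ s, (X i : MvPolynomial ι ℂ) ^ d i)
        ((∑ i ∈ s, d i : ℕ) : ℤ) := by
      intro s
      induction s using Finset.induction_on with
      | empty => simpa using hC 1
      | insert a s ha ih =>
        rw [Finset.prod_insert ha, Finset.sum_insert ha]
        push_cast at ih ⊢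
        exact hmul _ _ _ _ (hpow _ _) ih
    have := hmul _ _ _ _ (hC c) (hprod d.support)
    rw [zero_add] at this
    exact this
  have hsum : ∀ s ⊆ p.support, Q (∑ d ∈ s, monomial d (coeff d p)) n := by
    intro s
    induction s using Finset.induction_on with
    | empty => simpa using h0 n
    | insert a s ha ih =>
      intro hs
      rw [Finset.sum_insert ha]
      refine hadd _ _ _ (hmono _ _ _ (hmon _ _) ?_) (ih fun x hx => hs (by simp [hx]))
      have := le_totalDegree (hs (Finset.mem_insert_self a s))
      exact le_trans (by exact_mod_cast this) hp
  have := hsum _ subset_rfl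
  rwa [support_sum_monomial_coeff] at this

lemma DegLe.bind₁ {p : MvPolynomial ι ℂ} {n : ℤ} (hp : DegLe p n) {g : ι → MvPolynomial ι ℂ}
    (hg : ∀ i, DegLe (g i) 1) : DegLe (MvPolynomial.bind₁ g p) n := by
  refine DegLe.induct (Q := fun p n => DegLe (MvPolynomial.bind₁ g p) n) ?_ ?_ ?_ ?_ ?_ ?_ hp
  · intro c
    rw [bind₁_C_right]
    exact degLe_C c
  · intro i
    rw [bind₁_X_right]
    exact hg i
  · intro p q n m hp hq
    rw [map_mul]
    exact hp.mul hq
  · intro p q n hp hq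
    rw [map_add]
    exact hp.add hq
  · intro p n m hp h
    exact hp.mono h
  · intro n
    rw [map_zero]
    exact degLe_zero n

lemma DegLe.trP {p : MvPolynomial ι ℂ} {n : ℤ} (hp : DegLe p n) (v : ι → ℂ) :
    DegLe (trP v p) n :=
  hp.bind₁ fun i => (degLe_X i).add ((degLe_C _).mono zero_le_one)

lemma DegLe.actP {p : MvPolynomial ι ℂ} {n : ℤ} (hp : DegLe p n) (w : LatAut ι) :
    DegLe (actP w p) n :=
  hp.bind₁ fun _ => degLe_lin _

lemma DegLe.trP_sub {p : MvPolynomial ι ℂ} {n : ℤ} (hp : DegLe p n) (v : ι → ℂ) :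
    DegLe (Knop.trP v p - p) (n - 1) := by
  refine (DegLe.induct (Q := fun p n => DegLe p n ∧ DegLe (Knop.trP v p - p) (n - 1))
    ?_ ?_ ?_ ?_ ?_ ?_ hp).2
  · intro c
    refine ⟨degLe_C c, ?_⟩
    simp [Knop.trP, degLe_zero]
  · intro i
    refine ⟨degLe_X i, ?_⟩
    simpa [Knop.trP] using degLe_C (v i)
  · rintro p q n m ⟨hp, hp'⟩ ⟨hq, hq'⟩
    refine ⟨hp.mul hq, ?_⟩
    have : Knop.trP v (p * q) - p * q = (Knop.trP v p - p) * Knop.trP v q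
        + p * (Knop.trP v q - q) := by
      rw [map_mul]; ring
    rw [this]
    exact ((hp'.mul (hq.trP v)).mono (by omega)).add ((hp.mul hq').mono (by omega))
  · rintro p q n ⟨hp, hp'⟩ ⟨hq, hq'⟩
    refine ⟨hp.add hq, ?_⟩
    rw [map_add, add_sub_add_comm]
    exact hp'.add hq'
  · rintro p n m ⟨hp, hp'⟩ h
    exact ⟨hp.mono h, hp'.mono (by omega)⟩
  · intro n
    simp [degLe_zero]

lemma DegLe.of_mul {p q : MvPolynomial ι ℂ} {n : ℤ} (hq : q ≠ 0)
    (h : DegLe (p * q) (n + q.totalDegree)) : DegLe p n := by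
  by_cases hp : p = 0
  · exact Or.inl hp
  rcases h with h | h
  · simp [hp, hq] at h
  · right
    rw [totalDegree_mul_of_isDomain hp hq] at h
    push_cast at h
    omega

/-! ### Divisibility by products of linear forms -/

/-- Projection along the `i`-th coordinate to the hyperplane `γ = 0`. -/
def hypProj (γ : ι → ℤ) (i : ι) : MvPolynomial ι ℂ →ₐ[ℂ] MvPolynomial ι ℂ :=
  bind₁ fun j => X j - if j = i then C (γ i : ℂ)⁻¹ * lin γ else 0

lemma eval_hypProj (γ : ι → ℤ) (i : ι) (p : MvPolynomial ι ℂ) (z : ι → ℂ) :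
    eval z (hypProj γ i p) =
      eval (fun j => z j - if j = i then (γ i : ℂ)⁻¹ * evalC γ z else 0) p := by
  rw [hypProj, eval_bind₁']
  congr 2
  ext j
  split_ifs with h <;> simp [h]

lemma eval_hypProj_of_zero {γ : ι → ℤ} (i : ι) (p : MvPolynomial ι ℂ) {z : ι → ℂ}
    (hz : evalC γ z = 0) : eval z (hypProj γ i p) = eval z p := by
  rw [eval_hypProj]
  congr 2
  ext j
  simp [hz]

lemma lin_dvd_of_hypProj {γ : ι → ℤ} {i : ι} {p : MvPolynomial ι ℂ} (h : hypProj γ i p = 0) :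
    lin γ ∣ p := by
  have key : (Ideal.Quotient.mkₐ ℂ (Ideal.span {lin γ})).comp (hypProj γ i)
      = Ideal.Quotient.mkₐ ℂ (Ideal.span {lin γ}) := by
    apply MvPolynomial.algHom_ext
    intro j
    simp only [AlgHom.comp_apply, hypProj, bind₁_X_right, map_sub]
    have : Ideal.Quotient.mkₐ ℂ (Ideal.span {lin γ})
        (if j = i then C (γ i : ℂ)⁻¹ * lin γ else 0) = 0 := by
      rw [Ideal.Quotient.mkₐ_eq_mk, Ideal.Quotient.eq_zero_iff_mem]
      split_ifs
      · exact Ideal.mul_mem_left _ _ (Ideal.mem_span_singleton_self _)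
      · exact Ideal.zero_mem _
    rw [this, sub_zero]
  have := DFunLike.congr_fun key p
  rw [AlgHom.comp_apply, h, map_zero, eq_comm, Ideal.Quotient.mkₐ_eq_mk,
    Ideal.Quotient.eq_zero_iff_mem, Ideal.mem_span_singleton] at this
  exact this

lemma hypProj_eq_zero {γ : ι → ℤ} {i : ι} (hi : γ i ≠ 0) {p : MvPolynomial ι ℂ}
    (h : ∀ z, evalC γ z = 0 → eval z p = 0) : hypProj γ i p = 0 := by
  apply MvPolynomial.funext
  intro z
  rw [eval_hypProj, map_zero]
  apply h
  have hi' : (γ i : ℂ) ≠ 0 := by exact_mod_cast hi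
  have : (fun j => z j - if j = i then (γ i : ℂ)⁻¹ * evalC γ z else 0)
      = z - ((γ i : ℂ)⁻¹ * evalC γ z) • toV (e i) := by
    ext j
    by_cases hj : j = i
    · subst hj
      simp [toV, e]
    · simp [toV, e, hj]
  rw [this, evalC_sub_right, evalC_smul_right, evalC_toV, pairZ_e_right]
  field_simp
  ring

/-- The linear forms in `S` have pairwise distinct kernels. -/
def SepForms (S : Finset (ι → ℤ)) : Prop :=
  (∀ γ ∈ S, γ ≠ 0) ∧
    ∀ γ ∈ S, ∀ γ' ∈ S, γ ≠ γ' → ∃ z : ι → ℂ, evalC γ z = 0 ∧ evalC γ' z ≠ 0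

lemma SepForms.subset {S T : Finset (ι → ℤ)} (hS : SepForms S) (h : T ⊆ S) : SepForms T :=
  ⟨fun γ hγ => hS.1 γ (h hγ), fun γ hγ γ' hγ' => hS.2 γ (h hγ) γ' (h hγ')⟩

lemma prod_lin_dvd {S : Finset (ι → ℤ)} (hS : SepForms S) {p : MvPolynomial ι ℂ}
    (h : ∀ γ ∈ S, ∀ z, evalC γ z = 0 → eval z p = 0) : (∏ γ ∈ S, lin γ) ∣ p := by
  induction S using Finset.induction_on with
  | empty => simp
  | insert γ S hγ ih =>
    obtain ⟨Q, hQ⟩ := ih (hS.subset (by simp)) fun γ' hγ' => h γ' (by simp [hγ'])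
    obtain ⟨i, hi⟩ : ∃ i, γ i ≠ 0 := by
      by_contra! hcon
      exact hS.1 γ (by simp) (_root_.funext hcon)
    have h0 := hypProj_eq_zero hi (h γ (by simp))
    rw [hQ, map_mul, mul_eq_zero] at h0
    have h1 : hypProj γ i (∏ γ' ∈ S, lin γ') ≠ 0 := by
      rw [map_prod, Finset.prod_ne_zero_iff]
      intro γ' hγ' hcon
      obtain ⟨z, hz, hz'⟩ := hS.2 γ (by simp) γ' (by simp [hγ'])
        (fun heq => hγ (heq ▸ hγ'))
      apply hz'
      rw [← eval_lin, ← eval_hypProj_of_zero i _ hz, hcon, map_zero]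
    obtain ⟨Q', hQ'⟩ := lin_dvd_of_hypProj (h0.resolve_left h1)
    exact ⟨Q', by rw [Finset.prod_insert hγ, hQ, hQ']; ring⟩

/-- A lattice vector which is not a proper multiple. -/
def Prim (γ : ι → ℤ) : Prop := ∀ (n : ℤ) (β : ι → ℤ), γ = n • β → IsUnit n

lemma Prim.ne_zero {γ : ι → ℤ} (h : Prim γ) : γ ≠ 0 := fun h0 => by
  have := h 0 0 (by simp [h0])
  simp at this

lemma Prim.exists_sep {γ γ' : ι → ℤ} (h : Prim γ) (h' : Prim γ') (h1 : γ' ≠ γ) (h2 : γ' ≠ -γ) :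
    ∃ z : ι → ℂ, evalC γ z = 0 ∧ evalC γ' z ≠ 0 := by
  by_contra! hcon
  obtain ⟨i, hi⟩ : ∃ i, γ i ≠ 0 := by
    by_contra! hcon
    exact h.ne_zero (_root_.funext hcon)
  have key : ∀ j, γ i * γ' j = γ' i * γ j := by
    intro j
    have := hcon (toV (γ i • e j - γ j • e i)) (by
      rw [evalC_toV, pairZ_sub_right, pairZ_smul_right, pairZ_smul_right, pairZ_e_right,
        pairZ_e_right, mul_comm, sub_self, Int.cast_zero])
    rw [evalC_toV, pairZ_sub_right, pairZ_smul_right, pairZ_smul_right, pairZ_e_right,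
        pairZ_e_right] at this
    have : γ i * γ' j - γ j * γ' i = 0 := by exact_mod_cast this
    linarith [mul_comm (γ j) (γ' i)]
  obtain ⟨g, a, b, hg, hab, ha, hb⟩ :
      ∃ g a b : ℤ, g ≠ 0 ∧ IsCoprime a b ∧ γ i = a * g ∧ γ' i = b * g := by
    have hg : (Int.gcd (γ i) (γ' i) : ℤ) ≠ 0 := by
      simp [Int.gcd_eq_zero_iff, hi]
    have hg' : 0 < Int.gcd (γ i) (γ' i) := by
      have : Int.gcd (γ i) (γ' i) ≠ 0 := by exact_mod_cast hg
      omega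
    obtain ⟨a, b, hab, ha, hb⟩ := Int.exists_gcd_one hg'
    exact ⟨_, a, b, hg, Int.isCoprime_iff_gcd_eq_one.2 hab, ha, hb⟩
  have key' : ∀ j, a * γ' j = b * γ j := by
    intro j
    have := key j
    rw [ha, hb] at this
    apply mul_left_cancel₀ hg
    linarith
  have hau : IsUnit a := by
    have : ∀ j, ∃ c, γ j = a * c := fun j => (hab.dvd_of_dvd_mul_left ⟨γ' j, (key' j).symm⟩)
    choose c hc using this
    exact h a c (_root_.funext fun j => by simp [hc j])
  have hbu : IsUnit b := by
    have : ∀ j, ∃ c, γ' j = b * c := fun j => (hab.symm.dvd_of_dvd_mul_left ⟨γ j, key' j⟩)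
    choose c hc using this
    exact h' b c (_root_.funext fun j => by simp [hc j])
  rcases Int.isUnit_iff.1 hau with rfl | rfl <;> rcases Int.isUnit_iff.1 hbu with rfl | rfl
  · exact h1 (_root_.funext fun j => by simpa using key' j)
  · exact h2 (_root_.funext fun j => by simpa using key' j)
  · exact h2 (_root_.funext fun j => by have := key' j; simp at this ⊢; omega)
  · exact h1 (_root_.funext fun j => by simpa using key' j)

/-! ### Generic points -/

lemma exists_not_root {κ : Type*} [Countable κ] (q : κ → Polynomial ℂ) (hq : ∀ j, q j ≠ 0) :
    ∃ t : ℂ, ∀ j, (q j).eval t ≠ 0 := by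
  by_contra! hcon
  have : (Set.univ : Set ℂ) ⊆ ⋃ j, ((q j).roots.toFinset : Set ℂ) := by
    intro t _
    obtain ⟨j, hj⟩ := hcon t
    exact Set.mem_iUnion.2 ⟨j, by simp [hq j, hj]⟩
  exact not_countable_complex
    ((Set.countable_iUnion fun j => (Finset.countable_toSet _)).mono this)

/-- Restriction of a polynomial to a line. -/
def lineP (a b : ι → ℂ) (p : MvPolynomial ι ℂ) : Polynomial ℂ :=
  aeval (fun i => Polynomial.C (a i) + Polynomial.X * Polynomial.C (b i)) p

lemma eval_lineP (a b : ι → ℂ) (p : MvPolynomial ι ℂ) (t : ℂ) :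
    (lineP a b p).eval t = eval (a + t • b) p := by
  have : (Polynomial.aeval t).comp
      (aeval fun i => Polynomial.C (a i) + Polynomial.X * Polynomial.C (b i))
      = (aeval (a + t • b) : MvPolynomial ι ℂ →ₐ[ℂ] ℂ) := by
    apply MvPolynomial.algHom_ext
    intro i
    simp
    ring
  have := DFunLike.congr_fun this p
  simpa [lineP, Polynomial.coe_aeval_eq_eval, coe_aeval_eq_eval] using this

lemma exists_pos_generic (F : Finset (ι → ℤ)) (hF : ∀ γ ∈ F, γ ≠ 0) :
    ∃ ν : ι → ℤ, (∀ i, 0 < ν i) ∧ ∀ γ ∈ F, pairZ γ ν ≠ 0 := by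
  induction F using Finset.induction_on with
  | empty => exact ⟨fun _ => 1, by simp, by simp⟩
  | insert γ F hγ ih =>
    obtain ⟨ν, hν, hνF⟩ := ih fun γ' h => hF γ' (by simp [h])
    obtain ⟨i, hi⟩ : ∃ i, γ i ≠ 0 := by
      by_contra! hcon
      exact hF γ (by simp) (_root_.funext hcon)
    obtain ⟨m, hm⟩ : ∃ m : ℤ, 0 < m ∧ ∀ γ' ∈ F, |γ' i| < m := by
      refine ⟨1 + ∑ γ' ∈ F, |γ' i|, ?_, ?_⟩
      · have := Finset.sum_nonneg fun γ' (_ : γ' ∈ F) => abs_nonneg (γ' i)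
        omega
      · intro γ' h
        have := Finset.single_le_sum (f := fun γ' : ι → ℤ => |γ' i|)
          (fun γ' _ => abs_nonneg (γ' i)) h
        omega
    have hpos : ∀ m' : ℤ, 0 < m' → ∀ j, 0 < (m' • ν + e i) j := by
      intro m' hm' j
      have h1 := mul_pos hm' (hν j)
      have h2 : 0 ≤ e i j := by
        simp only [e, Pi.single_apply]; split_ifs <;> norm_num
      simp only [Pi.add_apply, Pi.smul_apply, smul_eq_mul]
      omega
    have hne : ∀ m' : ℤ, m ≤ m' → ∀ γ' ∈ F, pairZ γ' (m' • ν + e i) ≠ 0 := by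
      intro m' hm' γ' h h0
      rw [pairZ_add_right, pairZ_smul_right, pairZ_e_right] at h0
      have h1 := hm.2 γ' h
      have h2 : |m' * pairZ γ' ν| = |γ' i| := by rw [eq_neg_of_add_eq_zero_left h0, abs_neg]
      rw [abs_mul] at h2
      have h3 := Int.one_le_abs (hνF γ' h)
      have h4 : m' ≤ |m'| := le_abs_self m'
      nlinarith [abs_nonneg m']
    by_cases h : pairZ γ (m • ν + e i) = 0
    · refine ⟨(m + 1) • ν + e i, hpos _ (by omega), ?_⟩
      intro γ' hγ'
      rcases Finset.mem_insert.1 hγ' with rfl | hγ'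
      · intro h0
        rw [pairZ_add_right, pairZ_smul_right, pairZ_e_right] at h h0
        have : pairZ γ' ν = 0 := by linarith
        rw [this] at h
        simp at h
        exact hi h
      · exact hne _ (by omega) _ hγ'
    · refine ⟨m • ν + e i, hpos _ hm.1, ?_⟩
      intro γ' hmem
      rcases Finset.mem_insert.1 hmem with rfl | hmem
      · exact h
      · exact hne _ le_rfl _ hmem

/-- Points avoiding the integral hyperplanes of the forms in `S`. -/
def NonInt (S : Finset (ι → ℤ)) (z : ι → ℂ) : Prop := ∀ γ ∈ S, ∀ n : ℤ, evalC γ z ≠ n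

lemma exists_nonInt_eval_ne_zero {S : Finset (ι → ℤ)} (hS : ∀ γ ∈ S, γ ≠ 0)
    {q : MvPolynomial ι ℂ} (hq : q ≠ 0) : ∃ z, NonInt S z ∧ eval z q ≠ 0 := by
  obtain ⟨ν, -, hν⟩ := exists_pos_generic S hS
  obtain ⟨v, hv⟩ : ∃ v, eval v q ≠ 0 := by
    by_contra! hcon
    exact hq (MvPolynomial.funext fun z => by simpa using hcon z)
  set z₀ : ι → ℂ := Complex.I • toV ν
  let fam : Option (S × ℤ) → MvPolynomial ι ℂ := fun o =>
    o.elim q fun x => lin x.1.1 - C (x.2 : ℂ)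
  obtain ⟨t, ht⟩ := exists_not_root (fun o => lineP v (z₀ - v) (fam o)) (by
    rintro (_ | ⟨⟨γ, hγ⟩, n⟩) h0
    · have := eval_lineP v (z₀ - v) q 0
      simp only [fam, Option.elim] at h0
      rw [h0] at this
      simp at this
      exact hv this.symm
    · have := eval_lineP v (z₀ - v) (fam (some (⟨γ, hγ⟩, n))) 1
      rw [h0] at this
      simp only [fam, Option.elim, one_smul, add_sub_cancel, Polynomial.eval_zero, map_sub,
        eval_lin, eval_C, z₀, evalC_smul_right, evalC_toV] at this
      have him := congrArg Complex.im this
      simp at him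
      exact hν γ hγ (by exact_mod_cast him.symm))
  refine ⟨v + t • (z₀ - v), ?_, ?_⟩
  · intro γ hγ n h
    apply ht (some (⟨γ, hγ⟩, n))
    rw [eval_lineP]
    simp [fam, h]
  · have := ht none
    rwa [eval_lineP] at this

lemma eq_zero_of_nonInt {S : Finset (ι → ℤ)} (hS : ∀ γ ∈ S, γ ≠ 0)
    {q : MvPolynomial ι ℂ} (h : ∀ z, NonInt S z → eval z q = 0) : q = 0 := by
  by_contra hq
  obtain ⟨z, hz, hz'⟩ := exists_nonInt_eval_ne_zero hS hq
  exact hz' (h z hz)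

lemma NonInt.sub_toV {S : Finset (ι → ℤ)} {z : ι → ℂ} (hz : NonInt S z) (τ : ι → ℤ) :
    NonInt S (z - toV τ) := by
  intro γ hγ n h
  rw [evalC_sub_right, evalC_toV, sub_eq_iff_eq_add] at h
  exact hz γ hγ (n + pairZ γ τ) (by push_cast; exact h)

lemma NonInt.add_toV {S : Finset (ι → ℤ)} {z : ι → ℂ} (hz : NonInt S z) (τ : ι → ℤ) :
    NonInt S (z + toV τ) := by
  have := hz.sub_toV (-τ)
  rwa [toV_neg, sub_neg_eq_add] at this

lemma NonInt.ne_zero {S : Finset (ι → ℤ)} {z : ι → ℂ} (hz : NonInt S z) {γ : ι → ℤ}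
    (hγ : γ ∈ S) : evalC γ z ≠ 0 := by
  simpa using hz γ hγ 0

/-! ### Basic facts on the data -/

namespace Data

variable (D : Data ι)

/-- The group `W` as a finset. -/
def Wf : Finset (LatAut ι) := D.W_finite.toFinset

lemma mem_Wf {w : LatAut ι} : w ∈ D.Wf ↔ w ∈ D.W := by simp [Wf]

/-- The `W`-saturation of the set of roots. -/
def R : Finset (ι → ℤ) := (D.Wf ×ˢ D.Δ).image fun x => x.1 x.2

variable {D}

lemma mem_R {γ : ι → ℤ} : γ ∈ D.R ↔ ∃ w ∈ D.W, ∃ α ∈ D.Δ, γ = w α := by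
  simp only [R, Finset.mem_image, Finset.mem_product, mem_Wf, Prod.exists]
  constructor
  · rintro ⟨w, α, ⟨hw, hα⟩, rfl⟩
    exact ⟨w, hw, α, hα, rfl⟩
  · rintro ⟨w, hw, α, hα, rfl⟩
    exact ⟨w, α, ⟨hw, hα⟩, rfl⟩

lemma Δ_subset_R : D.Δ ⊆ D.R := fun α hα => mem_R.2 ⟨1, D.W.one_mem, α, hα, rfl⟩

lemma map_mem_R {w : LatAut ι} (hw : w ∈ D.W) {γ : ι → ℤ} (hγ : γ ∈ D.R) : w γ ∈ D.R := by
  obtain ⟨u, hu, α, hα, rfl⟩ := mem_R.1 hγ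
  exact mem_R.2 ⟨w * u, D.W.mul_mem hw hu, α, hα, rfl⟩

lemma symm_mem {w : LatAut ι} (hw : w ∈ D.W) : w.symm ∈ D.W := D.W.inv_mem hw

lemma neg_mem_R {γ : ι → ℤ} (hγ : γ ∈ D.R) : -γ ∈ D.R := by
  obtain ⟨u, hu, α, hα, rfl⟩ := mem_R.1 hγ
  exact mem_R.2 ⟨u, hu, -α, D.Δ_neg α hα, by simp⟩

lemma prim_of_mem_R {γ : ι → ℤ} (hγ : γ ∈ D.R) : Prim γ := by
  obtain ⟨u, hu, α, hα, rfl⟩ := mem_R.1 hγ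
  intro n β h
  refine D.Δ_prim α hα n (u.symm β) ?_
  rw [← map_smul, ← h, LinearEquiv.symm_apply_apply]

lemma ne_zero_of_mem_R {γ : ι → ℤ} (hγ : γ ∈ D.R) : γ ≠ 0 := (prim_of_mem_R hγ).ne_zero

lemma sepForms_of_subset_R {S : Finset (ι → ℤ)} (hS : S ⊆ D.R) (h : ∀ γ ∈ S, -γ ∉ S) :
    SepForms S :=
  ⟨fun _ hγ => ne_zero_of_mem_R (hS hγ), fun γ hγ _ hmem hne =>
    (prim_of_mem_R (hS hγ)).exists_sep (prim_of_mem_R (hS hmem)) hne.symm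
      fun h' => h γ hγ (h' ▸ hmem)⟩

/-- `s` is the reflection with root `γ` and coroot `δ`. -/
structure IsRefl (s : LatAut ι) (γ δ : ι → ℤ) : Prop where
  apply : ∀ x, s x = x - pairZ x δ • γ
  pair : pairZ γ δ = 2

lemma exists_refl {γ : ι → ℤ} (hγ : γ ∈ D.R) : ∃ s ∈ D.W, ∃ δ, IsRefl s γ δ := by
  obtain ⟨u, hu, α, hα, rfl⟩ := mem_R.1 hγ
  obtain ⟨s, hs, hs'⟩ := D.refl_mem α hα
  refine ⟨u * s * u⁻¹, D.W.mul_mem (D.W.mul_mem hu hs) (D.W.inv_mem hu),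
    actDual u (D.coroot α), ?_, ?_⟩
  · intro x
    have : (u * s * u⁻¹) x = u (s (u⁻¹ x)) := rfl
    rw [this, hs', reflMap, map_sub, map_smul, apply_inv_self', pairZ_actDual, symm_eq_inv]
  · rw [pairZ_actDual, LinearEquiv.symm_apply_apply]
    exact D.coroot_pair α hα

namespace IsRefl

variable {s : LatAut ι} {γ δ : ι → ℤ} (h : IsRefl s γ δ)
include h

lemma apply_apply (x : ι → ℤ) : s (s x) = x := by
  rw [h.apply (s x), h.apply x, pairZ_sub, pairZ_smul, h.pair]
  module

lemma symm_eq : s.symm = s := by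
  ext1 x
  rw [LinearEquiv.symm_apply_eq, h.apply_apply]

lemma apply_root : s γ = -γ := by
  rw [h.apply, h.pair]
  module

lemma actV (z : ι → ℂ) : Knop.actV s z = z - evalC γ z • toV δ := by
  refine vec_ext fun x => ?_
  rw [evalC_actV, h.symm_eq, h.apply, evalC_sub, evalC_smul, evalC_sub_right, evalC_smul_right,
    evalC_toV, mul_comm]

lemma actDual (z : ι → ℤ) : Knop.actDual s z = z - pairZ γ z • δ := by
  refine dual_ext fun x => ?_
  rw [pairZ_actDual, h.symm_eq, h.apply, pairZ_sub, pairZ_smul, pairZ_sub_right, pairZ_smul_right,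
    mul_comm]

end IsRefl

lemma symm_ell {w : LatAut ι} (hw : w ∈ D.W) : w.symm D.ell = D.ell := D.C4 _ (symm_mem hw)

lemma ell_actDual {w : LatAut ι} (hw : w ∈ D.W) (η : ι → ℤ) :
    pairZ D.ell (actDual w η) = pairZ D.ell η := by
  rw [pairZ_actDual, symm_ell hw]

lemma e_mem_Φ (i : ι) : e i ∈ D.Φ := (D.Φ_spec _).2 ⟨1, D.W.one_mem, i, rfl⟩

lemma map_mem_Φ {w : LatAut ι} (hw : w ∈ D.W) {ω : ι → ℤ} (hω : ω ∈ D.Φ) : w ω ∈ D.Φ := by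
  obtain ⟨u, hu, i, rfl⟩ := (D.Φ_spec _).1 hω
  exact (D.Φ_spec _).2 ⟨w * u, D.W.mul_mem hw hu, i, rfl⟩

lemma ne_zero_of_mem_Φ {ω : ι → ℤ} (hω : ω ∈ D.Φ) : ω ≠ 0 := by
  obtain ⟨u, hu, i, rfl⟩ := (D.Φ_spec _).1 hω
  intro h
  rw [map_eq_zero_iff _ u.injective] at h
  simpa [e] using congrFun h i

lemma actDual_mem_Λ₁ {w : LatAut ι} (hw : w ∈ D.W) {η : ι → ℤ} (hη : η ∈ D.Λ₁) :
    actDual w η ∈ D.Λ₁ := by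
  obtain ⟨u, hu, i, hi, rfl⟩ := (D.Λ₁_spec _).1 hη
  exact (D.Λ₁_spec _).2 ⟨w * u, D.W.mul_mem hw hu, i, hi, (actDual_mul _ _ _).symm⟩

lemma ell_of_mem_Λ₁ {η : ι → ℤ} (hη : η ∈ D.Λ₁) : pairZ D.ell η = 1 := by
  obtain ⟨u, hu, i, hi, rfl⟩ := (D.Λ₁_spec _).1 hη
  rw [ell_actDual hu, pairZ_e_right, hi]

lemma pair_of_mem_Λ₁ {η : ι → ℤ} (hη : η ∈ D.Λ₁) {ω : ι → ℤ} (hω : ω ∈ D.Φ) :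
    pairZ ω η = -1 ∨ pairZ ω η = 0 ∨ pairZ ω η = 1 := by
  obtain ⟨u, hu, i, hi, rfl⟩ := (D.Λ₁_spec _).1 hη
  rw [pairZ_actDual, pairZ_e_right]
  exact D.C7 i hi _ (Or.inr (map_mem_Φ (symm_mem hu) hω))

lemma IsK.map {ρ : ι → ℂ} {k : (ι → ℤ) → ℂ} (hk : D.IsK ρ k) {w : LatAut ι} (hw : w ∈ D.W) {i : ι} :
    k (w (e i)) = ρ i :=
  hk _ i ⟨w⁻¹, D.W.inv_mem hw, Or.inl (inv_apply_self' _ _).symm⟩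

lemma IsK.map_eq {ρ : ι → ℂ} {k : (ι → ℤ) → ℂ} (hk : D.IsK ρ k) {w : LatAut ι} (hw : w ∈ D.W)
    {ω : ι → ℤ} (hω : ω ∈ D.Φ) : k (w ω) = k ω := by
  obtain ⟨u, hu, i, rfl⟩ := (D.Φ_spec _).1 hω
  rw [hk.map hu]
  exact hk.map (w := w * u) (D.W.mul_mem hw hu)

lemma IsK.e {ρ : ι → ℂ} {k : (ι → ℤ) → ℂ} (hk : D.IsK ρ k) (i : ι) : k (e i) = ρ i :=
  hk.map (w := 1) D.W.one_mem

lemma nonneg_sum_one {x : ι → ℤ} (h0 : ∀ i, 0 ≤ x i) (h1 : ∑ i, x i = 1) : ∃ i, x = e i := by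
  obtain ⟨i, -, hi⟩ : ∃ i ∈ Finset.univ, x i ≠ 0 := Finset.exists_ne_zero_of_sum_ne_zero
    (by rw [h1]; norm_num)
  refine ⟨i, ?_⟩
  have hsplit := Finset.add_sum_erase Finset.univ x (Finset.mem_univ i)
  have hnn : 0 ≤ ∑ j ∈ Finset.univ.erase i, x j := Finset.sum_nonneg fun j _ => h0 j
  have hi1 : x i = 1 := by have := h0 i; omega
  have hz : ∑ j ∈ Finset.univ.erase i, x j = 0 := by omega
  rw [Finset.sum_eq_zero_iff_of_nonneg fun j _ => h0 j] at hz
  ext j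
  by_cases hj : j = i
  · subst hj; simp [Knop.e, hi1]
  · simp [Knop.e, hj, hz j (by simp [hj])]

/-- The existence part of the interpolation property at `ρ`. -/
def Exist (D : Data ι) (ρ : ι → ℂ) : Prop := ∀ lam ∈ LamPlus, ∃ p, D.CapelliAt ρ lam p

lemma pairZ_nonneg {x y : ι → ℤ} (hx : ∀ i, 0 ≤ x i) (hy : ∀ i, 0 ≤ y i) : 0 ≤ pairZ x y :=
  Finset.sum_nonneg fun i _ => mul_nonneg (hx i) (hy i)

lemma e_nonneg (i j : ι) : 0 ≤ (Knop.e i : ι → ℤ) j := by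
  simp only [Knop.e, Pi.single_apply]; split_ifs <;> norm_num

/-- An involution in `W` permuting the basis and moving some dual basis vector
contradicts interpolation. -/
lemma actDual_e_eq_of_perm {ρ : ι → ℂ} (hρ : D.InV0 ρ) (hE : D.Exist ρ)
    {s : LatAut ι} (hs : s ∈ D.W) (hss : s.symm = s) (hperm : ∀ m, ∃ k, s (Knop.e m) = Knop.e k)
    (m : ι) : actDual s (Knop.e m) = Knop.e m := by
  by_contra hne
  have hfix : Knop.actV s ρ = ρ := by
    ext i
    rw [← evalC_e i (Knop.actV s ρ), evalC_actV, hss]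
    obtain ⟨k, hk⟩ := hperm i
    rw [hk, evalC_e]
    exact hρ k i ⟨s, hs, Or.inl hk.symm⟩
  have hmu : actDual s (Knop.e m) ∈ (LamPlus : Set (ι → ℤ)) := by
    intro i
    rw [actDual, hss]
    obtain ⟨k, hk⟩ := hperm i
    rw [hk, pairZ_e]
    exact e_nonneg _ _
  obtain ⟨p, hp1, hp2, hp3⟩ := hE (Knop.e m) (fun i => e_nonneg _ _)
  have h1 := hp3 _ hmu (ell_actDual hs _).le
  rw [if_neg hne, toV_actDual] at h1
  have h2 := hp3 (Knop.e m) (fun i => e_nonneg _ _) le_rfl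
  rw [if_pos rfl, ← hp1 s hs, actV_add, hfix, h1] at h2
  exact zero_ne_one h2

lemma one_signed {ρ : ι → ℂ} (hρ : D.InV0 ρ) (hE : D.Exist ρ) {γ : ι → ℤ} (hγ : γ ∈ D.R) :
    (∀ i, 0 ≤ γ i) ∨ (∀ i, γ i ≤ 0) := by
  by_contra! hcon
  obtain ⟨⟨j, hj⟩, i, hi⟩ := hcon
  obtain ⟨s, hs, δ, hsr⟩ := exists_refl hγ
  obtain ⟨lam, hlam, hγlam⟩ : ∃ lam : ι → ℤ, (∀ m, 0 < lam m) ∧ pairZ γ lam = 0 := by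
    set v := pairZ γ (fun _ => 1) with hv
    rcases le_or_gt 0 v with h | h
    · refine ⟨(-γ j) • (fun _ => 1) + v • Knop.e j, fun m => ?_, ?_⟩
      · have := mul_nonneg h (e_nonneg j m)
        simp only [Pi.add_apply, Pi.smul_apply, smul_eq_mul]
        omega
      · rw [pairZ_add_right, pairZ_smul_right, pairZ_smul_right, pairZ_e_right, ← hv]
        ring
    · refine ⟨(γ i) • (fun _ => 1) + (-v) • Knop.e i, fun m => ?_, ?_⟩
      · have := mul_nonneg (neg_nonneg.2 h.le) (e_nonneg i m)
        simp only [Pi.add_apply, Pi.smul_apply, smul_eq_mul]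
        omega
      · rw [pairZ_add_right, pairZ_smul_right, pairZ_smul_right, pairZ_e_right, ← hv]
        ring
  have hnn : ∀ m, (∀ i, 0 ≤ s (Knop.e m) i) := by
    intro m
    rcases D.C3 _ (map_mem_Φ hs (e_mem_Φ m)) with h | h
    · exact h
    · have h1 : pairZ (s (Knop.e m)) lam = lam m := by
        rw [hsr.apply, pairZ_sub, pairZ_smul, hγlam, pairZ_e]
        ring
      have h2 : 0 ≤ pairZ (-(s (Knop.e m))) lam :=
        pairZ_nonneg (fun i => by simpa using h i) fun i => (hlam i).le
      rw [pairZ_neg, h1] at h2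
      have := hlam m
      omega
  have hsum : ∀ x : ι → ℤ, pairZ x (fun _ => 1) = ∑ i, x i := fun x => by simp [pairZ]
  have hpos : ∀ m, 1 ≤ ∑ i, s (Knop.e m) i := by
    intro m
    have h0 : 0 ≤ ∑ i, s (Knop.e m) i := Finset.sum_nonneg fun i _ => hnn m i
    rcases h0.lt_or_eq with h | h
    · omega
    · exfalso
      rw [eq_comm, Finset.sum_eq_zero_iff_of_nonneg fun i _ => hnn m i] at h
      exact ne_zero_of_mem_Φ (map_mem_Φ hs (e_mem_Φ m)) (_root_.funext fun i => h i (by simp))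
  have hperm : ∀ m, ∃ k, s (Knop.e m) = Knop.e k := by
    intro m
    refine nonneg_sum_one (hnn m) (le_antisymm ?_ (hpos m))
    have h1 : pairZ (s (s (Knop.e m))) (fun _ => 1) = 1 := by
      rw [hsr.apply_apply, pairZ_e]
    rw [pairZ_map] at h1
    rw [← h1]
    refine Finset.sum_le_sum fun i _ => ?_
    rw [hsum]
    exact le_mul_of_one_le_right (hnn m i) (hpos i)
  have h1 := actDual_e_eq_of_perm hρ hE hs hsr.symm_eq hperm i
  rw [hsr.actDual, pairZ_e_right, sub_eq_self, smul_eq_zero] at h1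
  rcases h1 with h1 | h1
  · omega
  · have := hsr.pair
    rw [h1] at this
    simp at this

end Data

/-! ### Interpolation -/

namespace Data

variable {D : Data ι}

lemma WInv.add {p q : MvPolynomial ι ℂ} (hp : D.WInv p) (hq : D.WInv q) : D.WInv (p + q) :=
  fun w hw z => by rw [map_add, map_add, hp w hw, hq w hw]

lemma WInv.mul {p q : MvPolynomial ι ℂ} (hp : D.WInv p) (hq : D.WInv q) : D.WInv (p * q) :=
  fun w hw z => by rw [map_mul, map_mul, hp w hw, hq w hw]

lemma wInv_C (c : ℂ) : D.WInv (C c) := fun w _ z => by simp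

lemma WInv.C_mul {p : MvPolynomial ι ℂ} (hp : D.WInv p) (c : ℂ) : D.WInv (C c * p) :=
  (wInv_C c).mul hp

lemma WInv.sub {p q : MvPolynomial ι ℂ} (hp : D.WInv p) (hq : D.WInv q) : D.WInv (p - q) :=
  fun w hw z => by rw [map_sub, map_sub, hp w hw, hq w hw]

lemma WInv.sum {κ : Type*} (s : Finset κ) {g : κ → MvPolynomial ι ℂ}
    (h : ∀ j ∈ s, D.WInv (g j)) : D.WInv (∑ j ∈ s, g j) :=
  fun w hw z => by
    rw [map_sum, map_sum]
    exact Finset.sum_congr rfl fun j hj => h j hj w hw z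

lemma wInv_ell : D.WInv (lin D.ell) := fun w hw z => by
  rw [eval_lin, eval_lin, evalC_actV, symm_ell hw]

/-- The uniqueness part of the interpolation property at `ρ`. -/
def Uniq (D : Data ι) (ρ : ι → ℂ) : Prop :=
  ∀ (N : ℤ) (q : MvPolynomial ι ℂ), D.WInv q → DegLe q N →
    (∀ μ ∈ LamPlus, pairZ D.ell μ ≤ N → eval (ρ + toV μ) q = 0) → q = 0

lemma ell_nonneg {μ : ι → ℤ} (hμ : μ ∈ LamPlus) : 0 ≤ pairZ D.ell μ :=
  pairZ_nonneg (fun i => (D.C6 i).le) hμ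

lemma exists_ell_eq_one [Nonempty ι] : ∃ i, D.ell i = 1 := by
  by_contra! hcon
  have := D.C8 (fun i => (D.ell i : ℂ)) 0
    (fun w hw z => by
      have := evalC_actV w D.ell z
      rwa [symm_ell hw] at this)
    (fun w hw z => by simp) (fun i hi => absurd hi (hcon i))
  obtain ⟨i⟩ := ‹Nonempty ι›
  have h := congrFun this i
  have := D.C6 i
  simp at h
  omega

lemma exists_ell_eq (n : ℕ) (q : MvPolynomial ι ℂ) (hq : q.totalDegree = n) :
    ∃ lam ∈ LamPlus, pairZ D.ell lam = n := by
  rcases n.eq_zero_or_pos with rfl | hn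
  · exact ⟨0, fun i => le_rfl, by simp⟩
  · have : Nonempty ι := by
      by_contra h
      rw [not_nonempty_iff] at h
      have := totalDegree_eq_zero_iff_eq_C.2 (eq_C_of_isEmpty q)
      omega
    obtain ⟨i, hi⟩ := exists_ell_eq_one (D := D)
    refine ⟨(n : ℤ) • Knop.e i, fun j => ?_, ?_⟩
    · simpa using mul_nonneg (Int.natCast_nonneg n) (e_nonneg i j)
    · rw [pairZ_smul_right, pairZ_e_right, hi, mul_one]

lemma exist_and_uniq_of_C0 {ρ : ι → ℂ}
    (h : ∀ lam : ι → ℤ, lam ∈ LamPlus →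
      ∃! p : MvPolynomial ι ℂ, D.WInv p ∧
        p.totalDegree = (pairZ D.ell lam).toNat ∧
        ∀ μ : ι → ℤ, μ ∈ LamPlus → pairZ D.ell μ ≤ pairZ D.ell lam →
          eval (ρ + toV μ) p = if μ = lam then 1 else 0) :
    D.Exist ρ ∧ D.Uniq ρ := by
  constructor
  · intro lam hlam
    obtain ⟨p, ⟨h1, h2, h3⟩, -⟩ := h lam hlam
    exact ⟨p, h1, by rw [h2, Int.toNat_of_nonneg (ell_nonneg hlam)], h3⟩
  · intro N q hq hN hz
    by_contra hq0
    have hqN : (q.totalDegree : ℤ) ≤ N := hN.resolve_left hq0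
    obtain ⟨lam, hlam, hn⟩ := exists_ell_eq (D := D) _ q rfl
    obtain ⟨p, ⟨h1, h2, h3⟩, huniq⟩ := h lam hlam
    rw [hn, Int.toNat_natCast] at h2
    have key : ∀ c : ℂ, c ≠ 0 → (p + C c * q).totalDegree < q.totalDegree := by
      intro c hc
      by_contra! hlt
      have hle : (p + C c * q).totalDegree ≤ q.totalDegree := by
        refine (totalDegree_add _ _).trans (max_le h2.le ?_)
        refine (totalDegree_mul _ _).trans ?_
        simp
      have := huniq (p + C c * q) ⟨h1.add (hq.C_mul c), by
        rw [hn, Int.toNat_natCast]; exact le_antisymm hle hlt, by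
        intro μ hμ hμl
        rw [map_add, map_mul, hz μ hμ (by omega), mul_zero, add_zero, h3 μ hμ hμl]⟩
      rw [add_eq_left, mul_eq_zero, C_eq_zero] at this
      exact this.elim hc hq0
    have h4 := key 1 one_ne_zero
    have h5 := key 2 two_ne_zero
    have h6 : q = (p + C 2 * q) - (p + C 1 * q) := by
      have : (C 2 : MvPolynomial ι ℂ) = C 1 + C 1 := by rw [← C_add]; norm_num
      rw [this, C_1]
      ring
    have h7 := totalDegree_sub (p + C 2 * q) (p + C 1 * q)
    rw [← h6] at h7
    omega

/-- The finite set of interpolation nodes of level at most `N`. -/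
def nodes (D : Data ι) (N : ℤ) : Finset (ι → ℤ) :=
  (Finset.Icc 0 (fun _ => N)).filter fun μ => pairZ D.ell μ ≤ N

lemma mem_nodes {N : ℤ} {μ : ι → ℤ} : μ ∈ D.nodes N ↔ μ ∈ LamPlus ∧ pairZ D.ell μ ≤ N := by
  simp only [nodes, Finset.mem_filter, Finset.mem_Icc]
  constructor
  · rintro ⟨⟨h1, -⟩, h2⟩
    exact ⟨h1, h2⟩
  · rintro ⟨h1, h2⟩
    refine ⟨⟨h1, fun i => ?_⟩, h2⟩
    have h3 : D.ell i * μ i ≤ pairZ D.ell μ :=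
      Finset.single_le_sum (f := fun i => D.ell i * μ i)
        (fun j _ => mul_nonneg (D.C6 j).le (h1 j)) (Finset.mem_univ i)
    have h4 : μ i ≤ D.ell i * μ i := le_mul_of_one_le_left (h1 i) (D.C6 i)
    simp only
    omega

/-- The matrix of values of a family of polynomials at the nodes. -/
def nodeMat (D : Data ι) (P : (ι → ℤ) → MvPolynomial ι ℂ) (ρ : ι → ℂ) (N : ℤ) :
    Matrix (D.nodes N) (D.nodes N) ℂ :=
  fun μ κ => eval (ρ + toV κ.1) (P μ.1)

/-- A family of Capelli polynomials. -/
def Fam (D : Data ι) (ρ : ι → ℂ) (P : (ι → ℤ) → MvPolynomial ι ℂ) : Prop :=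
  ∀ lam ∈ LamPlus, D.CapelliAt ρ lam (P lam)

lemma Exist.fam {ρ : ι → ℂ} (h : D.Exist ρ) : ∃ P, D.Fam ρ P := by
  choose! P hP using h
  exact ⟨P, hP⟩

lemma Fam.degLe {ρ : ι → ℂ} {P : (ι → ℤ) → MvPolynomial ι ℂ} (hP : D.Fam ρ P) {lam : ι → ℤ}
    (hlam : lam ∈ LamPlus) : DegLe (P lam) (pairZ D.ell lam) := Or.inr (hP lam hlam).2.1

lemma Fam.det_ne_zero {ρ : ι → ℂ} {P : (ι → ℤ) → MvPolynomial ι ℂ} (hP : D.Fam ρ P) (N : ℤ) :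
    (D.nodeMat P ρ N).det ≠ 0 := by
  intro h0
  obtain ⟨v, hv, hv0⟩ := Matrix.exists_vecMul_eq_zero_iff.2 h0
  obtain ⟨a, ha⟩ : ∃ a, v a ≠ 0 := by
    by_contra! hcon
    exact hv (_root_.funext hcon)
  obtain ⟨μ, hμ, hmin⟩ := Finset.exists_min_image (Finset.univ.filter fun a => v a ≠ 0)
    (fun a => pairZ D.ell a.1) ⟨a, by simpa using ha⟩
  have hμ' : v μ ≠ 0 := by simpa using hμ
  apply hμ'
  have := congrFun hv0 μ
  simp only [Matrix.vecMul, dotProduct, nodeMat, Pi.zero_apply] at this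
  rw [Finset.sum_eq_single μ] at this
  · rwa [(hP μ.1 (mem_nodes.1 μ.2).1).2.2 μ.1 (mem_nodes.1 μ.2).1 le_rfl, if_pos rfl, mul_one]
      at this
  · intro b _ hb
    by_cases hvb : v b = 0
    · simp [hvb]
    · rw [(hP b.1 (mem_nodes.1 b.2).1).2.2 μ.1 (mem_nodes.1 μ.2).1 (hmin b (by simpa using hvb)),
        if_neg (fun h => hb (Subtype.ext h.symm)), mul_zero]
  · simp

lemma exists_vecMul_eq {n : Type*} [Fintype n] [DecidableEq n] {A : Matrix n n ℂ} (hA : A.det ≠ 0)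
    (b : n → ℂ) : ∃ v, Matrix.vecMul v A = b :=
  ⟨Matrix.vecMul b A⁻¹, by
    rw [Matrix.vecMul_vecMul, Matrix.nonsing_inv_mul _ (isUnit_iff_ne_zero.2 hA),
      Matrix.vecMul_one]⟩

/-- The linear combination of a family with coefficients `v`. -/
def comb (D : Data ι) (P : (ι → ℤ) → MvPolynomial ι ℂ) {N : ℤ} (v : D.nodes N → ℂ) :
    MvPolynomial ι ℂ := ∑ μ : D.nodes N, C (v μ) * P μ.1

lemma eval_comb (P : (ι → ℤ) → MvPolynomial ι ℂ) {N : ℤ} (v : D.nodes N → ℂ) (z : ι → ℂ) :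
    eval z (D.comb P v) = ∑ μ, v μ * eval z (P μ.1) := by
  simp [comb]

lemma eval_comb_node (P : (ι → ℤ) → MvPolynomial ι ℂ) {N : ℤ} (v : D.nodes N → ℂ) (ρ : ι → ℂ)
    (κ : D.nodes N) :
    eval (ρ + toV κ.1) (D.comb P v) = Matrix.vecMul v (D.nodeMat P ρ N) κ := by
  rw [eval_comb]
  rfl

lemma Fam.wInv_comb {ρ : ι → ℂ} {P : (ι → ℤ) → MvPolynomial ι ℂ} (hP : D.Fam ρ P) {N : ℤ}
    (v : D.nodes N → ℂ) : D.WInv (D.comb P v) :=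
  WInv.sum _ fun μ _ => (hP μ.1 (mem_nodes.1 μ.2).1).1.C_mul _

lemma Fam.degLe_comb {ρ : ι → ℂ} {P : (ι → ℤ) → MvPolynomial ι ℂ} (hP : D.Fam ρ P) {N : ℤ}
    (v : D.nodes N → ℂ) : DegLe (D.comb P v) N :=
  DegLe.sum _ fun μ _ =>
    ((hP.degLe (mem_nodes.1 μ.2).1).mono (mem_nodes.1 μ.2).2).C_mul _

lemma Fam.span {ρ : ι → ℂ} {P : (ι → ℤ) → MvPolynomial ι ℂ} (hP : D.Fam ρ P) (hU : D.Uniq ρ)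
    {N : ℤ} {q : MvPolynomial ι ℂ} (hq : D.WInv q) (hN : DegLe q N) :
    ∃ v : D.nodes N → ℂ, q = D.comb P v := by
  obtain ⟨v, hv⟩ := exists_vecMul_eq (hP.det_ne_zero N) fun κ => eval (ρ + toV κ.1) q
  refine ⟨v, sub_eq_zero.1 (hU N _ (hq.sub (hP.wInv_comb v)) (hN.sub (hP.degLe_comb v)) ?_)⟩
  intro μ hμ hμN
  rw [map_sub, eval_comb_node P v ρ ⟨μ, mem_nodes.2 ⟨hμ, hμN⟩⟩, hv, sub_self]

lemma uniq_of_det {ρ ρ₁ : ι → ℂ} {P : (ι → ℤ) → MvPolynomial ι ℂ} (hP : D.Fam ρ P)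
    (hU : D.Uniq ρ) (hdet : ∀ N : ℤ, (D.nodeMat P ρ₁ N).det ≠ 0) : D.Uniq ρ₁ := by
  intro N q hq hN hz
  obtain ⟨v, rfl⟩ := hP.span hU hq hN
  have : v = 0 := by
    by_contra hv
    refine hdet N (Matrix.exists_vecMul_eq_zero_iff.1 ⟨v, hv, ?_⟩)
    ext κ
    rw [← eval_comb_node, hz κ.1 (mem_nodes.1 κ.2).1 (mem_nodes.1 κ.2).2]
    rfl
  simp [this, comb]

lemma exist_of_det {ρ ρ₁ : ι → ℂ} {P : (ι → ℤ) → MvPolynomial ι ℂ} (hP : D.Fam ρ P)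
    (hdet : ∀ N : ℤ, (D.nodeMat P ρ₁ N).det ≠ 0) : D.Exist ρ₁ := by
  intro lam hlam
  obtain ⟨v, hv⟩ := exists_vecMul_eq (hdet (pairZ D.ell lam)) fun κ => if κ.1 = lam then 1 else 0
  refine ⟨D.comb P v, hP.wInv_comb v, ?_, ?_⟩
  · rcases hP.degLe_comb v with h | h
    · rw [h, totalDegree_zero]
      exact ell_nonneg hlam
    · exact h
  · intro μ hμ hμN
    rw [eval_comb_node P v ρ₁ ⟨μ, mem_nodes.2 ⟨hμ, hμN⟩⟩, hv]

lemma Fam.det_ne_zero_of_fam {ρ ρ₁ : ι → ℂ} {P Q : (ι → ℤ) → MvPolynomial ι ℂ} (hP : D.Fam ρ P)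
    (hU : D.Uniq ρ) (hQ : D.Fam ρ₁ Q) (N : ℤ) : (D.nodeMat P ρ₁ N).det ≠ 0 := by
  intro h0
  obtain ⟨c, hc, hc0⟩ := Matrix.exists_mulVec_eq_zero_iff.2 h0
  have hann : ∀ q, D.WInv q → DegLe q N → ∑ κ : D.nodes N, eval (ρ₁ + toV κ.1) q * c κ = 0 := by
    intro q hq hqN
    obtain ⟨v, rfl⟩ := hP.span hU hq hqN
    simp only [eval_comb_node]
    have : ∑ κ, Matrix.vecMul v (D.nodeMat P ρ₁ N) κ * c κ
        = dotProduct v (Matrix.mulVec (D.nodeMat P ρ₁ N) c) := by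
      rw [Matrix.dotProduct_mulVec]; rfl
    rw [this, hc0, dotProduct_zero]
  obtain ⟨a, ha⟩ : ∃ a, c a ≠ 0 := by
    by_contra! hcon
    exact hc (_root_.funext hcon)
  obtain ⟨μ, hμ, hmax⟩ := Finset.exists_max_image (Finset.univ.filter fun a => c a ≠ 0)
    (fun a => pairZ D.ell a.1) ⟨a, by simpa using ha⟩
  have hμ' : c μ ≠ 0 := by simpa using hμ
  apply hμ'
  have hμ1 := mem_nodes.1 μ.2
  have := hann (Q μ.1) (hQ μ.1 hμ1.1).1 ((hQ.degLe hμ1.1).mono hμ1.2)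
  rw [Finset.sum_eq_single μ] at this
  · rwa [(hQ μ.1 hμ1.1).2.2 μ.1 hμ1.1 le_rfl, if_pos rfl, one_mul] at this
  · intro b _ hb
    by_cases hvb : c b = 0
    · simp [hvb]
    · rw [(hQ μ.1 hμ1.1).2.2 b.1 (mem_nodes.1 b.2).1 (hmax b (by simpa using hvb)),
        if_neg (fun h => hb (Subtype.ext h)), zero_mul]
  · simp

/-! ### Generic deformation of the parameter -/

/-- A parameter is good if it is nonintegral and has the interpolation property. -/
structure Good (D : Data ι) (ρ : ι → ℂ) : Prop where
  inV0 : D.InV0 ρ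
  nonInt : NonInt D.R ρ
  uniq : D.Uniq ρ
  exist : D.Exist ρ

lemma InV0.exists_isK {ρ : ι → ℂ} (hρ : D.InV0 ρ) : ∃ k, D.IsK ρ k := by
  refine ⟨fun ω => if h : ∃ i, ∃ w ∈ D.W, Knop.e i = w ω ∨ Knop.e i = -(w ω) then ρ h.choose else 0,
    ?_⟩
  intro ω i hi
  have h : ∃ i, ∃ w ∈ D.W, Knop.e i = w ω ∨ Knop.e i = -(w ω) := ⟨i, hi⟩
  simp only [dif_pos h]
  obtain ⟨u, hu, hu'⟩ := h.choose_spec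
  obtain ⟨w, hw, hw'⟩ := hi
  apply hρ
  refine ⟨u * w⁻¹, D.W.mul_mem hu (D.W.inv_mem hw), ?_⟩
  have h1 : (u * w⁻¹) (w ω) = u ω := congrArg u (inv_apply_self' w ω)
  rcases hw' with hw' | hw' <;> rw [hw']
  · rw [h1]; exact hu'
  · rw [map_neg, h1, neg_neg]; exact hu'.symm

/-- The deformation of `ρ'` into `ρ` along a parabola. -/
def defo (ρ' ρ : ι → ℂ) (t : ℂ) : ι → ℂ := fun i => (1 - t) * ρ' i + t * ρ i + t * (1 - t)

/-- The deformation of the parameter functions. -/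
def defoK (k' k : (ι → ℤ) → ℂ) (t : ℂ) : (ι → ℤ) → ℂ :=
  fun ω => (1 - t) * k' ω + t * k ω + t * (1 - t)

lemma defo_inV0 {ρ' ρ : ι → ℂ} (h' : D.InV0 ρ') (h : D.InV0 ρ) (t : ℂ) : D.InV0 (defo ρ' ρ t) :=
  fun i j hij => by simp only [defo]; rw [h' i j hij, h i j hij]

lemma defoK_isK {ρ' ρ : ι → ℂ} {k' k : (ι → ℤ) → ℂ} (h' : D.IsK ρ' k') (h : D.IsK ρ k) (t : ℂ) :
    D.IsK (defo ρ' ρ t) (defoK k' k t) :=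
  fun ω i hi => by simp only [defo, defoK]; rw [h' ω i hi, h ω i hi]

@[simp] lemma defo_one (ρ' ρ : ι → ℂ) : defo ρ' ρ 1 = ρ := by ext; simp [defo]

@[simp] lemma defo_zero (ρ' ρ : ι → ℂ) : defo ρ' ρ 0 = ρ' := by ext; simp [defo]

@[simp] lemma defoK_one (k' k : (ι → ℤ) → ℂ) : defoK k' k 1 = k := by ext; simp [defoK]

/-- The function `f` is given by a polynomial. -/
def PolyFn (f : ℂ → ℂ) : Prop := ∃ g : Polynomial ℂ, ∀ t, f t = g.eval t

namespace PolyFn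

lemma const (c : ℂ) : PolyFn fun _ => c := ⟨Polynomial.C c, by simp⟩

lemma id : PolyFn fun t => t := ⟨Polynomial.X, by simp⟩

lemma add {f g : ℂ → ℂ} (hf : PolyFn f) (hg : PolyFn g) : PolyFn fun t => f t + g t := by
  obtain ⟨a, ha⟩ := hf
  obtain ⟨b, hb⟩ := hg
  exact ⟨a + b, by simp [ha, hb]⟩

lemma mul {f g : ℂ → ℂ} (hf : PolyFn f) (hg : PolyFn g) : PolyFn fun t => f t * g t := by
  obtain ⟨a, ha⟩ := hf
  obtain ⟨b, hb⟩ := hg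
  exact ⟨a * b, by simp [ha, hb]⟩

lemma sub {f g : ℂ → ℂ} (hf : PolyFn f) (hg : PolyFn g) : PolyFn fun t => f t - g t := by
  obtain ⟨a, ha⟩ := hf
  obtain ⟨b, hb⟩ := hg
  exact ⟨a - b, by simp [ha, hb]⟩

lemma sum {κ : Type*} (s : Finset κ) {f : κ → ℂ → ℂ} (h : ∀ j ∈ s, PolyFn (f j)) :
    PolyFn fun t => ∑ j ∈ s, f j t := by
  induction s using Finset.induction_on with
  | empty => simpa using const 0
  | insert a s ha ih =>
    simp only [Finset.sum_insert ha]
    exact (h a (by simp)).add (ih fun j hj => h j (by simp [hj]))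

lemma prod {κ : Type*} (s : Finset κ) {f : κ → ℂ → ℂ} (h : ∀ j ∈ s, PolyFn (f j)) :
    PolyFn fun t => ∏ j ∈ s, f j t := by
  induction s using Finset.induction_on with
  | empty => simpa using const 1
  | insert a s ha ih =>
    simp only [Finset.prod_insert ha]
    exact (h a (by simp)).mul (ih fun j hj => h j (by simp [hj]))

lemma eval {c : ℂ → ι → ℂ} (hc : ∀ i, PolyFn fun t => c t i) (p : MvPolynomial ι ℂ) :
    PolyFn fun t => MvPolynomial.eval (c t) p := by
  induction p using MvPolynomial.induction_on with
  | C a => simpa using const a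
  | add p q hp hq => simpa using hp.add hq
  | mul_X p i hp => simpa using hp.mul (hc i)

lemma det {n : Type*} [Fintype n] [DecidableEq n] {A : ℂ → Matrix n n ℂ}
    (hA : ∀ i j, PolyFn fun t => A t i j) : PolyFn fun t => (A t).det := by
  simp only [Matrix.det_apply']
  exact sum _ fun σ _ => (const _).mul (prod _ fun i _ => hA _ _)

lemma defo (ρ' ρ : ι → ℂ) (i : ι) : PolyFn fun t => Data.defo ρ' ρ t i :=
  (((const 1).sub id).mul (const _)).add (id.mul (const _)) |>.add (id.mul ((const 1).sub id))

lemma defoK (k' k : (ι → ℤ) → ℂ) (ω : ι → ℤ) : PolyFn fun t => Data.defoK k' k t ω :=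
  (((const 1).sub id).mul (const _)).add (id.mul (const _)) |>.add (id.mul ((const 1).sub id))

end PolyFn

lemma sum_ne_zero_of_one_signed {γ : ι → ℤ} (h : (∀ i, 0 ≤ γ i) ∨ (∀ i, γ i ≤ 0)) (h0 : γ ≠ 0) :
    ∑ i, γ i ≠ 0 := by
  intro hs
  apply h0
  ext i
  rcases h with h | h
  · exact (Finset.sum_eq_zero_iff_of_nonneg fun i _ => h i).1 hs i (by simp)
  · exact (Finset.sum_eq_zero_iff_of_nonpos fun i _ => h i).1 hs i (by simp)

lemma evalC_defo (γ : ι → ℤ) (ρ' ρ : ι → ℂ) (t : ℂ) :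
    evalC γ (defo ρ' ρ t) = (1 - t) * evalC γ ρ' + t * evalC γ ρ + t * (1 - t) * (∑ i, γ i : ℤ) := by
  simp only [evalC, defo, Finset.mul_sum, Int.cast_sum, ← Finset.sum_add_distrib]
  exact Finset.sum_congr rfl fun i _ => by ring

/-- A polynomial identity in the deformation parameter which holds at good parameters
holds everywhere. -/
lemma PolyFn.eq_zero_of_good {ρ' ρ : ι → ℂ} (h' : D.InV0 ρ') (hU : D.Uniq ρ') (hE : D.Exist ρ')
    (h : D.InV0 ρ) {f : ℂ → ℂ} (hf : PolyFn f)
    (hgood : ∀ t, D.Good (Data.defo ρ' ρ t) → f t = 0) (t : ℂ) : f t = 0 := by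
  obtain ⟨g, hg⟩ := hf
  rw [hg]
  suffices hg0 : g = 0 by simp [hg0]
  by_contra hg0
  obtain ⟨P, hP⟩ := hE.fam
  have hdet : ∀ N : ℤ, PolyFn fun t => (D.nodeMat P (Data.defo ρ' ρ t) N).det := fun N =>
    PolyFn.det fun μ κ => PolyFn.eval (c := fun t => Data.defo ρ' ρ t + toV κ.1)
      (fun i => (PolyFn.defo ρ' ρ i).add (.const _)) _
  choose dets hdets using hdet
  beta_reduce at hdets
  have hlin : ∀ x : D.R × ℤ, PolyFn fun t => evalC x.1.1 (Data.defo ρ' ρ t) - x.2 := fun x => by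
    simp only [evalC]
    exact (PolyFn.sum _ fun i _ => (PolyFn.const _).mul (PolyFn.defo ρ' ρ i)).sub (.const _)
  choose lins hlins using hlin
  beta_reduce at hlins
  obtain ⟨s, hs⟩ := exists_not_root
    (fun o : Unit ⊕ ℤ ⊕ (D.R × ℤ) => Sum.elim (fun _ => g) (Sum.elim dets lins) o) (by
      rintro (_ | N | x) h0
      · exact hg0 h0
      · have := hdets N 0
        simp only [Sum.elim_inr, Sum.elim_inl] at h0
        rw [h0, defo_zero, Polynomial.eval_zero] at this
        exact hP.det_ne_zero N this
      · simp only [Sum.elim_inr] at h0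
        have e0 := hlins x 0
        have e1 := hlins x 1
        have e2 := hlins x 2
        rw [h0, Polynomial.eval_zero, evalC_defo] at e0 e1 e2
        have e3 : ((∑ i, x.1.1 i : ℤ) : ℂ) = 0 := by linear_combination (-1 / 2) * e2 + e1 - e0 / 2
        exact sum_ne_zero_of_one_signed (one_signed h' hE x.1.2) (ne_zero_of_mem_R x.1.2)
          (by exact_mod_cast e3))
  have hdetne : ∀ N : ℤ, (D.nodeMat P (Data.defo ρ' ρ s) N).det ≠ 0 := fun N => by
    rw [hdets]; exact hs (Sum.inr (Sum.inl N))
  apply hs (Sum.inl ())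
  rw [Sum.elim_inl, ← hg]
  refine hgood s ⟨defo_inV0 h' h s, fun γ hγ n hn => ?_, uniq_of_det hP hU hdetne,
    exist_of_det hP hdetne⟩
  apply hs (Sum.inr (Sum.inr (⟨γ, hγ⟩, n)))
  rw [Sum.elim_inr, Sum.elim_inr, ← hlins, hn, sub_self]

end Data

/-! ### The sign character and the discriminant -/

/-- The determinant character. -/
def eps (w : LatAut ι) : ℤ := LinearMap.det (w : (ι → ℤ) →ₗ[ℤ] (ι → ℤ))

@[simp] lemma eps_one : eps (1 : LatAut ι) = 1 := LinearMap.det_id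

lemma eps_mul (u w : LatAut ι) : eps (u * w) = eps u * eps w :=
  LinearMap.det_comp (u : (ι → ℤ) →ₗ[ℤ] (ι → ℤ)) (w : (ι → ℤ) →ₗ[ℤ] (ι → ℤ))

lemma eps_inv_mul (w : LatAut ι) : eps w⁻¹ * eps w = 1 := by rw [← eps_mul]; simp

lemma eps_sq (w : LatAut ι) : eps w * eps w = 1 := by
  rcases Int.isUnit_iff.1 (IsUnit.of_mul_eq_one_right _ (eps_inv_mul w)) with h | h <;> rw [h] <;> norm_num

lemma eps_ne_zero (w : LatAut ι) : (eps w : ℂ) ≠ 0 := by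
  have := eps_sq w
  intro h
  rw [Int.cast_eq_zero] at h
  simp [h] at this

lemma actP_lin (w : LatAut ι) (γ : ι → ℤ) : actP w (lin γ) = lin (w.symm γ) :=
  MvPolynomial.funext fun z => by simp

lemma lin_neg (γ : ι → ℤ) : lin (-γ) = -lin γ := MvPolynomial.funext fun z => by simp

lemma lin_ne_zero {γ : ι → ℤ} (h : γ ≠ 0) : lin γ ≠ 0 := by
  intro h0
  apply h
  ext i
  have : evalC γ (Pi.single i 1) = 0 := by rw [← eval_lin, h0, map_zero]
  simpa [evalC, Pi.single_apply] using this

namespace Data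

variable {D : Data ι}

lemma IsRefl.eps {s : LatAut ι} {γ δ : ι → ℤ} (h : IsRefl s γ δ) : Knop.eps s = -1 := by
  let f : (ι → ℤ) →ₗ[ℤ] ℤ :=
    { toFun := fun x => pairZ x δ
      map_add' := fun x y => pairZ_add x y δ
      map_smul' := fun n x => pairZ_smul n x δ }
  have h1 : (s : (ι → ℤ) →ₗ[ℤ] (ι → ℤ)) = LinearMap.transvection f (-γ) := by
    refine LinearMap.ext fun x => ?_
    change s x = _
    rw [h.apply]
    simp [LinearMap.transvection.apply, f, sub_eq_add_neg]
  rw [Knop.eps, h1, LinearMap.transvection.det]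
  simp [f, h.pair]

/-- The positive elements of the saturated root system. -/
def Rpos (D : Data ι) : Finset (ι → ℤ) := D.R.filter fun γ => ∀ i, 0 ≤ γ i

lemma sepForms_Rpos : SepForms D.Rpos := by
  refine sepForms_of_subset_R (Finset.filter_subset _ _) fun γ hγ hγ' => ?_
  have h1 := (Finset.mem_filter.1 hγ)
  have h2 := (Finset.mem_filter.1 hγ').2
  refine ne_zero_of_mem_R h1.1 (_root_.funext fun i => le_antisymm ?_ (h1.2 i))
  simpa using h2 i

/-- The product of the positive roots. -/
def den (D : Data ι) : MvPolynomial ι ℂ := ∏ γ ∈ D.Rpos, lin γ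

lemma den_ne_zero : D.den ≠ 0 :=
  Finset.prod_ne_zero_iff.2 fun γ hγ => lin_ne_zero (sepForms_Rpos.1 γ hγ)

lemma prod_R (hsgn : ∀ γ ∈ D.R, (∀ i, 0 ≤ γ i) ∨ ∀ i, γ i ≤ 0) :
    ∏ γ ∈ D.R, lin γ = (-1) ^ D.Rpos.card * D.den ^ 2 := by
  rw [← Finset.prod_filter_mul_prod_filter_not D.R fun γ => ∀ i, 0 ≤ γ i]
  have : ∏ γ ∈ D.R.filter (fun γ => ¬ ∀ i, 0 ≤ γ i), lin γ = ∏ γ ∈ D.Rpos, -lin γ := by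
    refine Finset.prod_nbij' (fun γ => -γ) (fun γ => -γ) ?_ ?_ (fun _ _ => neg_neg _)
      (fun _ _ => neg_neg _) (fun γ _ => by rw [lin_neg, neg_neg])
    · intro γ hγ
      rw [Finset.mem_filter] at hγ
      exact Finset.mem_filter.2 ⟨neg_mem_R hγ.1, fun i => by
        simpa using (hsgn γ hγ.1).resolve_left hγ.2 i⟩
    · intro γ hγ
      have hγ' := Finset.mem_filter.1 hγ
      refine Finset.mem_filter.2 ⟨neg_mem_R hγ'.1, fun h => ?_⟩
      refine ne_zero_of_mem_R hγ'.1 (_root_.funext fun i => le_antisymm ?_ (hγ'.2 i))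
      simpa using h i
  rw [this, Finset.prod_neg, den, Rpos]
  ring

lemma actP_prod_R {w : LatAut ι} (hw : w ∈ D.W) :
    actP w (∏ γ ∈ D.R, lin γ) = ∏ γ ∈ D.R, lin γ := by
  rw [map_prod]
  simp only [actP_lin]
  refine Finset.prod_nbij' (fun γ => w.symm γ) (fun γ => w γ) (fun γ hγ => map_mem_R (symm_mem hw) hγ)
    (fun γ hγ => map_mem_R hw hγ) (fun γ _ => w.apply_symm_apply γ)
    (fun γ _ => w.symm_apply_apply γ) (fun γ _ => rfl)

lemma actP_den_refl (hsgn : ∀ γ ∈ D.R, (∀ i, 0 ≤ γ i) ∨ ∀ i, γ i ≤ 0) {s : LatAut ι} (hs : s ∈ D.W)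
    {γ δ : ι → ℤ} (hγ : γ ∈ D.Rpos) (h : IsRefl s γ δ) : actP s D.den = -D.den := by
  have hsq : (actP s D.den) ^ 2 = D.den ^ 2 := by
    have := actP_prod_R hs
    rw [prod_R hsgn, map_mul, map_pow, map_pow, map_neg, map_one] at this
    exact mul_left_cancel₀ (pow_ne_zero _ (neg_ne_zero.2 one_ne_zero)) this
  rcases sq_eq_sq_iff_eq_or_eq_neg.1 hsq with h1 | h1
  · exfalso
    set d := ∏ γ' ∈ D.Rpos.erase γ, lin γ' with hd
    have hden : D.den = lin γ * d := (Finset.mul_prod_erase _ _ hγ).symm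
    have h2 : actP s d = -d := by
      rw [hden, map_mul, actP_lin, h.symm_eq, h.apply_root, lin_neg, neg_mul, ← mul_neg] at h1
      rw [← neg_eq_iff_eq_neg]
      exact mul_left_cancel₀ (lin_ne_zero (sepForms_Rpos.1 γ hγ)) h1
    have hdvd := prod_lin_dvd (S := {γ}) (sepForms_Rpos.subset (by simpa using hγ)) (p := d) (by
      intro γ' hγ' z hz
      rw [Finset.mem_singleton.1 hγ'] at hz
      have h3 : eval z (actP s d) = eval z (-d) := by rw [h2]
      rw [eval_actP, h.actV, hz, zero_smul, sub_zero, map_neg] at h3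
      linear_combination h3 / 2)
    have hp : lin γ * lin γ ∣ D.den := by
      rw [Finset.prod_singleton] at hdvd
      rw [hden]
      exact mul_dvd_mul_left _ hdvd
    rw [Finset.prod_singleton] at hdvd
    have hgen : ∃ z, evalC γ z = 0 ∧ eval z d ≠ 0 := by
      by_contra! hcon
      have : ∀ S ⊆ D.Rpos.erase γ, ∃ z, evalC γ z = 0 ∧ eval z (∏ γ' ∈ S, lin γ') ≠ 0 := by
        intro S
        induction S using Finset.induction_on with
        | empty => exact fun _ => ⟨0, by simp, by simp⟩
        | insert γ' S hγ' ih =>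
          intro hS
          obtain ⟨z, hz, hz'⟩ := ih ((Finset.subset_insert _ _).trans hS)
          have hm := Finset.mem_erase.1 (hS (Finset.mem_insert_self _ _))
          obtain ⟨y, hy, hy'⟩ := sepForms_Rpos.2 γ hγ γ' hm.2 hm.1.symm
          obtain ⟨t, ht⟩ := exists_not_root (κ := Bool)
            (fun b => lineP z (y - z) (if b then lin γ' else ∏ γ' ∈ S, lin γ')) (by
              rintro (_ | _) h0
              · have := congrArg (Polynomial.eval 0) h0
                simp only [eval_lineP] at this
                simp at this
                simp [this] at hz'
              · have := congrArg (Polynomial.eval 1) h0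
                simp only [eval_lineP] at this
                simp [hy'] at this)
          refine ⟨z + t • (y - z), ?_, ?_⟩
          · rw [evalC_add_right, evalC_smul_right, evalC_sub_right, hz, hy]
            ring
          · rw [Finset.prod_insert hγ', map_mul]
            have t1 := ht true
            have t2 := ht false
            rw [eval_lineP] at t1 t2
            exact mul_ne_zero (by simpa using t1) (by simpa using t2)
      obtain ⟨z, hz, hz'⟩ := this _ subset_rfl
      exact hz' (hcon z hz)
    obtain ⟨z, hz, hz'⟩ := hgen
    obtain ⟨r, hr⟩ := hdvd
    rw [hr, map_mul, eval_lin, hz, zero_mul] at hz'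
    exact hz' rfl
  · exact h1

lemma actP_den (hsgn : ∀ γ ∈ D.R, (∀ i, 0 ≤ γ i) ∨ ∀ i, γ i ≤ 0) {w : LatAut ι} (hw : w ∈ D.W) :
    actP w D.den = C (eps w : ℂ) * D.den := by
  have key : ∀ w : LatAut ι, w ∈ D.W → ∀ z, eval (actV w z) D.den = eps w * eval z D.den := by
    intro w hw
    have hw' := D.C1 hw
    clear hw
    induction hw' using Subgroup.closure_induction with
    | mem w hw =>
      obtain ⟨α, hα, hw⟩ := hw
      have hrefl : IsRefl w α (D.coroot α) := ⟨hw, D.coroot_pair α hα⟩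
      obtain ⟨w', hw', hw''⟩ := D.refl_mem α hα
      obtain rfl : w' = w := LinearEquiv.ext fun x => (hw'' x).trans (hw x).symm
      have hd : actP w' D.den = -D.den := by
        rcases hsgn α (Δ_subset_R hα) with h | h
        · exact actP_den_refl hsgn hw' (Finset.mem_filter.2 ⟨Δ_subset_R hα, h⟩) hrefl
        · refine actP_den_refl hsgn hw' (γ := -α) (δ := -D.coroot α)
            (Finset.mem_filter.2 ⟨Δ_subset_R (D.Δ_neg α hα), fun i => by simpa using h i⟩) ⟨?_, ?_⟩
          · intro x
            rw [hrefl.apply, pairZ_neg_right]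
            module
          · simp [hrefl.pair]
      intro z
      rw [← eval_actP, hd, hrefl.eps]
      simp
    | one => simp
    | mul u w _ _ hu hw => intro z; rw [actV_mul, hu, hw, eps_mul]; push_cast; ring
    | inv w _ hw =>
      intro z
      have := hw (actV w⁻¹ z)
      rw [actV_actV_inv] at this
      have h1 : (eps w⁻¹ : ℂ) * eps w = 1 := by exact_mod_cast eps_inv_mul w
      rw [this, ← mul_assoc, h1, one_mul]
  exact MvPolynomial.funext fun z => by simp [key w hw]

end Data

/-! ### Antisymmetrization -/

lemma totalDegree_lin {γ : ι → ℤ} (h : γ ≠ 0) : (lin γ).totalDegree = 1 := by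
  refine le_antisymm (by exact_mod_cast (degLe_lin γ).resolve_left (lin_ne_zero h)) ?_
  by_contra! hcon
  have h0 : (lin γ).totalDegree = 0 := by omega
  rw [totalDegree_eq_zero_iff_eq_C] at h0
  have h1 : eval (0 : ι → ℂ) (lin γ) = 0 := by rw [eval_lin, evalC_zero_right]
  rw [h0, eval_C] at h1
  rw [h1, C_0] at h0
  exact lin_ne_zero h h0

lemma DegLe.of_mul_prod_lin {S : Finset (ι → ℤ)} (hS : ∀ γ ∈ S, γ ≠ 0) {p : MvPolynomial ι ℂ} {n : ℤ}
    (h : DegLe (p * ∏ γ ∈ S, lin γ) (n + S.card)) : DegLe p n := by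
  induction S using Finset.induction_on generalizing n with
  | empty => simpa using h
  | insert γ S hγ ih =>
    have hne := hS γ (Finset.mem_insert_self _ _)
    refine ih (fun γ' h' => hS γ' (Finset.mem_insert_of_mem h')) (DegLe.of_mul (lin_ne_zero hne) ?_)
    rw [Finset.prod_insert hγ, Finset.card_insert_of_notMem hγ] at h
    rw [totalDegree_lin hne, mul_assoc, mul_comm _ (lin γ)]
    push_cast at h ⊢
    rwa [add_assoc]

namespace Data

variable {D : Data ι}

/-- Antisymmetrization over a set of group elements, divided by the forms attached to
reflections which preserve that set. -/
lemma exists_antisymm {T : Finset (LatAut ι)} {S : Finset (ι → ℤ)} (hS : S ⊆ D.Rpos)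
    (hTS : ∀ γ ∈ S, ∃ s δ, IsRefl s γ δ ∧ ∀ w ∈ T, w * s ∈ T) (q : MvPolynomial ι ℂ) :
    ∃ p, p * ∏ γ ∈ S, lin γ = ∑ w ∈ T, C (Knop.eps w : ℂ) * actP w q := by
  have := prod_lin_dvd (sepForms_Rpos.subset hS)
    (p := ∑ w ∈ T, C (Knop.eps w : ℂ) * actP w q) ?_
  · obtain ⟨p, hp⟩ := this
    exact ⟨p, by rw [hp, mul_comm]⟩
  intro γ hγ z hz
  obtain ⟨s, δ, hs, hT⟩ := hTS γ hγ
  have hsz : Knop.actV s z = z := by rw [hs.actV, hz, zero_smul, sub_zero]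
  have hss : ∀ w : LatAut ι, w * s * s = w := fun w => by
    rw [mul_assoc]
    have : s * s = 1 := LinearEquiv.ext hs.apply_apply
    rw [this, mul_one]
  simp only [map_sum, map_mul, eval_C, eval_actP]
  have h1 : ∑ w ∈ T, (Knop.eps w : ℂ) * eval (Knop.actV w z) q
      = ∑ w ∈ T, -((Knop.eps w : ℂ) * eval (Knop.actV w z) q) := by
    refine Finset.sum_nbij' (fun w => w * s) (fun w => w * s) hT hT (fun w _ => hss w)
      (fun w _ => hss w) fun w _ => ?_
    rw [eps_mul, hs.eps, actV_mul, hsz]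
    push_cast
    ring
  rw [Finset.sum_neg_distrib] at h1
  linear_combination h1 / 2

/-- Finitely many non-vanishing polynomial conditions can be imposed at a good parameter. -/
lemma PolyFn.exists_good {ρ' ρ : ι → ℂ} (h' : D.InV0 ρ') (hU : D.Uniq ρ') (hE : D.Exist ρ')
    (h : D.InV0 ρ) {κ : Type*} (S : Finset κ) (f : κ → ℂ → ℂ) (hf : ∀ j ∈ S, PolyFn (f j))
    (hne : ∀ j ∈ S, ∃ t, f j t ≠ 0) : ∃ t, D.Good (Data.defo ρ' ρ t) ∧ ∀ j ∈ S, f j t ≠ 0 := by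
  by_contra! hcon
  choose! g hg using hf
  have hg0 : ∏ j ∈ S, g j ≠ 0 := Finset.prod_ne_zero_iff.2 fun j hj h0 => by
    obtain ⟨t, ht⟩ := hne j hj
    exact ht (by rw [hg j hj, h0, Polynomial.eval_zero])
  apply hg0
  refine Polynomial.funext fun t => ?_
  rw [Polynomial.eval_zero, Polynomial.eval_prod]
  refine PolyFn.eq_zero_of_good h' hU hE h (f := fun t => ∏ j ∈ S, (g j).eval t)
    (PolyFn.prod _ fun j _ => ⟨g j, fun _ => rfl⟩) (fun t ht => ?_) t
  obtain ⟨j, hj, hj0⟩ := hcon t ht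
  exact Finset.prod_eq_zero hj (by rw [← hg j hj, hj0])

lemma exists_good_generic {ρ' : ι → ℂ} (h' : D.InV0 ρ') (hU : D.Uniq ρ') (hE : D.Exist ρ')
    (ν : ι → ℤ) : ∃ ρ k, D.Good ρ ∧ D.IsK ρ k ∧
      ∀ ω ∈ D.Φ, ∀ c : ℤ, 1 ≤ c → c ≤ pairZ ω ν → evalC ω ρ - k ω + pairZ ω ν - c + 1 ≠ 0 := by
  obtain ⟨k', hk'⟩ := h'.exists_isK
  obtain ⟨t, ht, ht'⟩ := PolyFn.exists_good h' hU hE h'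
    (D.Φ.sigma fun ω => Finset.Icc 1 (pairZ ω ν))
    (fun x t => evalC x.1 (Data.defo ρ' ρ' t) - defoK k' k' t x.1 + pairZ x.1 ν - x.2 + 1)
    (by
      rintro ⟨ω, c⟩ -
      refine (((PolyFn.sum _ fun i _ => (PolyFn.const _).mul (PolyFn.defo ρ' ρ' i)).sub
        (PolyFn.defoK k' k' ω)).add (PolyFn.const _)).sub (PolyFn.const _) |>.add (PolyFn.const _))
    (by
      rintro ⟨ω, c⟩ hx
      simp only [Finset.mem_sigma, Finset.mem_Icc] at hx
      obtain ⟨hω, hc1, hc⟩ := hx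
      simp only [evalC_defo, defoK]
      by_cases hs : ∑ i, ω i = 1
      · have h0 : ∀ i, 0 ≤ ω i := by
          rcases D.C3 ω hω with h | h
          · exact h
          · have := Finset.sum_nonpos fun i (_ : i ∈ Finset.univ) => h i
            omega
        obtain ⟨i, rfl⟩ := nonneg_sum_one h0 hs
        refine ⟨0, ?_⟩
        rw [evalC_e, hk'.e, pairZ_e]
        rw [pairZ_e] at hc
        have : ν i - c + 1 ≠ 0 := by omega
        have : ((ν i - c + 1 : ℤ) : ℂ) ≠ 0 := by exact_mod_cast this
        push_cast at this
        convert this using 1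
        ring
      · by_contra! hcon
        have h0 := hcon 0
        have h2 := hcon 2
        have : (∑ i, ω i : ℤ) = (1 : ℂ) := by linear_combination (h0 - h2) / 2
        exact hs (by exact_mod_cast this))
  exact ⟨_, _, ht, defoK_isK hk' hk' t, fun ω hω c h1 h2 =>
    ht' ⟨ω, c⟩ (by simp [hω, h1, h2])⟩

/-- A linear form which is maximal at `ν` on the orbit of `ν`. -/
lemma exists_max_form {ν : ι → ℤ} (hν : ∀ w ∈ D.W, w ≠ 1 → actDual w ν ≠ ν) :
    ∃ b, ∀ w ∈ D.W, w ≠ 1 → pairZ b (actDual w ν) < pairZ b ν := by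
  refine ⟨∑ u ∈ D.Wf, u.symm (actDual u ν), fun w hw hw1 => ?_⟩
  have key : ∀ x, pairZ (∑ u ∈ D.Wf, u.symm (actDual u ν)) x
      = ∑ u ∈ D.Wf, pairZ (actDual u ν) (actDual u x) := fun x => by
    rw [pairZ_sum]
    exact Finset.sum_congr rfl fun u _ => (pairZ_actDual _ _ _).symm
  have hsq : ∀ x y : ι → ℤ, pairZ (x - y) (x - y) = pairZ x x - 2 * pairZ x y + pairZ y y :=
    fun x y => by rw [pairZ_sub, pairZ_sub_right, pairZ_sub_right, pairZ_comm y x]; ring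
  have hre : ∑ u ∈ D.Wf, pairZ (actDual u (actDual w ν)) (actDual u (actDual w ν))
      = ∑ u ∈ D.Wf, pairZ (actDual u ν) (actDual u ν) := by
    refine Finset.sum_nbij' (fun u => u * w) (fun u => u * w⁻¹)
      (fun u hu => (mem_Wf D).2 (D.W.mul_mem ((mem_Wf D).1 hu) hw))
      (fun u hu => (mem_Wf D).2 (D.W.mul_mem ((mem_Wf D).1 hu) (D.W.inv_mem hw))) (fun u _ => by simp)
      (fun u _ => by simp) fun u _ => by rw [actDual_mul]
  have hnn : ∀ x : ι → ℤ, 0 ≤ pairZ x x := fun x => Finset.sum_nonneg fun i _ => mul_self_nonneg _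
  have hpos : 0 < ∑ u ∈ D.Wf, pairZ (actDual u ν - actDual u (actDual w ν))
      (actDual u ν - actDual u (actDual w ν)) := by
    refine Finset.sum_pos' (fun u _ => hnn _) ⟨1, (mem_Wf D).2 D.W.one_mem, ?_⟩
    refine lt_of_le_of_ne (hnn _) fun h0 => hν w hw hw1 ?_
    have h0' := (Finset.sum_eq_zero_iff_of_nonneg fun i _ => mul_self_nonneg _).1 h0.symm
    ext i
    have := mul_self_eq_zero.1 (h0' i (Finset.mem_univ _))
    rw [actDual_one, actDual_one, Pi.sub_apply] at this
    omega
  simp only [hsq, Finset.sum_add_distrib, Finset.sum_sub_distrib, ← Finset.mul_sum, hre] at hpos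
  rw [key, key]
  linarith

end Data

/-! ### The set of roots is stable -/

namespace Data

variable {D : Data ι}

/-- Genericity assumptions used to count roots. -/
structure Cfg (D : Data ι) (ρ : ι → ℂ) (k : (ι → ℤ) → ℂ) (ν b : ι → ℤ) (M : ℕ) : Prop where
  isK : D.IsK ρ k
  nonInt : NonInt D.R ρ
  sgn : ∀ γ ∈ D.R, (∀ i, 0 ≤ γ i) ∨ ∀ i, γ i ≤ 0
  pos : ∀ i, 0 < ν i
  mpos : 0 < M
  dvdR : ∀ γ ∈ D.Rpos, 0 < pairZ γ ν ∧ pairZ γ ν ∣ M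
  dvdΦ : ∀ ω ∈ D.Φ, 0 < pairZ ω ν → pairZ ω ν ∣ M
  lt : ∀ w ∈ D.W, w ≠ 1 → pairZ b (actDual w ν) < pairZ b ν
  gen : ∀ ω ∈ D.Φ, ∀ c : ℤ, 1 ≤ c → c ≤ pairZ ω ν →
    evalC ω ρ - k ω + pairZ ω ν - c + 1 ≠ 0

namespace Cfg

/-- The group elements whose affine conjugate by `(j / M) ν` is integral. -/
def Wj (D : Data ι) (ν : ι → ℤ) (M j : ℕ) : Finset (LatAut ι) :=
  D.Wf.filter fun w => ∃ β : ι → ℤ, (M : ℤ) • β = (j : ℤ) • ν - actDual w ((j : ℤ) • ν)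

/-- The positive roots taking an integral value at `(j / M) ν`. -/
def Rj (D : Data ι) (ν : ι → ℤ) (M j : ℕ) : Finset (ι → ℤ) :=
  D.Rpos.filter fun γ => (M : ℤ) ∣ j * pairZ γ ν

/-- The weights with a positive value at `ν`, and an integral one at `(j / M) ν`. -/
def Φj (D : Data ι) (ν : ι → ℤ) (M j : ℕ) : Finset (ι → ℤ) :=
  D.Φ.filter fun ω => 0 < pairZ ω ν ∧ (M : ℤ) ∣ j * pairZ ω ν

/-- The product of the affine forms of the weights in `Φj`. -/
def mj (D : Data ι) (k : (ι → ℤ) → ℂ) (ν : ι → ℤ) (M j : ℕ) : MvPolynomial ι ℂ :=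
  ∏ ω ∈ Φj D ν M j, (lin ω - C (k ω + ((j * pairZ ω ν / M : ℤ) : ℂ) - 1))

/-- The propagation property of the supports. -/
def TJ (D : Data ι) (ρ : ι → ℂ) (ν b : ι → ℤ) (M j : ℕ) (Q : MvPolynomial ι ℂ) : Prop :=
  ∀ u ∈ D.W, ∀ κ ∈ LamPlus, ∀ δ : ι → ℤ,
    (∀ i, pairZ (u (e i)) ((j : ℤ) • ν - (M : ℤ) • δ) < M * (κ i + 1)) →
    eval (actV u (ρ + toV κ) + toV δ) Q ≠ 0 →
    ∃ τ : ι → ℤ, (∀ i, τ i ≤ κ i) ∧ pairZ D.ell τ = pairZ D.ell ν - pairZ D.ell δ ∧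
      M * pairZ b τ ≤
        pairZ b (actDual u⁻¹ ((j : ℤ) • ν - (M : ℤ) • δ)) + (M - j) * pairZ b ν

variable {ρ : ι → ℂ} {k : (ι → ℤ) → ℂ} {ν b : ι → ℤ} {M : ℕ} (h : Cfg D ρ k ν b M)
include h

lemma le {w : LatAut ι} (hw : w ∈ D.W) : pairZ b (actDual w ν) ≤ pairZ b ν := by
  by_cases h1 : w = 1
  · simp [h1]
  · exact (h.lt w hw h1).le

lemma TJ_base : TJ D ρ ν b M M 1 := by
  intro u hu κ hκ δ hpre _
  have hM : (0 : ℤ) < M := by exact_mod_cast h.mpos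
  refine ⟨actDual u⁻¹ (ν - δ), fun i => ?_, ?_, ?_⟩
  · have := hpre i
    rw [← smul_sub, pairZ_smul_right] at this
    have h2 := lt_of_mul_lt_mul_left this hM.le
    have h3 : actDual u⁻¹ (ν - δ) i = pairZ (u (Knop.e i)) (ν - δ) := by
      rw [← pairZ_e i (actDual _ _), pairZ_actDual]; rfl
    omega
  · rw [ell_actDual (D.W.inv_mem hu), pairZ_sub_right]
  · rw [← smul_sub, actDual_smul, pairZ_smul_right, sub_self, zero_mul, add_zero]

lemma pre_succ {j : ℕ} {u : LatAut ι} (hu : u ∈ D.W) {κ δ : ι → ℤ}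
    (hpre : ∀ i, pairZ (u (Knop.e i)) ((j : ℤ) • ν - (M : ℤ) • δ) < M * (κ i + 1))
    (hm : eval (Knop.actV u (ρ + toV κ) + toV δ) (mj D k ν M (j + 1)) ≠ 0) (i : ι) :
    pairZ (u (Knop.e i)) (((j + 1 : ℕ) : ℤ) • ν - (M : ℤ) • δ) < M * (κ i + 1) := by
  by_contra! hcon
  have h1 := hpre i
  have hM : (0 : ℤ) < M := by exact_mod_cast h.mpos
  have hω : u (Knop.e i) ∈ D.Φ := map_mem_Φ hu (e_mem_Φ i)
  have hkω : k (u (Knop.e i)) = ρ i := h.isK.map hu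
  have hev : evalC (u (Knop.e i)) (Knop.actV u (ρ + toV κ) + toV δ)
      = ρ i + κ i + pairZ (u (Knop.e i)) δ := by
    rw [evalC_add_right, evalC_actV, LinearEquiv.symm_apply_apply, evalC_e, evalC_toV]
    rfl
  generalize u (Knop.e i) = ω at *
  simp only [pairZ_sub_right, pairZ_smul_right] at h1 hcon
  push_cast at hcon
  have hpos : 0 < pairZ ω ν := by nlinarith
  obtain ⟨a, ha⟩ := h.dvdΦ ω hω hpos
  have hc : a * (κ i + 1 + pairZ ω δ) = j + 1 := by
    have e1 : pairZ ω ν * j < pairZ ω ν * (a * (κ i + 1 + pairZ ω δ)) := by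
      rw [← mul_assoc, ← ha]; linarith
    have e2 : pairZ ω ν * (a * (κ i + 1 + pairZ ω δ)) ≤ pairZ ω ν * (j + 1) := by
      rw [← mul_assoc, ← ha]; linarith
    have e1 := lt_of_mul_lt_mul_left e1 hpos.le
    have e2 := le_of_mul_le_mul_left e2 hpos
    omega
  have hdiv : ((j + 1 : ℕ) : ℤ) * pairZ ω ν = M * (κ i + 1 + pairZ ω δ) := by
    rw [ha]; push_cast; rw [← hc]; ring
  apply hm
  rw [mj, map_prod]
  refine Finset.prod_eq_zero (i := ω) ?_ ?_
  · exact Finset.mem_filter.2 ⟨hω, hpos, ⟨_, hdiv⟩⟩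
  · rw [map_sub, eval_lin, eval_C, hev, hkω, hdiv, Int.mul_ediv_cancel_left _ hM.ne']
    push_cast
    ring

lemma TJ_mul {j : ℕ} {Q : MvPolynomial ι ℂ} (hQ : TJ D ρ ν b M (j + 1) Q) :
    TJ D ρ ν b M j (mj D k ν M (j + 1) * Q) := by
  intro u hu κ hκ δ hpre hne
  rw [map_mul] at hne
  obtain ⟨τ, h1, h2, h3⟩ := hQ u hu κ hκ δ (h.pre_succ hu hpre (left_ne_zero_of_mul hne))
    (right_ne_zero_of_mul hne)
  refine ⟨τ, h1, h2, h3.trans ?_⟩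
  have h4 := h.le (D.W.inv_mem hu)
  simp only [actDual_sub, actDual_smul, pairZ_sub_right, pairZ_smul_right]
  push_cast
  linarith

lemma eval_mj_ne_zero {j : ℕ} (hj1 : 1 ≤ j) (hj : j ≤ M) :
    eval (ρ + toV ν) (mj D k ν M j) ≠ 0 := by
  rw [mj, map_prod]
  have hM : (0 : ℤ) < M := by exact_mod_cast h.mpos
  refine Finset.prod_ne_zero_iff.2 fun ω hω => ?_
  obtain ⟨hω, hpos, c, hc⟩ := Finset.mem_filter.1 hω
  rw [hc, Int.mul_ediv_cancel_left _ hM.ne', map_sub, eval_lin, eval_C, evalC_add_right, evalC_toV]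
  have h1 : 1 ≤ c := by
    have : 0 < (j : ℤ) * pairZ ω ν := mul_pos (by exact_mod_cast hj1) hpos
    rw [hc] at this
    exact pos_of_mul_pos_right this hM.le
  have h2 : c ≤ pairZ ω ν := by
    have : (j : ℤ) * pairZ ω ν ≤ M * pairZ ω ν :=
      mul_le_mul_of_nonneg_right (by exact_mod_cast hj) hpos.le
    rw [hc] at this
    exact le_of_mul_le_mul_left this hM
  have := h.gen ω hω c h1 h2
  intro h0
  apply this
  rw [← h0]
  ring

omit h in
lemma mem_Wj {j : ℕ} {w : LatAut ι} : w ∈ Wj D ν M j ↔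
    w ∈ D.W ∧ ∃ β : ι → ℤ, (M : ℤ) • β = (j : ℤ) • ν - actDual w ((j : ℤ) • ν) := by
  rw [Wj, Finset.mem_filter, mem_Wf]

omit h in
lemma Wj_closed {j : ℕ} {γ : ι → ℤ} (hγ : γ ∈ Rj D ν M j) :
    ∃ s δ, IsRefl s γ δ ∧ ∀ w ∈ Wj D ν M j, w * s ∈ Wj D ν M j := by
  obtain ⟨hγ, c, hc⟩ := Finset.mem_filter.1 hγ
  obtain ⟨s, hs, δ, hsr⟩ := exists_refl (Finset.mem_filter.1 hγ).1
  refine ⟨s, δ, hsr, fun w hw => ?_⟩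
  obtain ⟨hw, β, hβ⟩ := mem_Wj.1 hw
  refine mem_Wj.2 ⟨D.W.mul_mem hw hs, β + c • actDual w δ, ?_⟩
  rw [actDual_mul, hsr.actDual, pairZ_smul_right, hc, actDual_sub, actDual_smul _ (_ * _), smul_add, hβ,
    smul_smul]
  abel

omit h in
lemma exists_step (j : ℕ) (Q : MvPolynomial ι ℂ) : ∃ Q',
    (∀ n : ℤ, DegLe Q (n + (Rj D ν M j).card) → DegLe Q' n) ∧
    ∀ z, eval z Q' * ∏ γ ∈ Rj D ν M j, evalC γ (z - ((j : ℂ) / M) • toV ν)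
      = ∑ w ∈ Wj D ν M j, (Knop.eps w : ℂ) *
        eval (Knop.actV w (z - ((j : ℂ) / M) • toV ν) + ((j : ℂ) / M) • toV ν) Q := by
  obtain ⟨p, hp⟩ := exists_antisymm (D := D) (T := Wj D ν M j) (S := Rj D ν M j)
    (Finset.filter_subset _ _) (fun γ hγ => Wj_closed hγ) (trP (((j : ℂ) / M) • toV ν) Q)
  refine ⟨trP (-(((j : ℂ) / M) • toV ν)) p, fun n hn => ?_, fun z => ?_⟩
  · refine DegLe.trP (DegLe.of_mul_prod_lin (S := Rj D ν M j)
      (fun γ hγ => sepForms_Rpos.1 γ (Finset.mem_filter.1 hγ).1) ?_) _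
    rw [hp]
    exact DegLe.sum _ fun w _ => ((hn.trP _).actP _).C_mul _
  · have := congrArg (eval (z - ((j : ℂ) / M) • toV ν)) hp
    simp only [map_mul, map_prod, map_sum, eval_lin, eval_C, eval_actP, eval_trP] at this
    rw [← this, eval_trP, ← sub_eq_add_neg]

lemma TJ_step {j : ℕ} {Q Q' : MvPolynomial ι ℂ} (hQ : TJ D ρ ν b M j Q)
    (hQ' : ∀ z, eval z Q' * ∏ γ ∈ Rj D ν M j, evalC γ (z - ((j : ℂ) / M) • toV ν)
      = ∑ w ∈ Wj D ν M j, (Knop.eps w : ℂ) *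
        eval (Knop.actV w (z - ((j : ℂ) / M) • toV ν) + ((j : ℂ) / M) • toV ν) Q) :
    TJ D ρ ν b M j Q' := by
  have hM : (M : ℂ) ≠ 0 := by exact_mod_cast h.mpos.ne'
  have hMZ : (M : ℤ) ≠ 0 := by exact_mod_cast h.mpos.ne'
  intro u hu κ hκ δ hpre hne
  set y := Knop.actV u (ρ + toV κ) + toV δ with hy
  have hden : ∏ γ ∈ Rj D ν M j, evalC γ (y - ((j : ℂ) / M) • toV ν) ≠ 0 := by
    refine Finset.prod_ne_zero_iff.2 fun γ hγ h0 => ?_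
    obtain ⟨hγ, c, hc⟩ := Finset.mem_filter.1 hγ
    have hγ' := map_mem_R (symm_mem hu) (Finset.mem_filter.1 hγ).1
    refine h.nonInt _ hγ' (c - pairZ γ δ - pairZ (u.symm γ) κ) ?_
    have hc' : (j : ℂ) / M * pairZ γ ν = c := by
      have : (j : ℂ) * pairZ γ ν = M * c := by exact_mod_cast hc
      field_simp
      linear_combination this
    rw [evalC_sub_right, evalC_smul_right, evalC_toV, hc', hy, evalC_add_right, evalC_actV,
      evalC_add_right, evalC_toV, evalC_toV] at h0
    push_cast
    linear_combination h0
  have hs := hQ' y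
  have hs0 := mul_ne_zero hne hden
  rw [hs] at hs0
  obtain ⟨w, hw, hw0⟩ := Finset.exists_ne_zero_of_sum_ne_zero hs0
  obtain ⟨hw, β, hβ⟩ := mem_Wj.1 hw
  have hpt : Knop.actV w (y - ((j : ℂ) / M) • toV ν) + ((j : ℂ) / M) • toV ν
      = Knop.actV (w * u) (ρ + toV κ) + toV (actDual w δ + β) := by
    have hβ' : toV β = ((j : ℂ) / M) • toV ν - ((j : ℂ) / M) • Knop.actV w (toV ν) := by
      have := congrArg toV hβ
      rw [toV_smul, toV_sub, actDual_smul, toV_smul, toV_smul, toV_actDual] at this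
      rw [← smul_sub, div_eq_inv_mul, mul_smul, smul_sub]
      push_cast at this
      rw [← this, smul_smul, inv_mul_cancel₀ hM, one_smul]
    rw [hy, actV_sub, actV_add, actV_mul, actV_smul, toV_add, hβ', toV_actDual]
    abel
  rw [hpt] at hw0
  have hvec : (j : ℤ) • ν - (M : ℤ) • (actDual w δ + β)
      = actDual w ((j : ℤ) • ν - (M : ℤ) • δ) := by
    rw [smul_add, hβ, actDual_sub, actDual_smul w (M : ℤ) δ]
    abel
  obtain ⟨τ, h1, h2, h3⟩ := hQ (w * u) (D.W.mul_mem hw hu) κ hκ (actDual w δ + β) (fun i => by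
    rw [hvec, pairZ_actDual]
    have : w.symm ((w * u) (Knop.e i)) = u (Knop.e i) := w.symm_apply_apply _
    rw [this]
    exact hpre i) (right_ne_zero_of_mul hw0)
  refine ⟨τ, h1, ?_, ?_⟩
  · rw [h2, pairZ_add_right, ell_actDual hw]
    have : pairZ D.ell ((M : ℤ) • β) = 0 := by
      rw [hβ, pairZ_sub_right, ell_actDual hw, sub_self]
    rw [pairZ_smul_right] at this
    have := (mul_eq_zero.1 this).resolve_left hMZ
    omega
  · rwa [hvec, mul_inv_rev, actDual_mul, actDual_inv_actDual] at h3

lemma eval_step_ne_zero {j : ℕ} (hj : j < M) {Q Q' : MvPolynomial ι ℂ}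
    (hTJ : TJ D ρ ν b M (j + 1) Q) (h0 : eval (ρ + toV ν) Q ≠ 0)
    (hQ' : ∀ z, eval z Q' * ∏ γ ∈ Rj D ν M j, evalC γ (z - ((j : ℂ) / M) • toV ν)
      = ∑ w ∈ Wj D ν M j, (Knop.eps w : ℂ) *
        eval (Knop.actV w (z - ((j : ℂ) / M) • toV ν) + ((j : ℂ) / M) • toV ν)
          (mj D k ν M (j + 1) * Q)) : eval (ρ + toV ν) Q' ≠ 0 := by
  have hM : (M : ℂ) ≠ 0 := by exact_mod_cast h.mpos.ne'
  have hMZ : (M : ℤ) ≠ 0 := by exact_mod_cast h.mpos.ne'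
  have h1mem : (1 : LatAut ι) ∈ Wj D ν M j := mem_Wj.2 ⟨D.W.one_mem, 0, by simp⟩
  intro hcon
  have hs := hQ' (ρ + toV ν)
  rw [hcon, zero_mul, Finset.sum_eq_single_of_mem 1 h1mem] at hs
  · rw [actV_one, sub_add_cancel, map_mul, eps_one] at hs
    have h2 := h.eval_mj_ne_zero (j := j + 1) (by omega) (by omega)
    refine mul_ne_zero ?_ (mul_ne_zero h2 h0) hs.symm
    norm_num
  · intro w hw hw1
    by_contra hw0
    obtain ⟨hw, β, hβ⟩ := mem_Wj.1 hw
    have hwW := hw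
    have hpt : Knop.actV w (ρ + toV ν - ((j : ℂ) / M) • toV ν) + ((j : ℂ) / M) • toV ν
        = Knop.actV w (ρ + toV ν) + toV β := by
      have hβ' : toV β = ((j : ℂ) / M) • toV ν - ((j : ℂ) / M) • Knop.actV w (toV ν) := by
        have := congrArg toV hβ
        rw [toV_smul, toV_sub, actDual_smul, toV_smul, toV_smul, toV_actDual] at this
        rw [← smul_sub, div_eq_inv_mul, mul_smul, smul_sub]
        push_cast at this
        rw [← this, smul_smul, inv_mul_cancel₀ hM, one_smul]
      rw [actV_sub, actV_smul, hβ']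
      abel
    rw [hpt, map_mul] at hw0
    have hw0 := right_ne_zero_of_mul hw0
    have hvec : (j : ℤ) • ν - (M : ℤ) • β = actDual w ((j : ℤ) • ν) := by
      rw [hβ]; abel
    have hpre := h.pre_succ hw (κ := ν) (δ := β) (j := j) (fun i => by
      rw [hvec, pairZ_actDual, LinearEquiv.symm_apply_apply, pairZ_smul_right, pairZ_e]
      have := h.pos i
      have hj' : (j : ℤ) ≤ M := by exact_mod_cast hj.le
      have hM0 : (0 : ℤ) < M := by exact_mod_cast h.mpos
      nlinarith) (left_ne_zero_of_mul hw0)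
    obtain ⟨τ, h1, h2, h3⟩ := hTJ w hw ν (fun i => (h.pos i).le) β hpre (right_ne_zero_of_mul hw0)
    have hβ0 : pairZ D.ell β = 0 := by
      have : pairZ D.ell ((M : ℤ) • β) = 0 := by
        rw [hβ, pairZ_sub_right, ell_actDual hw, sub_self]
      rw [pairZ_smul_right] at this
      exact (mul_eq_zero.1 this).resolve_left hMZ
    have hτ : τ = ν := by
      have hsum : ∑ i, D.ell i * (ν i - τ i) = 0 := by
        have : pairZ D.ell (ν - τ) = 0 := by rw [pairZ_sub_right, h2, hβ0]; ring
        exact this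
      rw [Finset.sum_eq_zero_iff_of_nonneg fun i _ =>
        mul_nonneg (D.C6 i).le (sub_nonneg.2 (h1 i))] at hsum
      ext i
      have := (mul_eq_zero.1 (hsum i (Finset.mem_univ _))).resolve_left (D.C6 i).ne'
      omega
    subst hτ
    have h4 := h.lt w⁻¹ (D.W.inv_mem hwW) (by simpa using hw1)
    have h5 : pairZ b (actDual w⁻¹ (((j + 1 : ℕ) : ℤ) • τ - (M : ℤ) • β))
        = pairZ b (actDual w⁻¹ τ) + j * pairZ b τ := by
      have : ((j + 1 : ℕ) : ℤ) • τ - (M : ℤ) • β = τ + actDual w ((j : ℤ) • τ) := by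
        rw [← hvec]
        push_cast
        rw [add_smul, one_smul]
        abel
      rw [this, actDual_add, actDual_inv_actDual, pairZ_add_right, pairZ_smul_right]
    rw [h5] at h3
    push_cast at h3
    linarith

/-- The degree of the polynomials obtained by descending induction. -/
def dg (D : Data ι) (ν : ι → ℤ) (M j : ℕ) : ℤ :=
  ∑ i ∈ Finset.Ico j M, (((Φj D ν M (i + 1)).card : ℤ) - (Rj D ν M i).card)

omit h in
lemma degLe_mj (j : ℕ) : DegLe (mj D k ν M j) (Φj D ν M j).card := by
  have := DegLe.prod (Φj D ν M j) (n := fun _ => 1)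
    (g := fun ω => lin ω - C (k ω + ((j * pairZ ω ν / M : ℤ) : ℂ) - 1))
    fun ω _ => (degLe_lin ω).sub ((degLe_C _).mono zero_le_one)
  rw [mj]
  simpa only [Finset.sum_const, nsmul_eq_mul, mul_one] using this

lemma exists_poly (j : ℕ) (hj : j ≤ M) : ∃ Q, DegLe Q (dg D ν M j) ∧ TJ D ρ ν b M j Q ∧
    eval (ρ + toV ν) Q ≠ 0 := by
  induction hj using Nat.decreasingInduction with
  | self => exact ⟨1, by simpa [dg] using degLe_one, h.TJ_base, by simp⟩
  | of_succ j hj ih =>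
    obtain ⟨Q, h1, h2, h3⟩ := ih
    obtain ⟨Q', h4, h5⟩ := exists_step (D := D) (ν := ν) (M := M) j (mj D k ν M (j + 1) * Q)
    refine ⟨Q', h4 _ ?_, h.TJ_step (h.TJ_mul h2) h5, h.eval_step_ne_zero hj h2 h3 h5⟩
    refine ((degLe_mj (j + 1)).mul h1).mono ?_
    rw [dg, dg, Finset.sum_eq_sum_Ico_succ_bot hj]
    linarith

lemma exists_poly_inv : ∃ Q, D.WInv Q ∧ DegLe Q (dg D ν M 0) ∧ TJ D ρ ν b M 0 Q ∧
    eval (ρ + toV ν) Q ≠ 0 := by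
  obtain ⟨Q, h1, h2, h3⟩ := h.exists_poly 1 h.mpos
  obtain ⟨Q', h4, h5⟩ := exists_step (D := D) (ν := ν) (M := M) 0 (mj D k ν M 1 * Q)
  refine ⟨Q', ?_, h4 _ ?_, h.TJ_step (h.TJ_mul h2) h5, h.eval_step_ne_zero h.mpos h2 h3 h5⟩
  · have hW0 : Wj D ν M 0 = D.Wf := by
      ext w
      rw [mem_Wj, mem_Wf]
      have h0 : actDual w (0 : ι → ℤ) = 0 := dual_ext fun γ => by simp
      exact ⟨fun hw => hw.1, fun hw => ⟨hw, 0, by simp [h0]⟩⟩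
    have hR0 : Rj D ν M 0 = D.Rpos := Finset.filter_true_of_mem fun γ _ => by simp
    have hsum : Q' * D.den = ∑ w ∈ D.Wf, C (Knop.eps w : ℂ) * actP w (mj D k ν M 1 * Q) := by
      refine MvPolynomial.funext fun z => ?_
      have := h5 z
      rw [hW0, hR0] at this
      simp only [Nat.cast_zero, zero_div, zero_smul, sub_zero, add_zero] at this
      simpa only [den, map_mul, map_prod, map_sum, eval_lin, eval_C, eval_actP] using this
    intro u hu z
    have h6 : actP u Q' * D.den = Q' * D.den := by
      have h7 := congrArg (actP u) hsum
      rw [map_mul, actP_den h.sgn hu] at h7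
      have h8 : actP u (∑ w ∈ D.Wf, C (Knop.eps w : ℂ) * actP w (mj D k ν M 1 * Q))
          = C (Knop.eps u : ℂ) * ∑ w ∈ D.Wf, C (Knop.eps w : ℂ) * actP w (mj D k ν M 1 * Q) := by
        rw [map_sum, Finset.mul_sum]
        refine Finset.sum_nbij' (fun w => w * u) (fun w => w * u⁻¹)
          (fun w hw => (mem_Wf D).2 (D.W.mul_mem ((mem_Wf D).1 hw) hu))
          (fun w hw => (mem_Wf D).2 (D.W.mul_mem ((mem_Wf D).1 hw) (D.W.inv_mem hu)))
          (fun w _ => by simp) (fun w _ => by simp) fun w _ => ?_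
        refine MvPolynomial.funext fun z => ?_
        have : (Knop.eps u : ℂ) * Knop.eps u = 1 := by exact_mod_cast eps_sq u
        simp only [map_mul, eval_actP, eval_C, eps_mul, actV_mul, algHom_C]
        push_cast
        simp only [algebraMap_eq, eval_C]
        linear_combination (-(Knop.eps w : ℂ) * (eval (Knop.actV w (Knop.actV u z)) (mj D k ν M 1) *
          eval (Knop.actV w (Knop.actV u z)) Q)) * this
      rw [h8, ← hsum] at h7
      refine mul_left_cancel₀ (C_ne_zero.2 (eps_ne_zero u)) ?_
      rw [← h7]
      ring
    rw [← eval_actP, mul_right_cancel₀ den_ne_zero h6]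
  · refine ((degLe_mj 1).mul h1).mono ?_
    rw [dg, dg, Finset.sum_eq_sum_Ico_succ_bot h.mpos]
    linarith

omit h in
lemma sum_indicator {a : ℤ} (ha : 0 < a) (hM : 0 < M) (hd : a ∣ M) :
    ∑ i ∈ Finset.range M, (if (M : ℤ) ∣ (i : ℕ) * a then 1 else 0 : ℤ) = a := by
  obtain ⟨c, hc⟩ := hd
  have hc0 : 0 < c := by
    have : 0 < a * c := by rw [← hc]; exact_mod_cast hM
    exact pos_of_mul_pos_right this ha.le
  lift c to ℕ using hc0.le
  have h1 : ∀ i : ℕ, (M : ℤ) ∣ i * a ↔ c ∣ i := fun i => by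
    rw [hc, mul_comm a, mul_dvd_mul_iff_right ha.ne']
    exact Int.natCast_dvd_natCast
  have h2 : ∑ i ∈ Finset.range M, (if (M : ℤ) ∣ ((i + 1 : ℕ) : ℤ) * a then 1 else 0 : ℤ) = a := by
    simp only [h1]
    rw [Finset.sum_boole, Nat.card_multiples]
    push_cast
    rw [hc, Int.mul_ediv_cancel _ (by omega)]
  have h3 := Finset.sum_range_succ (fun i : ℕ => (if (M : ℤ) ∣ i * a then 1 else 0 : ℤ)) M
  rw [Finset.sum_range_succ', h2] at h3
  simp only [Nat.cast_zero, zero_mul, dvd_zero, if_true, dvd_mul_right] at h3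
  linarith

lemma sum_indicator_succ {a : ℤ} (ha : 0 < a) (hd : a ∣ M) :
    ∑ i ∈ Finset.range M, (if (M : ℤ) ∣ ((i + 1 : ℕ) : ℤ) * a then 1 else 0 : ℤ) = a := by
  have h3 := Finset.sum_range_succ (fun i : ℕ => (if (M : ℤ) ∣ i * a then 1 else 0 : ℤ)) M
  rw [Finset.sum_range_succ', sum_indicator ha h.mpos hd] at h3
  simp only [Nat.cast_zero, zero_mul, dvd_zero, if_true, dvd_mul_right] at h3
  linarith

lemma dg_zero : dg D ν M 0 =
    ∑ ω ∈ D.Φ.filter (fun ω => 0 < pairZ ω ν), pairZ ω ν - ∑ γ ∈ D.Rpos, pairZ γ ν := by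
  have h1 : ∀ i : ℕ, ((Φj D ν M (i + 1)).card : ℤ) = ∑ ω ∈ D.Φ.filter (fun ω => 0 < pairZ ω ν),
      (if (M : ℤ) ∣ ((i + 1 : ℕ) : ℤ) * pairZ ω ν then 1 else 0 : ℤ) := fun i => by
    rw [Finset.sum_boole, Finset.filter_filter, Φj]
  have h2 : ∀ i : ℕ, ((Rj D ν M i).card : ℤ) = ∑ γ ∈ D.Rpos,
      (if (M : ℤ) ∣ i * pairZ γ ν then 1 else 0 : ℤ) := fun i => by
    rw [Finset.sum_boole, Rj]
  simp only [dg, h1, h2, Finset.sum_sub_distrib, ← Finset.range_eq_Ico]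
  rw [Finset.sum_comm, Finset.sum_comm (t := D.Rpos)]
  congr 1
  · refine Finset.sum_congr rfl fun ω hω => ?_
    obtain ⟨hω, hpos⟩ := Finset.mem_filter.1 hω
    exact h.sum_indicator_succ hpos (h.dvdΦ ω hω hpos)
  · refine Finset.sum_congr rfl fun γ hγ => ?_
    exact sum_indicator (h.dvdR γ hγ).1 h.mpos (h.dvdR γ hγ).2

/-- Comparing degrees yields the lower bound for the number of roots. -/
lemma R_subset_Δ (hU : D.Uniq ρ) : D.R ⊆ D.Δ := by
  obtain ⟨Q, h1, h2, h3, h4⟩ := h.exists_poly_inv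
  have hdeg : pairZ D.ell ν ≤ dg D ν M 0 := by
    by_contra! hcon
    have := hU (pairZ D.ell ν - 1) Q h1 (h2.mono (by omega)) fun κ hκ hκ' => by
      by_contra hne
      obtain ⟨τ, h5, h6, -⟩ := h3 1 D.W.one_mem κ hκ 0 (fun i => by
        simp only [Nat.cast_zero, zero_smul, smul_zero, sub_zero, pairZ_zero_right]
        have := hκ i
        have hM : (0 : ℤ) < M := by exact_mod_cast h.mpos
        positivity) (by simpa using hne)
      have : 0 ≤ pairZ D.ell (κ - τ) := ell_nonneg fun i => sub_nonneg.2 (h5 i)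
      rw [pairZ_sub_right, h6, pairZ_zero_right] at this
      omega
    rw [this, map_zero] at h4
    exact h4 rfl
  rw [h.dg_zero] at hdeg
  have hΦ : D.Φ.filter (fun ω => 0 < pairZ ω ν) = D.Φ.filter fun ω => ∀ i, 0 ≤ ω i := by
    refine Finset.filter_congr fun ω hω => ⟨fun hpos => ?_, fun hnn => ?_⟩
    · refine (D.C3 ω hω).resolve_right fun hneg => ?_
      have : pairZ ω ν ≤ 0 := Finset.sum_nonpos fun i _ =>
        mul_nonpos_of_nonpos_of_nonneg (hneg i) (h.pos i).le
      omega
    · refine lt_of_le_of_ne (pairZ_nonneg hnn fun i => (h.pos i).le) fun h0 => ?_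
      have := (Finset.sum_eq_zero_iff_of_nonneg fun i _ =>
        mul_nonneg (hnn i) (h.pos i).le).1 h0.symm
      refine ne_zero_of_mem_Φ hω (_root_.funext fun i => ?_)
      exact (mul_eq_zero.1 (this i (Finset.mem_univ _))).resolve_right (h.pos i).ne'
  have hC5 := congrArg (fun x => pairZ x ν) D.C5
  simp only [pairZ_sub, pairZ_sum] at hC5
  rw [hΦ, ← hC5] at hdeg
  have hsub : D.Δ.filter (fun α => ∀ i, 0 ≤ α i) ⊆ D.Rpos :=
    Finset.filter_subset_filter _ Δ_subset_R
  have hkey : ∀ γ ∈ D.Rpos, γ ∈ D.Δ := by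
    intro γ hγ
    by_contra hγ'
    have := Finset.sum_lt_sum_of_subset hsub hγ (fun h' => hγ' (Finset.mem_filter.1 h').1)
      (h.dvdR γ hγ).1 (f := fun γ => pairZ γ ν) fun γ' h' _ => (h.dvdR γ' h').1.le
    simp only [Rpos] at this hdeg
    linarith
  intro γ hγ
  rcases h.sgn γ hγ with h5 | h5
  · exact hkey γ (Finset.mem_filter.2 ⟨hγ, h5⟩)
  · have := D.Δ_neg _ (hkey (-γ) (Finset.mem_filter.2 ⟨neg_mem_R hγ, fun i => by simpa using h5 i⟩))
    rwa [neg_neg] at this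

end Cfg

/-- The set of roots is stable under the reflection group. -/
theorem R_eq_Δ {ρ' : ι → ℂ} (h' : D.InV0 ρ') (hU : D.Uniq ρ') (hE : D.Exist ρ') : D.R = D.Δ := by
  have hsgn : ∀ γ ∈ D.R, (∀ i, 0 ≤ γ i) ∨ ∀ i, γ i ≤ 0 := fun γ => one_signed h' hE
  obtain ⟨ν, hν, hν'⟩ := exists_pos_generic
    (D.R ∪ D.Φ ∪ ((D.Wf ×ˢ Finset.univ).image fun x => x.1.symm (Knop.e x.2) - Knop.e x.2).filter
      fun γ => γ ≠ 0) (by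
      intro γ hγ
      simp only [Finset.mem_union, Finset.mem_filter] at hγ
      rcases hγ with (hγ | hγ) | hγ
      · exact ne_zero_of_mem_R hγ
      · exact ne_zero_of_mem_Φ hγ
      · exact hγ.2)
  have hνR : ∀ γ ∈ D.R, pairZ γ ν ≠ 0 := fun γ hγ => hν' γ (by simp [hγ])
  have hνΦ : ∀ γ ∈ D.Φ, pairZ γ ν ≠ 0 := fun γ hγ => hν' γ (by simp [hγ])
  have hνW : ∀ w ∈ D.W, w ≠ 1 → actDual w ν ≠ ν := by
    intro w hw hw1 hwν
    apply hw1
    have : ∀ i, w.symm (Knop.e i) = Knop.e i := fun i => by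
      by_contra hne
      refine hν' (w.symm (Knop.e i) - Knop.e i) ?_ ?_
      · refine Finset.mem_union_right _ (Finset.mem_filter.2 ⟨Finset.mem_image.2
          ⟨(w, i), by simp [mem_Wf, hw], rfl⟩, sub_ne_zero.2 hne⟩)
      · rw [pairZ_sub, ← pairZ_actDual, hwν, sub_self]
    refine LinearEquiv.ext fun x => dual_ext fun y => ?_
    change pairZ y (w x) = pairZ y x
    have hx : w x = x := by
      conv_lhs => rw [← sum_smul_e x]
      conv_rhs => rw [← sum_smul_e x]
      rw [map_sum]
      refine Finset.sum_congr rfl fun i _ => ?_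
      rw [map_smul, ← (LinearEquiv.symm_apply_eq w).1 (this i)]
    rw [hx]
  obtain ⟨ρ, k, hgood, hk, hgen⟩ := exists_good_generic h' hU hE ν
  obtain ⟨b, hb⟩ := exists_max_form hνW
  set M := (∏ γ ∈ D.R ∪ D.Φ, pairZ γ ν).natAbs with hM
  have hdvd : ∀ γ ∈ D.R ∪ D.Φ, pairZ γ ν ∣ M := fun γ hγ => by
    rw [hM, Int.dvd_natAbs]
    exact Finset.dvd_prod_of_mem _ hγ
  have hcfg : Cfg D ρ k ν b M := by
    refine ⟨hk, hgood.nonInt, hsgn, hν, ?_, ?_, fun ω hω _ => hdvd ω (by simp [hω]), hb, hgen⟩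
    · rw [hM, Int.natAbs_pos, Finset.prod_ne_zero_iff]
      intro γ hγ
      rcases Finset.mem_union.1 hγ with hγ | hγ
      · exact hνR γ hγ
      · exact hνΦ γ hγ
    · intro γ hγ
      obtain ⟨hγ, hnn⟩ := Finset.mem_filter.1 hγ
      exact ⟨lt_of_le_of_ne (pairZ_nonneg hnn fun i => (hν i).le) (hνR γ hγ).symm,
        hdvd γ (by simp [hγ])⟩
  exact (hcfg.R_subset_Δ hgood.uniq).antisymm Δ_subset_R

end Data

/-! ### Rational functions with a degree bound -/

lemma totalDegree_trP (v : ι → ℂ) (p : MvPolynomial ι ℂ) : (trP v p).totalDegree = p.totalDegree := by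
  have key : ∀ (v : ι → ℂ) (p : MvPolynomial ι ℂ), (trP v p).totalDegree ≤ p.totalDegree := by
    intro v p
    rcases (degLe_totalDegree p).trP v with h | h
    · simp [h]
    · exact_mod_cast h
  refine (key v p).antisymm ?_
  have h := key (-v) (trP v p)
  have h2 : trP (-v) (trP v p) = p := MvPolynomial.funext fun z => by simp [eval_trP]
  rwa [h2] at h

lemma totalDegree_prod_lin {S : Finset (ι → ℤ)} (hS : ∀ γ ∈ S, γ ≠ 0) :
    (∏ γ ∈ S, lin γ).totalDegree = S.card := by
  induction S using Finset.induction_on with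
  | empty => simp
  | insert γ S hγ ih =>
    have hS' : ∀ γ ∈ S, γ ≠ 0 := fun γ' h' => hS γ' (Finset.mem_insert_of_mem h')
    have hne := hS γ (Finset.mem_insert_self _ _)
    rw [Finset.prod_insert hγ, Finset.card_insert_of_notMem hγ, totalDegree_mul_of_isDomain
      (lin_ne_zero hne) (Finset.prod_ne_zero_iff.2 fun γ' h' => lin_ne_zero (hS' γ' h')),
      totalDegree_lin hne, ih hS', add_comm]

namespace Data

variable {D : Data ι}

lemma exists_nonInt (D : Data ι) : ∃ z, NonInt D.R z := by
  obtain ⟨z, hz, -⟩ := exists_nonInt_eval_ne_zero (S := D.R) (fun γ => ne_zero_of_mem_R)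
    (q := (1 : MvPolynomial ι ℂ)) one_ne_zero
  exact ⟨z, hz⟩

lemma eq_of_nonInt {p q : MvPolynomial ι ℂ} (h : ∀ z, NonInt D.R z → eval z p = eval z q) : p = q :=
  sub_eq_zero.1 (eq_zero_of_nonInt (S := D.R) (fun _ => ne_zero_of_mem_R) fun z hz => by
    rw [map_sub, h z hz, sub_self])

lemma nonInt_actV {w : LatAut ι} (hw : w ∈ D.W) {z : ι → ℂ} (hz : NonInt D.R z) :
    NonInt D.R (Knop.actV w z) := fun γ hγ n => by
  rw [evalC_actV]
  exact hz _ (map_mem_R (symm_mem hw) hγ) n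

/-- A function which, away from the integral root hyperplanes, is rational of degree `≤ m`. -/
def RatDeg (D : Data ι) (m : ℤ) (F : (ι → ℂ) → ℂ) : Prop :=
  ∃ a b : MvPolynomial ι ℂ, (∀ z, NonInt D.R z → eval z b ≠ 0 ∧ F z * eval z b = eval z a) ∧
    DegLe a (m + b.totalDegree)

namespace RatDeg

variable {F G : (ι → ℂ) → ℂ} {m n : ℤ}

lemma ne_zero_of_eval {b : MvPolynomial ι ℂ} (h : ∀ z, NonInt D.R z → eval z b ≠ 0) : b ≠ 0 := by
  obtain ⟨z, hz⟩ := exists_nonInt D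
  rintro rfl
  exact h z hz (map_zero _)

lemma mono (h : D.RatDeg m F) (hmn : m ≤ n) : D.RatDeg n F := by
  obtain ⟨a, b, h1, h2⟩ := h
  exact ⟨a, b, h1, h2.mono (by omega)⟩

lemma poly {p : MvPolynomial ι ℂ} (h : DegLe p m) : D.RatDeg m fun z => eval z p :=
  ⟨p, 1, fun z _ => by simp, by simpa using h⟩

lemma add (hF : D.RatDeg m F) (hG : D.RatDeg m G) : D.RatDeg m fun z => F z + G z := by
  obtain ⟨a, b, h1, h2⟩ := hF
  obtain ⟨a', b', h1', h2'⟩ := hG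
  have hb := ne_zero_of_eval fun z hz => (h1 z hz).1
  have hb' := ne_zero_of_eval fun z hz => (h1' z hz).1
  refine ⟨a * b' + a' * b, b * b', fun z hz => ⟨?_, ?_⟩, ?_⟩
  · rw [map_mul]; exact mul_ne_zero (h1 z hz).1 (h1' z hz).1
  · rw [map_add, map_mul, map_mul, map_mul, ← (h1 z hz).2, ← (h1' z hz).2]; ring
  · rw [totalDegree_mul_of_isDomain hb hb']
    push_cast
    refine DegLe.add ((h2.mul (degLe_totalDegree b')).mono (by omega))
      ((h2'.mul (degLe_totalDegree b)).mono (by omega))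

lemma mul (hF : D.RatDeg m F) (hG : D.RatDeg n G) : D.RatDeg (m + n) fun z => F z * G z := by
  obtain ⟨a, b, h1, h2⟩ := hF
  obtain ⟨a', b', h1', h2'⟩ := hG
  have hb := ne_zero_of_eval fun z hz => (h1 z hz).1
  have hb' := ne_zero_of_eval fun z hz => (h1' z hz).1
  refine ⟨a * a', b * b', fun z hz => ⟨?_, ?_⟩, ?_⟩
  · rw [map_mul]; exact mul_ne_zero (h1 z hz).1 (h1' z hz).1
  · rw [map_mul, map_mul, ← (h1 z hz).2, ← (h1' z hz).2]; ring
  · rw [totalDegree_mul_of_isDomain hb hb']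
    push_cast
    exact (h2.mul h2').mono (by omega)

lemma const_mul (c : ℂ) (hF : D.RatDeg m F) : D.RatDeg m fun z => c * F z := by
  have := (poly (D := D) (degLe_C (ι := ι) c)).mul hF
  simpa using this

lemma sub (hF : D.RatDeg m F) (hG : D.RatDeg m G) : D.RatDeg m fun z => F z - G z := by
  have := hF.add (hG.const_mul (-1))
  simpa [sub_eq_add_neg] using this

lemma sum {κ : Type*} (s : Finset κ) {f : κ → (ι → ℂ) → ℂ} (h : ∀ j ∈ s, D.RatDeg m (f j)) :
    D.RatDeg m fun z => ∑ j ∈ s, f j z := by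
  induction s using Finset.induction_on with
  | empty => simpa using poly (D := D) (degLe_zero (ι := ι) m)
  | insert a s ha ih =>
    simp only [Finset.sum_insert ha]
    exact (h a (Finset.mem_insert_self _ _)).add
      (ih fun j hj => h j (Finset.mem_insert_of_mem hj))

lemma prod {κ : Type*} (s : Finset κ) {f : κ → (ι → ℂ) → ℂ} (h : ∀ j ∈ s, D.RatDeg m (f j)) :
    D.RatDeg (s.card * m) fun z => ∏ j ∈ s, f j z := by
  induction s using Finset.induction_on with
  | empty => simpa using poly (D := D) (degLe_one (ι := ι))
  | insert a s ha ih =>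
    simp only [Finset.prod_insert ha, Finset.card_insert_of_notMem ha]
    exact ((h a (Finset.mem_insert_self _ _)).mul
      (ih fun j hj => h j (Finset.mem_insert_of_mem hj))).mono (by push_cast; linarith)

lemma shift (hF : D.RatDeg m F) (τ : ι → ℤ) : D.RatDeg m fun z => F (z - toV τ) := by
  obtain ⟨a, b, h1, h2⟩ := hF
  refine ⟨trP (-toV τ) a, trP (-toV τ) b, fun z hz => ?_, ?_⟩
  · rw [eval_trP, eval_trP, ← sub_eq_add_neg]
    exact h1 _ (hz.sub_toV τ)
  · rw [totalDegree_trP]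
    exact h2.trP _

lemma sub_shift (hF : D.RatDeg m F) (τ : ι → ℤ) : D.RatDeg (m - 1) fun z => F z - F (z - toV τ) := by
  obtain ⟨a, b, h1, h2⟩ := hF
  have hb := ne_zero_of_eval fun z hz => (h1 z hz).1
  have h1' : ∀ z, NonInt D.R z → eval z (trP (-toV τ) b) ≠ 0 ∧
      F (z - toV τ) * eval z (trP (-toV τ) b) = eval z (trP (-toV τ) a) := fun z hz => by
    rw [eval_trP, eval_trP, ← sub_eq_add_neg]
    exact h1 _ (hz.sub_toV τ)
  have hb' := ne_zero_of_eval fun z hz => (h1' z hz).1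
  refine ⟨a * (trP (-toV τ) b - b) - (trP (-toV τ) a - a) * b, b * trP (-toV τ) b,
    fun z hz => ⟨?_, ?_⟩, ?_⟩
  · rw [map_mul]; exact mul_ne_zero (h1 z hz).1 (h1' z hz).1
  · rw [map_sub, map_mul, map_mul, map_mul, map_sub, map_sub, ← (h1 z hz).2, ← (h1' z hz).2]; ring
  · rw [totalDegree_mul_of_isDomain hb hb', totalDegree_trP]
    push_cast
    exact ((h2.mul ((degLe_totalDegree b).trP_sub _)).mono (by omega)).sub
      (((h2.trP_sub _).mul (degLe_totalDegree b)).mono (by omega))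

lemma degLe {p : MvPolynomial ι ℂ} (h : D.RatDeg m F) (hp : ∀ z, NonInt D.R z → F z = eval z p) :
    DegLe p m := by
  obtain ⟨a, b, h1, h2⟩ := h
  have hb := ne_zero_of_eval fun z hz => (h1 z hz).1
  refine DegLe.of_mul hb ?_
  have : p * b = a := eq_of_nonInt (D := D) fun z hz => by
    rw [map_mul, ← hp z hz, (h1 z hz).2]
  rwa [this]

lemma eq_zero_of_mul (h : D.RatDeg m F) {q : MvPolynomial ι ℂ} (hq : q ≠ 0)
    (h0 : ∀ z, NonInt D.R z → F z * eval z q = 0) {z : ι → ℂ} (hz : NonInt D.R z) : F z = 0 := by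
  obtain ⟨a, b, h1, -⟩ := h
  have haq : a * q = 0 := eq_of_nonInt (D := D) fun z hz => by
    rw [map_mul, ← (h1 z hz).2, map_zero]
    linear_combination eval z b * h0 z hz
  have ha := (mul_eq_zero.1 haq).resolve_right hq
  have := (h1 z hz).2
  rw [ha, map_zero] at this
  exact (mul_eq_zero.1 this).resolve_right (h1 z hz).1

end RatDeg

/-! ### Separation of the coefficients of a difference operator -/

lemma exists_actDual_e_ne {w : LatAut ι} (hw : w ≠ 1) : ∃ i, actDual w (Knop.e i) ≠ Knop.e i := by
  by_contra! hcon
  apply hw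
  have h1 : ∀ γ, w.symm γ = γ := fun γ => by
    ext i
    have := pairZ_actDual w γ (Knop.e i)
    rw [hcon i, pairZ_e_right, pairZ_e_right] at this
    exact this.symm
  exact LinearEquiv.ext fun γ => by
    have := h1 (w γ)
    rw [LinearEquiv.symm_apply_apply] at this
    exact this.symm

lemma coeff_eq_zero {T : Finset (ι → ℤ)} {c : (ι → ℤ) → (ι → ℂ) → ℂ}
    (hc : ∀ τ ∈ T, ∃ m, D.RatDeg m (c τ))
    (h : ∀ p, D.WInv p → ∀ z, NonInt D.R z → ∑ τ ∈ T, c τ z * eval (z - toV τ) p = 0)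
    {τ₀ : ι → ℤ} (hτ₀ : τ₀ ∈ T) {z : ι → ℂ} (hz : NonInt D.R z) : c τ₀ z = 0 := by
  obtain ⟨γ, -, hγ⟩ := exists_pos_generic
    (((T.image fun τ => τ - τ₀) ∪
      ((D.Wf ×ˢ Finset.univ).image fun x => actDual x.1 (Knop.e x.2) - Knop.e x.2)).filter
      fun γ => γ ≠ 0) (fun γ hγ => (Finset.mem_filter.1 hγ).2)
  have hγT : ∀ τ ∈ T, τ ≠ τ₀ → pairZ γ (τ - τ₀) ≠ 0 := fun τ hτ hne => by
    rw [pairZ_comm]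
    refine hγ _ (Finset.mem_filter.2 ⟨Finset.mem_union_left _ (Finset.mem_image_of_mem _ hτ),
      sub_ne_zero.2 hne⟩)
  have hγW : ∀ w ∈ D.W, w ≠ 1 → w.symm γ - γ ≠ 0 := fun w hw hw1 h0 => by
    obtain ⟨i, hi⟩ := exists_actDual_e_ne hw1
    refine hγ (actDual w (Knop.e i) - Knop.e i) (Finset.mem_filter.2 ⟨Finset.mem_union_right _
      (Finset.mem_image.2 ⟨(w, i), by simp [mem_Wf, hw], rfl⟩), sub_ne_zero.2 hi⟩) ?_
    rw [pairZ_comm, pairZ_sub_right, pairZ_actDual, ← pairZ_sub, h0, pairZ_zero]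
  let r : MvPolynomial ι ℂ := ∏ τ ∈ T.erase τ₀, ∏ w ∈ D.Wf,
    (lin (w.symm γ - γ) - C (pairZ (w.symm γ) τ₀ - pairZ γ τ : ℂ))
  have hr : r ≠ 0 := by
    refine Finset.prod_ne_zero_iff.2 fun τ hτ => Finset.prod_ne_zero_iff.2 fun w hw h0 => ?_
    obtain ⟨hne, hτ⟩ := Finset.mem_erase.1 hτ
    have hc0 := congrArg (eval (0 : ι → ℂ)) h0
    rw [map_sub, eval_lin, eval_C, evalC_zero_right, map_zero, zero_sub, neg_eq_zero] at hc0
    rw [hc0, C_0, sub_zero] at h0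
    have hw1 : w = 1 := by
      by_contra hw1
      exact lin_ne_zero (hγW w ((mem_Wf D).1 hw) hw1) h0
    subst hw1
    refine hγT τ hτ hne ?_
    rw [pairZ_sub_right]
    have : (pairZ γ τ₀ : ℂ) - pairZ γ τ = 0 := hc0
    have : pairZ γ τ₀ - pairZ γ τ = 0 := by exact_mod_cast this
    omega
  obtain ⟨m, hm⟩ := hc τ₀ hτ₀
  refine hm.eq_zero_of_mul hr (fun z hz => ?_) hz
  let p : MvPolynomial ι ℂ := ∏ τ ∈ T.erase τ₀, ∏ w ∈ D.Wf,
    (lin (w.symm γ) - C (evalC γ (z - toV τ)))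
  have hp : ∀ x, eval x p = ∏ τ ∈ T.erase τ₀, ∏ w ∈ D.Wf,
      (evalC γ (Knop.actV w x) - evalC γ (z - toV τ)) := fun x => by
    simp [p]
  have hpinv : D.WInv p := fun u hu x => by
    rw [hp, hp]
    refine Finset.prod_congr rfl fun τ _ => ?_
    refine Finset.prod_nbij' (fun w => w * u) (fun w => w * u⁻¹)
      (fun w hw => (mem_Wf D).2 (D.W.mul_mem ((mem_Wf D).1 hw) hu))
      (fun w hw => (mem_Wf D).2 (D.W.mul_mem ((mem_Wf D).1 hw) (D.W.inv_mem hu)))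
      (fun w _ => by simp) (fun w _ => by simp) fun w _ => by rw [actV_mul]
  have hsum := h p hpinv z hz
  rw [Finset.sum_eq_single_of_mem τ₀ hτ₀] at hsum
  · rw [← hsum, hp]
    congr 1
    rw [map_prod]
    refine Finset.prod_congr rfl fun τ _ => ?_
    rw [map_prod]
    refine Finset.prod_congr rfl fun w _ => ?_
    rw [map_sub, eval_lin, eval_C, evalC_actV, evalC_sub, evalC_sub_right, evalC_sub_right, evalC_toV,
      evalC_toV]
    ring
  · intro τ hτ hne
    rw [hp, Finset.prod_eq_zero (Finset.mem_erase.2 ⟨hne, hτ⟩), mul_zero]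
    refine Finset.prod_eq_zero ((mem_Wf D).2 D.W.one_mem) ?_
    rw [actV_one, sub_self]

end Data

/-! ### The coefficients of the basic difference operator -/

lemma ffall_one (x : ℂ) : ffall x 1 = x := by simp [ffall]

namespace Data

variable {D : Data ι}

lemma sgn_of_R_eq (hR : D.R = D.Δ) : ∀ γ ∈ D.R, (∀ i, 0 ≤ γ i) ∨ ∀ i, γ i ≤ 0 := by
  rw [hR]
  exact D.C2

lemma pair_of_mem_Δ (hR : D.R = D.Δ) {η : ι → ℤ} (hη : η ∈ D.Λ₁) {α : ι → ℤ} (hα : α ∈ D.Δ) :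
    pairZ α η = -1 ∨ pairZ α η = 0 ∨ pairZ α η = 1 := by
  obtain ⟨u, hu, i, hi, rfl⟩ := (D.Λ₁_spec _).1 hη
  rw [pairZ_actDual, pairZ_e_right]
  exact D.C7 i hi _ (Or.inl (hR ▸ map_mem_R (symm_mem hu) (Δ_subset_R hα)))

lemma map_mem_Δ (hR : D.R = D.Δ) {w : LatAut ι} (hw : w ∈ D.W) {α : ι → ℤ} (hα : α ∈ D.Δ) :
    w α ∈ D.Δ := hR ▸ map_mem_R hw (Δ_subset_R hα)

lemma fgen_actDual (hR : D.R = D.Δ) {ρ : ι → ℂ} {k : (ι → ℤ) → ℂ} (hk : D.IsK ρ k)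
    {w : LatAut ι} (hw : w ∈ D.W) (η : ι → ℤ) (z : ι → ℂ) :
    D.fgen k (actDual w η) (Knop.actV w z) = D.fgen k η z := by
  unfold fgen
  simp only [pairZ_actDual, evalC_actV]
  congr 1
  · refine Finset.prod_nbij' (fun ω => w.symm ω) (fun ω => w ω) ?_ ?_
      (fun ω _ => w.apply_symm_apply ω) (fun ω _ => w.symm_apply_apply ω) ?_
    · intro ω hω
      rw [Finset.mem_filter] at hω ⊢
      exact ⟨map_mem_Φ (symm_mem hw) hω.1, hω.2⟩
    · intro ω hω
      rw [Finset.mem_filter] at hω ⊢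
      exact ⟨map_mem_Φ hw hω.1, by simpa using hω.2⟩
    · intro ω hω
      rw [hk.map_eq (symm_mem hw) (Finset.mem_filter.1 hω).1]
  · refine Finset.prod_nbij' (fun ω => w.symm ω) (fun ω => w ω) ?_ ?_
      (fun ω _ => w.apply_symm_apply ω) (fun ω _ => w.symm_apply_apply ω) (fun ω _ => rfl)
    · intro ω hω
      rw [Finset.mem_filter] at hω ⊢
      exact ⟨map_mem_Δ hR (symm_mem hw) hω.1, hω.2⟩
    · intro ω hω
      rw [Finset.mem_filter] at hω ⊢
      exact ⟨map_mem_Δ hR hw hω.1, by simpa using hω.2⟩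

/-- The elements of `Φ` which are positive on `η`. -/
def Φup (D : Data ι) (η : ι → ℤ) : Finset (ι → ℤ) := D.Φ.filter fun ω => 0 < pairZ ω η

/-- The roots which are positive on `η`. -/
def Δup (D : Data ι) (η : ι → ℤ) : Finset (ι → ℤ) := D.Δ.filter fun α => 0 < pairZ α η

/-- The numerator of `f_η`. -/
def num (D : Data ι) (k : (ι → ℤ) → ℂ) (η : ι → ℤ) : MvPolynomial ι ℂ :=
  ∏ ω ∈ D.Φup η, (lin ω - C (k ω))

/-- The denominator of `f_η`. -/
def dn (D : Data ι) (η : ι → ℤ) : MvPolynomial ι ℂ := ∏ α ∈ D.Δup η, lin α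

lemma fgen_eq (hR : D.R = D.Δ) (k : (ι → ℤ) → ℂ) {η : ι → ℤ} (hη : η ∈ D.Λ₁) (z : ι → ℂ) :
    D.fgen k η z = eval z (D.num k η) / eval z (D.dn η) := by
  rw [fgen, num, dn, map_prod, map_prod]
  congr 1
  · refine Finset.prod_congr rfl fun ω hω => ?_
    obtain ⟨hω, hpos⟩ := Finset.mem_filter.1 hω
    have : pairZ ω η = 1 := by rcases pair_of_mem_Λ₁ hη hω with h | h | h <;> omega
    simp [this, ffall_one]
  · refine Finset.prod_congr rfl fun ω hω => ?_
    obtain ⟨hω, hpos⟩ := Finset.mem_filter.1 hω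
    have : pairZ ω η = 1 := by rcases pair_of_mem_Δ hR hη hω with h | h | h <;> omega
    simp [this, ffall_one]

lemma eval_dn_ne_zero (η : ι → ℤ) {z : ι → ℂ} (hz : NonInt D.R z) : eval z (D.dn η) ≠ 0 := by
  rw [dn, map_prod]
  refine Finset.prod_ne_zero_iff.2 fun α hα => ?_
  rw [eval_lin]
  exact hz.ne_zero (Δ_subset_R (Finset.mem_filter.1 hα).1)

lemma fgen_mul_dn (hR : D.R = D.Δ) (k : (ι → ℤ) → ℂ) {η : ι → ℤ} (hη : η ∈ D.Λ₁) {z : ι → ℂ}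
    (hz : NonInt D.R z) : D.fgen k η z * eval z (D.dn η) = eval z (D.num k η) := by
  rw [fgen_eq hR k hη, div_mul_cancel₀ _ (eval_dn_ne_zero η hz)]

lemma sum_coord_eq_card {S : Finset (ι → ℤ)} (hS : ∀ γ ∈ S, (∀ i, 0 ≤ γ i) ∨ ∀ i, γ i ≤ 0) {i : ι}
    (hi : ∀ γ ∈ S, γ i = -1 ∨ γ i = 0 ∨ γ i = 1) :
    ∑ γ ∈ S.filter (fun γ => ∀ j, 0 ≤ γ j), γ i = (S.filter fun γ => 0 < γ i).card := by
  rw [Finset.card_eq_sum_ones, Finset.sum_filter, Finset.sum_filter]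
  push_cast
  refine Finset.sum_congr rfl fun γ hγ => ?_
  rcases hS γ hγ with h | h
  · rw [if_pos h]
    have := h i
    rcases hi γ hγ with h1 | h1 | h1
    · omega
    · simp [h1]
    · simp [h1]
  · have := h i
    rw [if_neg (not_lt.2 this)]
    split_ifs with h'
    · exact le_antisymm this (h' i)
    · rfl

lemma card_Φup (hR : D.R = D.Δ) {η : ι → ℤ} (hη : η ∈ D.Λ₁) :
    (D.Φup η).card = (D.Δup η).card + 1 := by
  obtain ⟨u, hu, i, hi, rfl⟩ := (D.Λ₁_spec _).1 hη
  have h1 : (D.Φup (actDual u (Knop.e i))).card = (D.Φ.filter fun γ => 0 < γ i).card := by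
    refine Finset.card_nbij' (fun ω => u.symm ω) (fun ω => u ω) ?_ ?_
      (fun ω _ => u.apply_symm_apply ω) (fun ω _ => u.symm_apply_apply ω)
    · intro ω hω
      simp only [Φup, Finset.coe_filter, Set.mem_ofPred_eq, pairZ_actDual, pairZ_e_right] at hω ⊢
      exact ⟨map_mem_Φ (symm_mem hu) hω.1, hω.2⟩
    · intro ω hω
      simp only [Φup, Finset.coe_filter, Set.mem_ofPred_eq, pairZ_actDual, pairZ_e_right,
        LinearEquiv.symm_apply_apply] at hω ⊢
      exact ⟨map_mem_Φ hu hω.1, hω.2⟩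
  have h2 : (D.Δup (actDual u (Knop.e i))).card = (D.Δ.filter fun γ => 0 < γ i).card := by
    refine Finset.card_nbij' (fun ω => u.symm ω) (fun ω => u ω) ?_ ?_
      (fun ω _ => u.apply_symm_apply ω) (fun ω _ => u.symm_apply_apply ω)
    · intro ω hω
      simp only [Δup, Finset.coe_filter, Set.mem_ofPred_eq, pairZ_actDual, pairZ_e_right] at hω ⊢
      exact ⟨map_mem_Δ hR (symm_mem hu) hω.1, hω.2⟩
    · intro ω hω
      simp only [Δup, Finset.coe_filter, Set.mem_ofPred_eq, pairZ_actDual, pairZ_e_right,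
        LinearEquiv.symm_apply_apply] at hω ⊢
      exact ⟨map_mem_Δ hR hu hω.1, hω.2⟩
  have h5 := congrFun D.C5 i
  rw [Pi.sub_apply, Finset.sum_apply, Finset.sum_apply,
    sum_coord_eq_card D.C3 fun γ hγ => D.C7 i hi γ (Or.inr hγ),
    sum_coord_eq_card D.C2 fun γ hγ => D.C7 i hi γ (Or.inl hγ), hi] at h5
  omega

lemma ratDeg_fgen (hR : D.R = D.Δ) (k : (ι → ℤ) → ℂ) {η : ι → ℤ} (hη : η ∈ D.Λ₁) :
    D.RatDeg 1 (D.fgen k η) := by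
  refine ⟨D.num k η, D.dn η, fun z hz => ⟨eval_dn_ne_zero η hz, fgen_mul_dn hR k hη hz⟩, ?_⟩
  rw [dn, totalDegree_prod_lin (S := D.Δup η) fun γ hγ =>
    ne_zero_of_mem_R (Δ_subset_R (Finset.mem_filter.1 hγ).1)]
  have : DegLe (D.num k η) (∑ _ω ∈ D.Φup η, 1) :=
    DegLe.prod _ fun ω _ => (degLe_lin ω).sub ((degLe_C _).mono zero_le_one)
  refine this.mono ?_
  rw [Finset.sum_const, card_Φup hR hη]
  simp only [nsmul_eq_mul, mul_one]
  push_cast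
  omega

/-! ### Difference operators -/

/-- The operator `g T_τ`. -/
def monoOp (g : (ι → ℂ) → ℂ) (τ : ι → ℤ) : Module.End ℂ ((ι → ℂ) → ℂ) where
  toFun F z := g z * F (z - toV τ)
  map_add' F G := by ext z; simp [mul_add]
  map_smul' c F := by ext z; simp; ring

lemma monoOp_apply (g : (ι → ℂ) → ℂ) (τ : ι → ℤ) (F : (ι → ℂ) → ℂ) (z : ι → ℂ) :
    monoOp g τ F z = g z * F (z - toV τ) := rfl

/-- Multiplication by a polynomial. -/
def mulOp (h : MvPolynomial ι ℂ) : Module.End ℂ ((ι → ℂ) → ℂ) := monoOp (fun z => eval z h) 0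

@[simp] lemma mulOp_apply (h : MvPolynomial ι ℂ) (F : (ι → ℂ) → ℂ) (z : ι → ℂ) :
    mulOp h F z = eval z h * F z := by
  rw [mulOp, monoOp_apply, toV_zero, sub_zero]

lemma mulOp_mul (h₁ h₂ : MvPolynomial ι ℂ) : mulOp (h₁ * h₂) = mulOp h₁ * mulOp h₂ := by
  ext F z
  simp [mul_assoc]

/-- The operator `L = ∑ f_η T_η`. -/
def Lop (D : Data ι) (k : (ι → ℤ) → ℂ) : Module.End ℂ ((ι → ℂ) → ℂ) :=
  ∑ η ∈ D.Λ₁, monoOp (D.fgen k η) η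

lemma Lop_apply (k : (ι → ℤ) → ℂ) (F : (ι → ℂ) → ℂ) (z : ι → ℂ) :
    D.Lop k F z = ∑ η ∈ D.Λ₁, D.fgen k η z * F (z - toV η) := by
  simp [Lop, monoOp_apply]

/-- The difference operators with coefficients of degree `≤ m`. -/
def diffSub (D : Data ι) (m : ℤ) : Submodule ℂ (Module.End ℂ ((ι → ℂ) → ℂ)) :=
  Submodule.span ℂ {A | ∃ g τ, D.RatDeg m g ∧ A = monoOp g τ}

lemma mulOp_mem_diffSub {h : MvPolynomial ι ℂ} {m : ℤ} (hm : DegLe h m) : mulOp h ∈ D.diffSub m :=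
  Submodule.subset_span ⟨_, 0, .poly hm, rfl⟩

lemma Lop_comm_mem_diffSub (hR : D.R = D.Δ) (k : (ι → ℤ) → ℂ) {m : ℤ}
    {A : Module.End ℂ ((ι → ℂ) → ℂ)} (hA : A ∈ D.diffSub m) :
    D.Lop k * A - A * D.Lop k ∈ D.diffSub m := by
  induction hA using Submodule.span_induction with
  | mem A hA =>
    obtain ⟨b, τ, hb, rfl⟩ := hA
    rw [Lop, Finset.sum_mul, Finset.mul_sum, ← Finset.sum_sub_distrib]
    refine Submodule.sum_mem _ fun η hη => Submodule.subset_span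
      ⟨fun z => b z * (D.fgen k η z - D.fgen k η (z - toV τ))
        - D.fgen k η z * (b z - b (z - toV η)), η + τ, ?_, ?_⟩
    · have ha := ratDeg_fgen hR k hη
      exact ((hb.mul (ha.sub_shift τ)).mono (by omega)).sub
        ((ha.mul (hb.sub_shift η)).mono (by omega))
    · ext F z
      simp only [LinearMap.sub_apply, Module.End.mul_apply, Pi.sub_apply, monoOp_apply, toV_add]
      rw [sub_sub, sub_sub, add_comm (toV τ) (toV η)]
      ring
  | zero => simp
  | add A B _ _ hA hB =>
    have : D.Lop k * (A + B) - (A + B) * D.Lop k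
      = (D.Lop k * A - A * D.Lop k) + (D.Lop k * B - B * D.Lop k) := by
      rw [mul_add, add_mul]; abel
    rw [this]
    exact Submodule.add_mem _ hA hB
  | smul c A _ hA =>
    have : D.Lop k * (c • A) - (c • A) * D.Lop k = c • (D.Lop k * A - A * D.Lop k) := by
      rw [mul_smul_comm, smul_mul_assoc, smul_sub]
    rw [this]
    exact Submodule.smul_mem _ _ hA

lemma ratDeg_of_mem_diffSub {m n : ℤ} {A : Module.End ℂ ((ι → ℂ) → ℂ)} (hA : A ∈ D.diffSub m)
    {F : (ι → ℂ) → ℂ} (hF : D.RatDeg n F) : D.RatDeg (m + n) (A F) := by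
  induction hA using Submodule.span_induction with
  | mem A hA =>
    obtain ⟨b, τ, hb, rfl⟩ := hA
    exact hb.mul (hF.shift τ)
  | zero =>
    have := RatDeg.poly (D := D) (degLe_zero (ι := ι) (m + n))
    simp only [map_zero] at this
    exact this
  | add A B _ _ hA hB => exact hA.add hB
  | smul c A _ hA => exact hA.const_mul c

lemma congr_of_mem_diffSub {m : ℤ} {A : Module.End ℂ ((ι → ℂ) → ℂ)} (hA : A ∈ D.diffSub m)
    {F G : (ι → ℂ) → ℂ} (h : ∀ z, NonInt D.R z → F z = G z) :
    ∀ z, NonInt D.R z → A F z = A G z := by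
  intro z hz
  induction hA using Submodule.span_induction with
  | mem A hA =>
    obtain ⟨b, τ, hb, rfl⟩ := hA
    rw [monoOp_apply, monoOp_apply, h _ (hz.sub_toV τ)]
  | zero => rfl
  | add A B _ _ hA hB => rw [LinearMap.add_apply, LinearMap.add_apply, Pi.add_apply, Pi.add_apply, hA, hB]
  | smul c A _ hA => rw [LinearMap.smul_apply, LinearMap.smul_apply, Pi.smul_apply, Pi.smul_apply, hA]

/-! ### Operators preserving invariant polynomials -/

/-- A function which, away from the integral root hyperplanes, is an invariant polynomial. -/
def IsInvPoly (D : Data ι) (F : (ι → ℂ) → ℂ) : Prop :=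
  ∃ q, D.WInv q ∧ ∀ z, NonInt D.R z → F z = eval z q

lemma WInv.isInvPoly {q : MvPolynomial ι ℂ} (hq : D.WInv q) : D.IsInvPoly fun z => eval z q :=
  ⟨q, hq, fun _ _ => rfl⟩

lemma IsInvPoly.sub {F G : (ι → ℂ) → ℂ} (hF : D.IsInvPoly F) (hG : D.IsInvPoly G) :
    D.IsInvPoly (F - G) := by
  obtain ⟨p, hp, hp'⟩ := hF
  obtain ⟨q, hq, hq'⟩ := hG
  exact ⟨p - q, hp.sub hq, fun z hz => by rw [Pi.sub_apply, map_sub, hp' z hz, hq' z hz]⟩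

lemma IsInvPoly.smul {F : (ι → ℂ) → ℂ} (hF : D.IsInvPoly F) (c : ℂ) : D.IsInvPoly (c • F) := by
  obtain ⟨p, hp, hp'⟩ := hF
  exact ⟨C c * p, hp.C_mul c, fun z hz => by simp [hp' z hz]⟩

lemma IsInvPoly.mulOp {F : (ι → ℂ) → ℂ} (hF : D.IsInvPoly F) {h : MvPolynomial ι ℂ}
    (hh : D.WInv h) : D.IsInvPoly (Data.mulOp h F) := by
  obtain ⟨p, hp, hp'⟩ := hF
  exact ⟨h * p, hh.mul hp, fun z hz => by simp [hp' z hz]⟩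

lemma dn_dvd_den (hR : D.R = D.Δ) (η : ι → ℤ) : D.dn η ∣ D.den := by
  refine prod_lin_dvd (sepForms_of_subset_R ((Finset.filter_subset _ _).trans Δ_subset_R) ?_) ?_
  · intro γ hγ hγ'
    have h1 := (Finset.mem_filter.1 hγ).2
    have h2 := (Finset.mem_filter.1 hγ').2
    rw [pairZ_neg] at h2
    omega
  · intro γ hγ z hz
    have hγR := Δ_subset_R (Finset.mem_filter.1 hγ).1
    rw [den, map_prod]
    rcases sgn_of_R_eq hR γ hγR with h | h
    · exact Finset.prod_eq_zero (Finset.mem_filter.2 ⟨hγR, h⟩) (by rw [eval_lin, hz])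
    · refine Finset.prod_eq_zero (i := -γ) (Finset.mem_filter.2 ⟨neg_mem_R hγR, fun i => ?_⟩)
        (by rw [eval_lin, evalC_neg, hz, neg_zero])
      simpa using h i

lemma eval_den_ne_zero {z : ι → ℂ} (hz : NonInt D.R z) : eval z D.den ≠ 0 := by
  rw [den, map_prod]
  refine Finset.prod_ne_zero_iff.2 fun γ hγ => ?_
  rw [eval_lin]
  exact hz.ne_zero (Finset.mem_filter.1 hγ).1

lemma Lop_actV (hR : D.R = D.Δ) {ρ : ι → ℂ} {k : (ι → ℤ) → ℂ} (hk : D.IsK ρ k)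
    {p : MvPolynomial ι ℂ} (hp : D.WInv p) {w : LatAut ι} (hw : w ∈ D.W) (z : ι → ℂ) :
    D.Lop k (fun y => eval y p) (Knop.actV w z) = D.Lop k (fun y => eval y p) z := by
  rw [Lop_apply, Lop_apply]
  symm
  refine Finset.sum_nbij' (fun η => actDual w η) (fun η => actDual w⁻¹ η)
    (fun η hη => actDual_mem_Λ₁ hw hη) (fun η hη => actDual_mem_Λ₁ (D.W.inv_mem hw) hη)
    (fun η _ => by simp) (fun η _ => by simp) fun η _ => ?_
  rw [fgen_actDual hR hk hw, toV_actDual, ← actV_sub, hp w hw]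

lemma IsInvPoly.Lop (hR : D.R = D.Δ) {ρ : ι → ℂ} {k : (ι → ℤ) → ℂ} (hk : D.IsK ρ k)
    {F : (ι → ℂ) → ℂ} (hF : D.IsInvPoly F) : D.IsInvPoly (D.Lop k F) := by
  obtain ⟨p, hp, hpF⟩ := hF
  choose c hc using dn_dvd_den hR
  let A : MvPolynomial ι ℂ := ∑ η ∈ D.Λ₁, D.num k η * c η * trP (-toV η) p
  have hA : ∀ z, NonInt D.R z → eval z A = eval z D.den * D.Lop k (fun y => eval y p) z := by
    intro z hz
    rw [Lop_apply, Finset.mul_sum, map_sum]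
    refine Finset.sum_congr rfl fun η hη => ?_
    rw [map_mul, map_mul, eval_trP, ← sub_eq_add_neg, ← fgen_mul_dn hR k hη hz]
    conv_rhs => rw [hc η, map_mul]
    ring
  have hAw : ∀ w ∈ D.W, actP w A = C (eps w : ℂ) * A := fun w hw =>
    eq_of_nonInt (D := D) fun z hz => by
      rw [eval_actP, hA _ (nonInt_actV hw hz), Lop_actV hR hk hp hw, ← eval_actP,
        actP_den (sgn_of_R_eq hR) hw, map_mul, map_mul, hA z hz, mul_assoc]
  obtain ⟨q, hq⟩ : D.den ∣ A := by
    refine prod_lin_dvd sepForms_Rpos fun γ hγ z hz => ?_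
    obtain ⟨s, hs, δ, hsr⟩ := exists_refl (Finset.mem_filter.1 hγ).1
    have h1 := congrArg (eval z) (hAw s hs)
    rw [eval_actP, hsr.actV, hz, zero_smul, sub_zero, hsr.eps, map_mul, eval_C] at h1
    push_cast at h1
    linear_combination h1 / 2
  have hqz : ∀ z, NonInt D.R z → D.Lop k (fun y => eval y p) z = eval z q := fun z hz => by
    have := hA z hz
    rw [hq, map_mul] at this
    exact (mul_left_cancel₀ (eval_den_ne_zero hz) this).symm
  refine ⟨q, fun w hw z => ?_, fun z hz => ?_⟩
  · rw [← eval_actP]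
    congr 1
    refine eq_of_nonInt (D := D) fun z hz => ?_
    rw [eval_actP, ← hqz z hz, ← hqz _ (nonInt_actV hw hz), Lop_actV hR hk hp hw]
  · rw [← hqz z hz, Lop_apply, Lop_apply]
    exact Finset.sum_congr rfl fun η _ => by rw [hpF _ (hz.sub_toV η)]

end Data

/-! ### Divided powers of a commutator -/

/-- The divided powers `ad(L)^d (a) / d!`. -/
def adDiv {A : Type*} [Ring A] [Algebra ℂ A] (L a : A) : ℕ → A
  | 0 => a
  | d + 1 => ((d : ℂ) + 1)⁻¹ • (L * adDiv L a d - adDiv L a d * L)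

section AdDiv

variable {A : Type*} [Ring A] [Algebra ℂ A] (L : A)

lemma succ_smul_adDiv (a : A) (d : ℕ) :
    ((d : ℂ) + 1) • adDiv L a (d + 1) = L * adDiv L a d - adDiv L a d * L := by
  rw [adDiv, smul_smul, mul_inv_cancel₀ (by exact_mod_cast d.succ_ne_zero), one_smul]

lemma sum_antidiagonal_smul (g : ℕ → ℕ → A) (d : ℕ) :
    ∑ x ∈ Finset.HasAntidiagonal.antidiagonal d,
      (((x.1 : ℂ) + 1) • g (x.1 + 1) x.2 + ((x.2 : ℂ) + 1) • g x.1 (x.2 + 1))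
      = ((d : ℂ) + 1) • ∑ x ∈ Finset.HasAntidiagonal.antidiagonal (d + 1), g x.1 x.2 := by
  have h1 : ∑ x ∈ Finset.HasAntidiagonal.antidiagonal (d + 1), (x.1 : ℂ) • g x.1 x.2
      = ∑ x ∈ Finset.HasAntidiagonal.antidiagonal d, ((x.1 : ℂ) + 1) • g (x.1 + 1) x.2 := by
    rw [Finset.Nat.sum_antidiagonal_succ (f := fun x : ℕ × ℕ => (x.1 : ℂ) • g x.1 x.2)]
    simp
  have h2 : ∑ x ∈ Finset.HasAntidiagonal.antidiagonal (d + 1), (x.2 : ℂ) • g x.1 x.2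
      = ∑ x ∈ Finset.HasAntidiagonal.antidiagonal d, ((x.2 : ℂ) + 1) • g x.1 (x.2 + 1) := by
    rw [Finset.Nat.sum_antidiagonal_succ' (f := fun x : ℕ × ℕ => (x.2 : ℂ) • g x.1 x.2)]
    simp
  rw [Finset.sum_add_distrib, ← h1, ← h2, ← Finset.sum_add_distrib, Finset.smul_sum]
  refine Finset.sum_congr rfl fun x hx => ?_
  rw [← add_smul]
  congr 1
  have := Finset.HasAntidiagonal.mem_antidiagonal.1 hx
  exact_mod_cast this

lemma adDiv_eq_sum (a : A) (d : ℕ) :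
    adDiv L a d = ∑ x ∈ Finset.HasAntidiagonal.antidiagonal d,
      ((-1 : ℂ) ^ x.2 / ((Nat.factorial x.1 : ℂ) * Nat.factorial x.2)) • (L ^ x.1 * a * L ^ x.2) := by
  induction d with
  | zero => simp [adDiv]
  | succ d ih =>
    rw [adDiv, ih, inv_smul_eq_iff₀ (by exact_mod_cast d.succ_ne_zero),
      ← sum_antidiagonal_smul (fun i j => ((-1 : ℂ) ^ j / ((Nat.factorial i : ℂ) * Nat.factorial j)) •
        (L ^ i * a * L ^ j)), Finset.mul_sum, Finset.sum_mul, ← Finset.sum_sub_distrib]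
    refine Finset.sum_congr rfl fun x _ => ?_
    have h1 : ((x.1 : ℂ) + 1) ≠ 0 := by exact_mod_cast x.1.succ_ne_zero
    have h2 : ((x.2 : ℂ) + 1) ≠ 0 := by exact_mod_cast x.2.succ_ne_zero
    have h3 : (Nat.factorial x.1 : ℂ) ≠ 0 := by exact_mod_cast Nat.factorial_ne_zero _
    have h4 : (Nat.factorial x.2 : ℂ) ≠ 0 := by exact_mod_cast Nat.factorial_ne_zero _
    rw [smul_smul, smul_smul, mul_smul_comm, smul_mul_assoc, sub_eq_add_neg, ← neg_smul]
    congr 2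
    · rw [Nat.factorial_succ]
      push_cast
      field_simp
    · rw [pow_succ' L, mul_assoc, mul_assoc, mul_assoc]
    · rw [Nat.factorial_succ]
      push_cast
      field_simp
      ring
    · rw [pow_succ L, mul_assoc, mul_assoc]

lemma adDiv_mul (a b : A) (d : ℕ) :
    adDiv L (a * b) d = ∑ x ∈ Finset.HasAntidiagonal.antidiagonal d, adDiv L a x.1 * adDiv L b x.2 := by
  induction d with
  | zero => simp [adDiv]
  | succ d ih =>
    rw [adDiv, ih, inv_smul_eq_iff₀ (by exact_mod_cast d.succ_ne_zero),
      ← sum_antidiagonal_smul (fun i j => adDiv L a i * adDiv L b j), Finset.mul_sum, Finset.sum_mul,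
      ← Finset.sum_sub_distrib]
    refine Finset.sum_congr rfl fun x _ => ?_
    rw [← smul_mul_assoc, ← mul_smul_comm, succ_smul_adDiv, succ_smul_adDiv]
    noncomm_ring

lemma adDiv_add (a b : A) (d : ℕ) : adDiv L (a + b) d = adDiv L a d + adDiv L b d := by
  induction d with
  | zero => rfl
  | succ d ih =>
    rw [adDiv, adDiv, adDiv, ih, ← smul_add]
    congr 1
    noncomm_ring

lemma adDiv_smul (c : ℂ) (a : A) (d : ℕ) : adDiv L (c • a) d = c • adDiv L a d := by
  induction d with
  | zero => rfl
  | succ d ih =>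
    rw [adDiv, adDiv, ih, smul_comm c, mul_smul_comm, smul_mul_assoc, smul_sub, smul_sub,
      smul_sub]

end AdDiv

namespace Data

variable {D : Data ι}

/-- The component of degree `d` of the difference operator attached to `h`. -/
def Xop (D : Data ι) (k : (ι → ℤ) → ℂ) (h : MvPolynomial ι ℂ) (d : ℕ) :
    Module.End ℂ ((ι → ℂ) → ℂ) := adDiv (D.Lop k) (mulOp h) d

lemma Xop_succ_apply (k : (ι → ℤ) → ℂ) (h : MvPolynomial ι ℂ) (d : ℕ) (F : (ι → ℂ) → ℂ) :
    D.Xop k h (d + 1) F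
      = ((d : ℂ) + 1)⁻¹ • (D.Lop k (D.Xop k h d F) - D.Xop k h d (D.Lop k F)) := rfl

lemma Xop_mem_diffSub (hR : D.R = D.Δ) (k : (ι → ℤ) → ℂ) {h : MvPolynomial ι ℂ} {m : ℤ}
    (hm : DegLe h m) (d : ℕ) : D.Xop k h d ∈ D.diffSub m := by
  induction d with
  | zero => exact mulOp_mem_diffSub hm
  | succ d ih => exact Submodule.smul_mem _ _ (Lop_comm_mem_diffSub hR k ih)

lemma IsInvPoly.Xop (hR : D.R = D.Δ) {ρ : ι → ℂ} {k : (ι → ℤ) → ℂ} (hk : D.IsK ρ k)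
    {h : MvPolynomial ι ℂ} (hh : D.WInv h) (d : ℕ) {F : (ι → ℂ) → ℂ} (hF : D.IsInvPoly F) :
    D.IsInvPoly (D.Xop k h d F) := by
  induction d generalizing F with
  | zero => exact hF.mulOp hh
  | succ d ih => exact (((ih hF).Lop hR hk).sub (ih (hF.Lop hR hk))).smul _

/-! ### Expansion along paths -/

@[simp] lemma pathPt_zero {d : ℕ} (s : Fin d → ι → ℤ) : pathPt 0 s 0 = 0 := by simp [pathPt]

lemma pathPt_cons {d : ℕ} (η : ι → ℤ) (s : Fin d → ι → ℤ) (m : ℕ) :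
    pathPt 0 (Fin.cons η s : Fin (d + 1) → ι → ℤ) (m + 1) = η + pathPt 0 s m := by
  simp only [pathPt, zero_add, Finset.sum_filter, Fin.sum_univ_succ, Fin.cons_zero, Fin.cons_succ,
    Fin.val_zero, Fin.val_succ, Nat.succ_pos, if_true, Nat.add_lt_add_iff_right]

lemma sum_piFinset_cons {d : ℕ} (S : Finset (ι → ℤ)) (g : (Fin (d + 1) → ι → ℤ) → ℂ) :
    ∑ s ∈ Fintype.piFinset (fun _ : Fin (d + 1) => S), g s
      = ∑ η ∈ S, ∑ s ∈ Fintype.piFinset (fun _ : Fin d => S), g (Fin.cons η s) := by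
  rw [← Finset.sum_product']
  symm
  refine Finset.sum_nbij' (fun x => Fin.cons x.1 x.2) (fun s => (s 0, Fin.tail s)) ?_ ?_ ?_ ?_ ?_
  · intro x hx
    rw [Finset.mem_product, Fintype.mem_piFinset] at hx
    rw [Fintype.mem_piFinset]
    exact Fin.cases hx.1 hx.2
  · intro s hs
    rw [Fintype.mem_piFinset] at hs
    rw [Finset.mem_product, Fintype.mem_piFinset]
    exact ⟨hs 0, fun i => hs i.succ⟩
  · intro x _
    simp
  · intro s _
    simp
  · intro x _
    rfl

/-- The product of the values of the coefficients along a path. -/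
def pathProd (D : Data ι) (k : (ι → ℤ) → ℂ) {d : ℕ} (s : Fin d → ι → ℤ) (z : ι → ℂ) : ℂ :=
  ∏ i : Fin d, D.fgen k (s i) (z - toV (pathPt 0 s (i : ℕ)))

lemma pathProd_cons (k : (ι → ℤ) → ℂ) {d : ℕ} (η : ι → ℤ) (s : Fin d → ι → ℤ) (z : ι → ℂ) :
    D.pathProd k (Fin.cons η s : Fin (d + 1) → ι → ℤ) z
      = D.fgen k η z * D.pathProd k s (z - toV η) := by
  rw [pathProd, Fin.prod_univ_succ]
  simp only [Fin.val_zero, pathPt_zero, toV_zero, sub_zero, Fin.cons_zero, Fin.cons_succ,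
    Fin.val_succ, pathPt_cons, toV_add, ← sub_sub]
  rfl

lemma Lop_sum_paths (k : (ι → ℤ) → ℂ) {d : ℕ} {G : (ι → ℂ) → ℂ}
    {c : (Fin d → ι → ℤ) → (ι → ℂ) → ℂ} {c' : (Fin (d + 1) → ι → ℤ) → (ι → ℂ) → ℂ}
    (hc : ∀ η s z, c s (z - toV η) = c' (Fin.cons η s) z)
    (hG : ∀ z, G z = ∑ s ∈ Fintype.piFinset (fun _ : Fin d => D.Λ₁), D.pathProd k s z * c s z)
    (z : ι → ℂ) : D.Lop k G z
      = ∑ s ∈ Fintype.piFinset (fun _ : Fin (d + 1) => D.Λ₁), D.pathProd k s z * c' s z := by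
  rw [Lop_apply, sum_piFinset_cons]
  refine Finset.sum_congr rfl fun η _ => ?_
  rw [hG, Finset.mul_sum]
  refine Finset.sum_congr rfl fun s _ => ?_
  rw [pathProd_cons, hc, mul_assoc]

lemma Lop_pow_apply (k : (ι → ℤ) → ℂ) (d : ℕ) (F : (ι → ℂ) → ℂ) (z : ι → ℂ) :
    (D.Lop k ^ d) F z = ∑ s ∈ Fintype.piFinset (fun _ : Fin d => D.Λ₁),
      D.pathProd k s z * F (z - toV (pathPt 0 s d)) := by
  induction d generalizing z with
  | zero => simp [pathProd]
  | succ d ih =>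
    rw [pow_succ', Module.End.mul_apply]
    refine Lop_sum_paths k (c' := fun s z => F (z - toV (pathPt 0 s (d + 1))))
      (fun η s z => ?_) ih z
    rw [pathPt_cons, toV_add, sub_sub]

lemma Lop_pow_mulOp_apply (k : (ι → ℤ) → ℂ) (h : MvPolynomial ι ℂ) (d i : ℕ) (hi : i ≤ d)
    (F : (ι → ℂ) → ℂ) (z : ι → ℂ) :
    (D.Lop k ^ i * mulOp h * D.Lop k ^ (d - i)) F z
      = ∑ s ∈ Fintype.piFinset (fun _ : Fin d => D.Λ₁),
        D.pathProd k s z * (eval (z - toV (pathPt 0 s i)) h * F (z - toV (pathPt 0 s d))) := by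
  induction d generalizing i z with
  | zero =>
    obtain rfl : i = 0 := by omega
    simp [pathProd]
  | succ d ih =>
    cases i with
    | zero =>
      rw [pow_zero, one_mul, Nat.sub_zero, Module.End.mul_apply, mulOp_apply, Lop_pow_apply,
        Finset.mul_sum]
      refine Finset.sum_congr rfl fun s _ => ?_
      rw [pathPt_zero, toV_zero, sub_zero]
      ring
    | succ i =>
      rw [Nat.add_sub_add_right, pow_succ', mul_assoc, mul_assoc, Module.End.mul_apply, ← mul_assoc]
      refine Lop_sum_paths k
        (c' := fun s z => eval (z - toV (pathPt 0 s (i + 1))) h * F (z - toV (pathPt 0 s (d + 1))))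
        (fun η s z => ?_) (fun z => ih i (by omega) z) z
      rw [pathPt_cons, pathPt_cons, toV_add, toV_add, sub_sub, sub_sub]

/-- The sum of `h` along a path. -/
def pathCoef (h : MvPolynomial ι ℂ) {d : ℕ} (s : Fin d → ι → ℤ) (z : ι → ℂ) : ℂ :=
  ∑ i ∈ Finset.range (d + 1),
    ((-1 : ℂ) ^ (d - i) / ((Nat.factorial i : ℂ) * (Nat.factorial (d - i) : ℂ))) *
      eval (z - toV (pathPt 0 s i)) h

/-- The coefficient of `T_τ` in the component of degree `d`. -/
def bdeg (D : Data ι) (k : (ι → ℤ) → ℂ) (h : MvPolynomial ι ℂ) (d : ℕ) (τ : ι → ℤ) (z : ι → ℂ) : ℂ :=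
  ∑ s ∈ paths D 0 τ d, pathCoef h s z * D.pathProd k s z

lemma bfun_eq_bdeg (k : (ι → ℤ) → ℂ) (h : MvPolynomial ι ℂ) (τ : ι → ℤ) (z : ι → ℂ) :
    D.bfun k h τ z = D.bdeg k h (pairZ D.ell τ).toNat τ z := rfl

/-- The endpoints of the paths of length `d`. -/
def ends (D : Data ι) (d : ℕ) : Finset (ι → ℤ) :=
  (Fintype.piFinset fun _ : Fin d => D.Λ₁).image fun s => pathPt 0 s d

lemma pathPt_last {d : ℕ} (s : Fin d → ι → ℤ) : pathPt 0 s d = ∑ i, s i := by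
  simp [pathPt]

lemma ell_of_mem_ends {d : ℕ} {τ : ι → ℤ} (h : τ ∈ D.ends d) : pairZ D.ell τ = d := by
  obtain ⟨s, hs, rfl⟩ := Finset.mem_image.1 h
  rw [Fintype.mem_piFinset] at hs
  rw [pathPt_last, pairZ_sum_right, Finset.sum_congr rfl fun i _ => ell_of_mem_Λ₁ (hs i)]
  simp

lemma mem_Lam_of_mem_ends {d : ℕ} {τ : ι → ℤ} (h : τ ∈ D.ends d) : τ ∈ D.Lam := by
  obtain ⟨s, hs, rfl⟩ := Finset.mem_image.1 h
  rw [Fintype.mem_piFinset] at hs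
  rw [pathPt_last]
  exact sum_mem fun i _ => AddSubmonoid.subset_closure (hs i)

lemma bdeg_eq_zero_of_notMem {k : (ι → ℤ) → ℂ} {h : MvPolynomial ι ℂ} {d : ℕ} {τ : ι → ℤ}
    (hτ : τ ∉ D.ends d) (z : ι → ℂ) : D.bdeg k h d τ z = 0 := by
  refine Finset.sum_eq_zero fun s hs => absurd ?_ hτ
  rw [paths, Finset.mem_filter] at hs
  exact Finset.mem_image.2 ⟨s, hs.1, hs.2⟩

lemma Xop_apply (k : (ι → ℤ) → ℂ) (h : MvPolynomial ι ℂ) (d : ℕ) (F : (ι → ℂ) → ℂ) (z : ι → ℂ) :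
    D.Xop k h d F z = ∑ τ ∈ D.ends d, D.bfun k h τ z * F (z - toV τ) := by
  have h1 : D.Xop k h d F z = ∑ s ∈ Fintype.piFinset (fun _ : Fin d => D.Λ₁),
      pathCoef h s z * D.pathProd k s z * F (z - toV (pathPt 0 s d)) := by
    rw [Xop, adDiv_eq_sum, Finset.Nat.sum_antidiagonal_eq_sum_range_succ
      (fun i j => ((-1 : ℂ) ^ j / ((Nat.factorial i : ℂ) * Nat.factorial j)) •
        (D.Lop k ^ i * mulOp h * D.Lop k ^ j)), LinearMap.sum_apply, Finset.sum_apply]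
    simp only [pathCoef, Finset.sum_mul]
    rw [Finset.sum_comm]
    refine Finset.sum_congr rfl fun i hi => ?_
    rw [LinearMap.smul_apply, Pi.smul_apply,
      Lop_pow_mulOp_apply k h d i (Nat.lt_succ_iff.1 (Finset.mem_range.1 hi)), smul_eq_mul,
      Finset.mul_sum]
    exact Finset.sum_congr rfl fun s _ => by ring
  rw [h1, ← Finset.sum_fiberwise_of_maps_to (t := D.ends d) (g := fun s => pathPt 0 s d)
    (fun s hs => Finset.mem_image_of_mem _ hs)]
  refine Finset.sum_congr rfl fun τ hτ => ?_
  rw [bfun_eq_bdeg, ell_of_mem_ends hτ, Int.toNat_natCast, bdeg, Finset.sum_mul]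
  refine Finset.sum_congr rfl fun s hs => ?_
  rw [(Finset.mem_filter.1 hs).2]

lemma ratDeg_bfun (hR : D.R = D.Δ) (k : (ι → ℤ) → ℂ) (h : MvPolynomial ι ℂ) (τ : ι → ℤ) :
    ∃ m, D.RatDeg m (D.bfun k h τ) := by
  refine ⟨h.totalDegree + (pairZ D.ell τ).toNat, ?_⟩
  change D.RatDeg _ fun z => D.bdeg k h (pairZ D.ell τ).toNat τ z
  generalize (pairZ D.ell τ).toNat = d
  simp only [bdeg, pathProd, pathCoef]
  refine RatDeg.sum _ fun s hs => ?_
  rw [paths, Finset.mem_filter, Fintype.mem_piFinset] at hs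
  refine (RatDeg.sum _ fun i _ => ?_).mul ?_
  · exact ((RatDeg.poly (degLe_totalDegree h)).shift _).const_mul _
  · have := RatDeg.prod (D := D) (m := 1) Finset.univ
      (f := fun (i : Fin d) z => D.fgen k (s i) (z - toV (pathPt 0 s (i : ℕ))))
      fun i _ => (ratDeg_fgen hR k (hs.1 i)).shift _
    simpa using this

/-- The coefficients of the difference operators vanish beyond the degree. -/
def Van (D : Data ι) (k : (ι → ℤ) → ℂ) : Prop :=
  ∀ h, D.WInv h → ∀ τ, (h.totalDegree : ℤ) < pairZ D.ell τ →
    ∀ z, NonInt D.R z → D.bfun k h τ z = 0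

lemma Van.Xop_eq_zero {k : (ι → ℤ) → ℂ} (hV : D.Van k) {h : MvPolynomial ι ℂ} (hh : D.WInv h)
    {d : ℕ} (hd : h.totalDegree < d) (F : (ι → ℂ) → ℂ) {z : ι → ℂ} (hz : NonInt D.R z) :
    D.Xop k h d F z = 0 := by
  rw [Xop_apply]
  refine Finset.sum_eq_zero fun τ hτ => ?_
  rw [hV h hh τ (by rw [ell_of_mem_ends hτ]; exact_mod_cast hd) z hz, zero_mul]

lemma Van.Dop_eq {k : (ι → ℤ) → ℂ} (hV : D.Van k) {h : MvPolynomial ι ℂ} (hh : D.WInv h)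
    {H : ℕ} (hH : h.totalDegree ≤ H) (F : (ι → ℂ) → ℂ) {z : ι → ℂ} (hz : NonInt D.R z) :
    D.Dop k h F z = ∑ d ∈ Finset.range (H + 1), D.Xop k h d F z := by
  rw [Dop, finsum_mem_eq_sum_of_inter_support_eq (t := (Finset.range (H + 1)).biUnion D.ends),
    Finset.sum_biUnion]
  · exact Finset.sum_congr rfl fun d _ => (Xop_apply k h d F z).symm
  · intro d _ d' _ hne
    refine Finset.disjoint_left.2 fun τ hτ hτ' => hne ?_
    have := (ell_of_mem_ends hτ).symm.trans (ell_of_mem_ends hτ')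
    exact_mod_cast this
  · ext τ
    simp only [Set.mem_inter_iff, SetLike.mem_coe, Function.mem_support, Finset.mem_biUnion,
      Finset.mem_range, and_congr_left_iff]
    intro hne
    constructor
    · intro hτ
      have h0 : D.bfun k h τ z ≠ 0 := left_ne_zero_of_mul hne
      refine ⟨(pairZ D.ell τ).toNat, ?_, ?_⟩
      · by_contra hlt
        exact h0 (hV h hh τ (by omega) z hz)
      · by_contra hcon
        exact h0 (bdeg_eq_zero_of_notMem hcon z)
    · rintro ⟨d, -, hd⟩
      exact mem_Lam_of_mem_ends hd

end Data

/-! ### The generic case -/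

namespace Data

variable {D : Data ι}

/-- `F` vanishes at the shifted lattice points of level `< m`. -/
def VanLt (D : Data ι) (ρ : ι → ℂ) (F : (ι → ℂ) → ℂ) (m : ℤ) : Prop :=
  ∀ κ ∈ LamPlus, pairZ D.ell κ < m → F (ρ + toV κ) = 0

lemma fgen_node_eq_zero (hR : D.R = D.Δ) {ρ : ι → ℂ} {k : (ι → ℤ) → ℂ} (hk : D.IsK ρ k)
    {η κ : ι → ℤ} (hη : η ∈ D.Λ₁) (hκ : κ ∈ LamPlus) (h : κ - η ∉ LamPlus) :
    D.fgen k η (ρ + toV κ) = 0 := by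
  have h' : ∃ i, (κ - η) i < 0 := by
    by_contra! hcon
    exact h hcon
  obtain ⟨i, hi⟩ := h'
  have h1 := pair_of_mem_Λ₁ hη (e_mem_Φ (D := D) i)
  rw [pairZ_e] at h1
  have h2 := hκ i
  rw [Pi.sub_apply] at hi
  have hη1 : η i = 1 := by rcases h1 with h | h | h <;> omega
  have hκ0 : κ i = 0 := by omega
  rw [fgen_eq hR k hη, num, map_prod, Finset.prod_eq_zero (i := Knop.e i), zero_div]
  · exact Finset.mem_filter.2 ⟨e_mem_Φ i, by rw [pairZ_e, hη1]; exact zero_lt_one⟩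
  · rw [map_sub, eval_lin, eval_C, hk.e, evalC_e]
    simp [toV, hκ0]

lemma VanLt.Lop (hR : D.R = D.Δ) {ρ : ι → ℂ} {k : (ι → ℤ) → ℂ} (hk : D.IsK ρ k)
    {F : (ι → ℂ) → ℂ} {m : ℤ} (h : D.VanLt ρ F m) : D.VanLt ρ (D.Lop k F) (m + 1) := by
  intro κ hκ hm
  rw [Lop_apply]
  refine Finset.sum_eq_zero fun η hη => ?_
  by_cases hmem : κ - η ∈ LamPlus
  · rw [add_sub_assoc, ← toV_sub, h _ hmem, mul_zero]
    rw [pairZ_sub_right, ell_of_mem_Λ₁ hη]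
    omega
  · rw [fgen_node_eq_zero hR hk hη hκ hmem, zero_mul]

lemma VanLt.Xop (hR : D.R = D.Δ) {ρ : ι → ℂ} {k : (ι → ℤ) → ℂ} (hk : D.IsK ρ k)
    (h : MvPolynomial ι ℂ) (d : ℕ) {F : (ι → ℂ) → ℂ} {m : ℤ} (hF : D.VanLt ρ F m) :
    D.VanLt ρ (D.Xop k h d F) (m + d) := by
  induction d generalizing F m with
  | zero =>
    intro κ hκ hm
    change mulOp h F _ = 0
    rw [mulOp_apply, hF κ hκ (by simpa using hm), mul_zero]
  | succ d ih =>
    intro κ hκ hm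
    push_cast at hm
    rw [Xop_succ_apply, Pi.smul_apply, Pi.sub_apply, (ih hF).Lop hR hk κ hκ (by omega),
      ih (hF.Lop hR hk) κ hκ (by omega), sub_zero, smul_zero]

lemma Good.node {ρ : ι → ℂ} (hg : D.Good ρ) (κ : ι → ℤ) : NonInt D.R (ρ + toV κ) :=
  hg.nonInt.add_toV κ

lemma Good.Xop_eq_zero_of_vanLt (hR : D.R = D.Δ) {ρ : ι → ℂ} {k : (ι → ℤ) → ℂ} (hk : D.IsK ρ k)
    (hg : D.Good ρ) {h : MvPolynomial ι ℂ} (hh : D.WInv h) {d : ℕ} (hd : h.totalDegree < d)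
    {p : MvPolynomial ι ℂ} {n : ℤ} (hp : D.WInv p) (hn : DegLe p n)
    (hv : D.VanLt ρ (fun z => eval z p) n) {z : ι → ℂ} (hz : NonInt D.R z) :
    D.Xop k h d (fun z => eval z p) z = 0 := by
  obtain ⟨q, hq, hq'⟩ := hp.isInvPoly.Xop hR hk hh d
  have hdeg : DegLe q (h.totalDegree + n) :=
    (ratDeg_of_mem_diffSub (Xop_mem_diffSub hR k (degLe_totalDegree h) d)
      (RatDeg.poly hn)).degLe hq'
  rw [hq' z hz, hg.uniq _ q hq hdeg fun κ hκ hκn => ?_, map_zero]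
  rw [← hq' _ (hg.node κ), hv.Xop hR hk h d κ hκ (by omega)]

lemma Fam.vanLt {ρ : ι → ℂ} {P : (ι → ℤ) → MvPolynomial ι ℂ} (hP : D.Fam ρ P) {μ : ι → ℤ}
    (hμ : μ ∈ LamPlus) : D.VanLt ρ (fun z => eval z (P μ)) (pairZ D.ell μ) := by
  intro κ hκ hlt
  have := (hP μ hμ).2.2 κ hκ hlt.le
  rwa [if_neg (by rintro rfl; exact hlt.ne rfl)] at this

lemma Good.Xop_eq_zero (hR : D.R = D.Δ) {ρ : ι → ℂ} {k : (ι → ℤ) → ℂ} (hk : D.IsK ρ k)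
    (hg : D.Good ρ) {h : MvPolynomial ι ℂ} (hh : D.WInv h) {d : ℕ} (hd : h.totalDegree < d)
    {p : MvPolynomial ι ℂ} (hp : D.WInv p) {z : ι → ℂ} (hz : NonInt D.R z) :
    D.Xop k h d (fun z => eval z p) z = 0 := by
  obtain ⟨P, hP⟩ := hg.exist.fam
  obtain ⟨v, hv⟩ := hP.span hg.uniq hp (degLe_totalDegree p)
  have : (fun z => eval z p)
      = ∑ μ : D.nodes p.totalDegree, v μ • fun z : ι → ℂ => eval z (P μ.1) := by
    ext z
    conv_lhs => rw [hv]
    rw [eval_comb, Finset.sum_apply]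
    rfl
  rw [this, map_sum, Finset.sum_apply]
  refine Finset.sum_eq_zero fun μ _ => ?_
  have hμ := (mem_nodes.1 μ.2).1
  rw [map_smul, Pi.smul_apply, hg.Xop_eq_zero_of_vanLt hR hk hh hd (hP _ hμ).1 (hP.degLe hμ)
    (hP.vanLt hμ) hz, smul_zero]

lemma Good.van (hR : D.R = D.Δ) {ρ : ι → ℂ} {k : (ι → ℤ) → ℂ} (hk : D.IsK ρ k)
    (hg : D.Good ρ) : D.Van k := by
  intro h hh τ hτ z hz
  by_cases hmem : τ ∈ D.ends (pairZ D.ell τ).toNat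
  · refine coeff_eq_zero (T := D.ends (pairZ D.ell τ).toNat) (c := fun τ => D.bfun k h τ)
      (fun τ _ => ratDeg_bfun hR k h τ) (fun p hp z hz => ?_) hmem hz
    rw [← Xop_apply k h _ fun z => eval z p]
    exact hg.Xop_eq_zero hR hk hh (by omega) hp hz
  · exact bdeg_eq_zero_of_notMem hmem z

/-! ### The value of `L` on constants -/

lemma eq_zero_of_ell_le {κ : ι → ℤ} (hκ : κ ∈ LamPlus) (h : pairZ D.ell κ ≤ 0) : κ = 0 := by
  have h0 := le_antisymm h (ell_nonneg hκ)
  have := (Finset.sum_eq_zero_iff_of_nonneg fun i _ => mul_nonneg (D.C6 i).le (hκ i)).1 h0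
  ext i
  exact (mul_eq_zero.1 (this i (Finset.mem_univ i))).resolve_left (D.C6 i).ne'

lemma eq_e_of_sub_mem {i : ι} (hi : D.ell i = 1) {η : ι → ℤ} (hη : η ∈ D.Λ₁) {m : ℤ}
    (h : m • Knop.e i - η ∈ LamPlus) : η = Knop.e i := by
  have h0 : Knop.e i - η ∈ LamPlus := by
    intro j
    rcases eq_or_ne j i with rfl | hj
    · have h1 := pair_of_mem_Λ₁ hη (e_mem_Φ (D := D) j)
      rw [pairZ_e] at h1
      simp only [Knop.e, Pi.sub_apply, Pi.single_eq_same]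
      omega
    · have := h j
      simpa [Knop.e, Pi.single_eq_of_ne hj] using this
  have h1 := eq_zero_of_ell_le (D := D) h0 (by
    rw [pairZ_sub_right, pairZ_e_right, hi, ell_of_mem_Λ₁ hη, sub_self])
  exact (sub_eq_zero.1 h1).symm

lemma e_mem_Λ₁ {i : ι} (hi : D.ell i = 1) : Knop.e i ∈ D.Λ₁ :=
  (D.Λ₁_spec _).2 ⟨1, D.W.one_mem, i, hi, (actDual_one _).symm⟩

lemma Lop_one_node (hR : D.R = D.Δ) {ρ : ι → ℂ} {k : (ι → ℤ) → ℂ} (hk : D.IsK ρ k) {i : ι}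
    (hi : D.ell i = 1) (m : ℕ) :
    D.Lop k (fun _ => 1) (ρ + toV ((m : ℤ) • Knop.e i))
      = D.fgen k (Knop.e i) (ρ + toV ((m : ℤ) • Knop.e i)) := by
  rw [Lop_apply, Finset.sum_eq_single_of_mem _ (e_mem_Λ₁ hi), mul_one]
  intro η hη hne
  rw [fgen_node_eq_zero hR hk hη, zero_mul]
  · intro j
    exact mul_nonneg (Int.natCast_nonneg m) (e_nonneg i j)
  · exact fun h => hne (eq_e_of_sub_mem hi hη h)

lemma ratDeg_Lop_one (hR : D.R = D.Δ) (k : (ι → ℤ) → ℂ) : D.RatDeg 1 (D.Lop k fun _ => 1) := by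
  have := RatDeg.sum (D := D) D.Λ₁ (f := fun η => D.fgen k η) fun η hη => ratDeg_fgen hR k hη
  have h1 : (D.Lop k fun _ => 1) = fun z => ∑ η ∈ D.Λ₁, D.fgen k η z := by
    ext z
    simp [Lop_apply]
  rwa [h1]

lemma _root_.Knop.DegLe.exists_eq_C {p : MvPolynomial ι ℂ} (h : DegLe p 0) : ∃ c, p = C c := by
  rcases h with h | h
  · exact ⟨0, by simp [h]⟩
  · exact ⟨_, totalDegree_eq_zero_iff_eq_C.1 (by omega)⟩

/-- A polynomial of degree `≤ 1` is affine along lines. -/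
lemma _root_.Knop.DegLe.eval_add_smul {p : MvPolynomial ι ℂ} (h : DegLe p 1) (z : ι → ℂ)
    (η : ι → ℤ) (m : ℕ) :
    eval (z + toV ((m : ℤ) • η)) p = eval z p + m * (eval (z + toV η) p - eval z p) := by
  obtain ⟨c, hc⟩ := (h.trP_sub (toV η)).exists_eq_C
  have key : ∀ y, eval (y + toV η) p = eval y p + c := fun y => by
    have := congrArg (eval y) hc
    rw [map_sub, eval_trP, eval_C] at this
    linear_combination this
  induction m with
  | zero => simp
  | succ m ih =>
    push_cast
    rw [add_smul, one_smul, toV_add, ← add_assoc, key, ih, key z]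
    ring

lemma Good.Lop_one (hR : D.R = D.Δ) {ρ : ι → ℂ} {k : (ι → ℤ) → ℂ} (hk : D.IsK ρ k)
    (hg : D.Good ρ) {z : ι → ℂ} (hz : NonInt D.R z) :
    D.Lop k (fun _ => 1) z = evalC D.ell z - evalC D.ell ρ := by
  have h1 : D.IsInvPoly fun _ => 1 := ⟨C 1, wInv_C 1, by simp⟩
  obtain ⟨q, hq, hq'⟩ := h1.Lop hR hk
  have hdeg : DegLe q 1 := (ratDeg_Lop_one hR k).degLe hq'
  have hq0 : eval ρ q = 0 := by
    have hv : D.VanLt ρ (fun _ => 1) 0 := fun κ hκ h => absurd (ell_nonneg (D := D) hκ) (by omega)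
    have := hv.Lop hR hk 0 (fun i => le_rfl) (by simp)
    rwa [toV_zero, add_zero, hq' _ hg.nonInt] at this
  have hqe : ∀ i, D.ell i = 1 → eval (ρ + toV (Knop.e i)) q = 1 := by
    intro i hi
    set A := eval (ρ + toV (Knop.e i)) q with hA
    have hpair : ∀ α ∈ D.Δup (Knop.e i), α i = 1 := fun α hα => by
      obtain ⟨h1, h2⟩ := Finset.mem_filter.1 hα
      rw [pairZ_e_right] at h2
      rcases D.C7 i hi α (Or.inl h1) with h | h | h <;> omega
    have hpair' : ∀ ω ∈ D.Φup (Knop.e i), ω i = 1 := fun α hα => by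
      obtain ⟨h1, h2⟩ := Finset.mem_filter.1 hα
      rw [pairZ_e_right] at h2
      rcases D.C7 i hi α (Or.inr h1) with h | h | h <;> omega
    have hpoly : Polynomial.C A * Polynomial.X *
        (∏ α ∈ D.Δup (Knop.e i), (Polynomial.X + Polynomial.C (evalC α ρ)))
        = ∏ ω ∈ D.Φup (Knop.e i), (Polynomial.X + Polynomial.C (evalC ω ρ - k ω)) := by
      refine Polynomial.eq_of_infinite_eval_eq _ _
        (Set.infinite_of_injective_forall_mem (f := fun m : ℕ => (m : ℂ)) Nat.cast_injective
          fun m => ?_)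
      have hx := Lop_one_node hR hk hi m
      rw [hq' _ (hg.node _), hdeg.eval_add_smul, hq0, zero_add, sub_zero, ← hA] at hx
      have hy := fgen_mul_dn hR k (e_mem_Λ₁ hi) (hg.node ((m : ℤ) • Knop.e i))
      rw [← hx, dn, num, map_prod, map_prod] at hy
      simp only [Set.mem_ofPred_eq, Polynomial.eval_mul, Polynomial.eval_C, Polynomial.eval_X,
        Polynomial.eval_prod, Polynomial.eval_add]
      rw [mul_comm A]
      convert hy using 2
      · refine Finset.prod_congr rfl fun α hα => ?_
        rw [eval_lin, evalC_add_right, evalC_toV, pairZ_smul_right, pairZ_e_right, hpair α hα]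
        push_cast
        ring
      · rename_i ω hω
        rw [map_sub, eval_C, eval_lin, evalC_add_right, evalC_toV, pairZ_smul_right, pairZ_e_right,
          hpair' ω hω]
        push_cast
        ring
    have hlead := congrArg Polynomial.leadingCoeff hpoly
    rwa [(Polynomial.monic_prod_of_monic _ _ fun ω _ => Polynomial.monic_X_add_C _).leadingCoeff,
      Polynomial.leadingCoeff_mul, Polynomial.leadingCoeff_mul, Polynomial.leadingCoeff_C,
      Polynomial.leadingCoeff_X, mul_one,
      (Polynomial.monic_prod_of_monic _ _ fun α _ => Polynomial.monic_X_add_C _).leadingCoeff,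
      mul_one] at hlead
  have h0 : q - (lin D.ell - C (evalC D.ell ρ)) = 0 := by
    refine hg.uniq 1 _ (hq.sub (wInv_ell.sub (wInv_C _)))
      (hdeg.sub ((degLe_lin _).sub ((degLe_C _).mono zero_le_one))) fun κ hκ hκ1 => ?_
    rw [map_sub, map_sub, eval_lin, eval_C, evalC_add_right, evalC_toV, add_sub_cancel_left]
    by_cases hκ0 : κ = 0
    · rw [hκ0, toV_zero, add_zero, hq0]
      simp
    · obtain ⟨i, hi⟩ : ∃ i, κ i ≠ 0 := Function.ne_iff.1 hκ0
      have hκi := hκ i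
      have hsub : κ - Knop.e i ∈ LamPlus := by
        intro j
        have hκj := hκ j
        rcases eq_or_ne j i with rfl | hj
        · simp only [Knop.e, Pi.sub_apply, Pi.single_eq_same]
          omega
        · simpa [Knop.e, Pi.single_eq_of_ne hj] using hκj
      have hell := D.C6 i
      have h2 : pairZ D.ell (κ - Knop.e i) = pairZ D.ell κ - D.ell i := by
        rw [pairZ_sub_right, pairZ_e_right]
      have h3 := eq_zero_of_ell_le (D := D) hsub (by omega)
      rw [sub_eq_zero] at h3
      have h4 : D.ell i = 1 := by
        have := ell_nonneg (D := D) hsub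
        omega
      rw [h3, hqe i h4, pairZ_e_right, h4]
      simp
  rw [hq' z hz, sub_eq_zero.1 h0, map_sub, eval_lin, eval_C]

/-! ### Eigenfunctions -/

/-- The Euler-type operator `ℓ - L`. -/
def Eop (D : Data ι) (k : (ι → ℤ) → ℂ) : Module.End ℂ ((ι → ℂ) → ℂ) := mulOp (lin D.ell) - D.Lop k

lemma Eop_apply (k : (ι → ℤ) → ℂ) (F : (ι → ℂ) → ℂ) (z : ι → ℂ) :
    D.Eop k F z = evalC D.ell z * F z - D.Lop k F z := by
  rw [Eop, LinearMap.sub_apply, Pi.sub_apply, mulOp_apply, eval_lin]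

lemma ell_comm_Xop (k : (ι → ℤ) → ℂ) (h : MvPolynomial ι ℂ) (d : ℕ) :
    mulOp (lin D.ell) * D.Xop k h d - D.Xop k h d * mulOp (lin D.ell) = (d : ℂ) • D.Xop k h d := by
  ext F z
  simp only [LinearMap.sub_apply, Module.End.mul_apply, Pi.sub_apply, LinearMap.smul_apply,
    Pi.smul_apply, smul_eq_mul, mulOp_apply, Xop_apply, Finset.mul_sum, ← Finset.sum_sub_distrib,
    eval_lin]
  refine Finset.sum_congr rfl fun τ hτ => ?_
  rw [evalC_sub_right, evalC_toV, ell_of_mem_ends hτ]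
  push_cast
  ring

/-- The truncation of the difference operator attached to `h`. -/
def Sop (D : Data ι) (k : (ι → ℤ) → ℂ) (h : MvPolynomial ι ℂ) (H : ℕ) :
    Module.End ℂ ((ι → ℂ) → ℂ) := ∑ d ∈ Finset.range (H + 1), D.Xop k h d

lemma Eop_comm_Sop (k : (ι → ℤ) → ℂ) (h : MvPolynomial ι ℂ) (H : ℕ) :
    D.Eop k * D.Sop k h H - D.Sop k h H * D.Eop k = -(((H : ℂ) + 1) • D.Xop k h (H + 1)) := by
  have step : ∀ d : ℕ, D.Eop k * D.Xop k h d - D.Xop k h d * D.Eop k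
      = (d : ℂ) • D.Xop k h d - ((d : ℂ) + 1) • D.Xop k h (d + 1) := fun d => by
    rw [← ell_comm_Xop, Xop, Xop, succ_smul_adDiv, Eop]
    rw [sub_mul, mul_sub]
    abel
  induction H with
  | zero => simpa [Sop] using step 0
  | succ H ih =>
    rw [Sop, Finset.sum_range_succ, ← Sop, mul_add, add_mul, add_sub_add_comm, ih, step]
    push_cast
    abel

lemma Sop_mem_diffSub (hR : D.R = D.Δ) (k : (ι → ℤ) → ℂ) (h : MvPolynomial ι ℂ) (H : ℕ) :
    D.Sop k h H ∈ D.diffSub h.totalDegree :=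
  Submodule.sum_mem _ fun d _ => Xop_mem_diffSub hR k (degLe_totalDegree h) d

lemma Sop_apply (k : (ι → ℤ) → ℂ) (h : MvPolynomial ι ℂ) (H : ℕ) (F : (ι → ℂ) → ℂ) (z : ι → ℂ) :
    D.Sop k h H F z = ∑ d ∈ Finset.range (H + 1), D.Xop k h d F z := by
  rw [Sop, LinearMap.sum_apply, Finset.sum_apply]

lemma IsInvPoly.Sop (hR : D.R = D.Δ) {ρ : ι → ℂ} {k : (ι → ℤ) → ℂ} (hk : D.IsK ρ k)
    {h : MvPolynomial ι ℂ} (hh : D.WInv h) (H : ℕ) {F : (ι → ℂ) → ℂ} (hF : D.IsInvPoly F) :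
    D.IsInvPoly (D.Sop k h H F) := by
  choose q hq hq' using fun d => hF.Xop hR hk hh d
  refine ⟨∑ d ∈ Finset.range (H + 1), q d, WInv.sum _ fun d _ => hq d, fun z hz => ?_⟩
  rw [Sop_apply, map_sum]
  exact Finset.sum_congr rfl fun d _ => hq' d z hz

lemma Good.Eop_eq (hR : D.R = D.Δ) {ρ : ι → ℂ} {k : (ι → ℤ) → ℂ} (hk : D.IsK ρ k)
    (hg : D.Good ρ) {lam : ι → ℤ} {p : MvPolynomial ι ℂ} (hp : D.WInv p)
    (hdeg : DegLe p (pairZ D.ell lam))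
    (h0 : ∀ κ ∈ LamPlus, pairZ D.ell κ ≤ pairZ D.ell lam → κ ≠ lam → eval (ρ + toV κ) p = 0)
    {z : ι → ℂ} (hz : NonInt D.R z) :
    D.Eop k (fun y => eval y p) z = (evalC D.ell ρ + pairZ D.ell lam) * eval z p := by
  obtain ⟨q, hq, hq'⟩ : D.IsInvPoly (D.Eop k fun y => eval y p) :=
    (hp.isInvPoly.mulOp wInv_ell).sub (hp.isInvPoly.Lop hR hk)
  have hrat : D.RatDeg (pairZ D.ell lam) fun z => evalC D.ell ρ * eval z p
      + ∑ η ∈ D.Λ₁, D.fgen k η z * (eval z p - eval (z - toV η) p) := by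
    refine ((RatDeg.poly hdeg).const_mul _).add (RatDeg.sum _ fun η hη => ?_)
    exact ((ratDeg_fgen hR k hη).mul ((RatDeg.poly hdeg).sub_shift η)).mono (by omega)
  have hqdeg : DegLe q (pairZ D.ell lam) := by
    refine hrat.degLe fun z hz => ?_
    rw [← hq' z hz, Eop_apply]
    have h1 := hg.Lop_one hR hk hz
    rw [Lop_apply] at h1 ⊢
    simp only [mul_one] at h1
    simp only [mul_sub, Finset.sum_sub_distrib, ← Finset.sum_mul]
    rw [h1]
    ring
  have hv : D.VanLt ρ (fun y => eval y p) (pairZ D.ell lam) := fun κ hκ hlt =>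
    h0 κ hκ hlt.le (by rintro rfl; exact hlt.ne rfl)
  have hq0 : q - C (evalC D.ell ρ + pairZ D.ell lam) * p = 0 := by
    refine hg.uniq _ _ (hq.sub (hp.C_mul _)) (hqdeg.sub (hdeg.C_mul _)) fun κ hκ hle => ?_
    rw [map_sub, ← hq' _ (hg.node κ), Eop_apply, hv.Lop hR hk κ hκ (by omega), map_mul, eval_C]
    by_cases hne : κ = lam
    · subst hne
      rw [evalC_add_right, evalC_toV]
      ring
    · rw [h0 κ hκ hle hne]
      ring
  rw [hq' z hz, sub_eq_zero.1 hq0, map_mul, eval_C]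

lemma Good.Sop_eq (hR : D.R = D.Δ) {ρ : ι → ℂ} {k : (ι → ℤ) → ℂ} (hk : D.IsK ρ k)
    (hg : D.Good ρ) {h : MvPolynomial ι ℂ} (hh : D.WInv h) {lam : ι → ℤ} {p : MvPolynomial ι ℂ}
    (hp : D.WInv p) (hdeg : DegLe p (pairZ D.ell lam))
    (h0 : ∀ κ ∈ LamPlus, pairZ D.ell κ ≤ pairZ D.ell lam → κ ≠ lam → eval (ρ + toV κ) p = 0)
    {z : ι → ℂ} (hz : NonInt D.R z) :
    D.Sop k h h.totalDegree (fun y => eval y p) z = eval (ρ + toV lam) h * eval z p := by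
  set H := h.totalDegree with hH
  set a := eval (ρ + toV lam) h with ha
  set c := evalC D.ell ρ + pairZ D.ell lam with hc
  set F : (ι → ℂ) → ℂ := fun y => eval y p with hF
  have hE : ∀ z, NonInt D.R z → D.Eop k F z = (c • F) z := fun z hz => by
    rw [hg.Eop_eq hR hk hp hdeg h0 hz]
    rfl
  set G : (ι → ℂ) → ℂ := D.Sop k h H F - a • F with hG
  obtain ⟨r, hr, hr'⟩ : D.IsInvPoly G :=
    (hp.isInvPoly.Sop hR hk hh H).sub (hp.isInvPoly.smul a)
  have hEG : ∀ z, NonInt D.R z → D.Eop k G z = c * G z := fun z hz => by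
    have h1 : D.Eop k (D.Sop k h H F) z = D.Sop k h H (D.Eop k F) z := by
      have := congrFun (LinearMap.congr_fun (Eop_comm_Sop (D := D) k h H) F) z
      simp only [LinearMap.sub_apply, Module.End.mul_apply, Pi.sub_apply, LinearMap.neg_apply,
        LinearMap.smul_apply, Pi.neg_apply, Pi.smul_apply] at this
      rw [(hg.van hR hk).Xop_eq_zero hh (by omega) F hz, smul_zero, neg_zero] at this
      exact sub_eq_zero.1 this
    rw [hG, map_sub, map_smul, Pi.sub_apply, Pi.smul_apply, h1,
      congr_of_mem_diffSub (Sop_mem_diffSub hR k h H) hE z hz, map_smul, hE z hz]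
    simp only [Pi.smul_apply, Pi.sub_apply, smul_eq_mul]
    ring
  have hv : D.VanLt ρ F (pairZ D.ell lam) := fun κ hκ hlt =>
    h0 κ hκ hlt.le (by rintro rfl; exact hlt.ne rfl)
  have hG0 : D.VanLt ρ G (pairZ D.ell lam + 1) := by
    intro κ hκ hlt
    rw [hG, Pi.sub_apply, Sop_apply, Finset.sum_range_succ', Finset.sum_eq_zero fun d _ =>
      hv.Xop hR hk h (d + 1) κ hκ (by push_cast; omega), zero_add]
    change mulOp h F _ - a * F _ = 0
    rw [mulOp_apply, ← sub_mul]
    by_cases hne : κ = lam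
    · rw [hne, ← ha, sub_self, zero_mul]
    · rw [hF]
      dsimp only
      rw [h0 κ hκ (by omega) hne, mul_zero]
  have hGall : ∀ m : ℕ, D.VanLt ρ G m := by
    intro m
    induction m with
    | zero => exact fun κ hκ hlt => absurd (ell_nonneg (D := D) hκ) (by push_cast at hlt; omega)
    | succ m ih =>
      intro κ hκ hlt
      by_cases hle : pairZ D.ell κ < pairZ D.ell lam + 1
      · exact hG0 κ hκ hle
      · have h1 := hEG _ (hg.node κ)
        rw [Eop_apply, ih.Lop hR hk κ hκ (by push_cast at hlt; omega), evalC_add_right, evalC_toV,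
          hc] at h1
        have h2 : ((pairZ D.ell κ - pairZ D.ell lam : ℤ) : ℂ) * G (ρ + toV κ) = 0 := by
          push_cast
          linear_combination h1
        refine (mul_eq_zero.1 h2).resolve_left ?_
        exact_mod_cast (by omega : pairZ D.ell κ - pairZ D.ell lam ≠ 0)
  have hr0 : r = 0 := hg.uniq r.totalDegree r hr (degLe_totalDegree r) fun κ hκ _ => by
    rw [← hr' _ (hg.node κ)]
    exact hGall ((pairZ D.ell κ).toNat + 1) κ hκ (by push_cast; omega)
  have := hr' z hz
  rw [hr0, map_zero] at this
  exact sub_eq_zero.1 this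

end Data

/-! ### Polynomial dependence on the parameter -/

namespace Data

variable {D : Data ι}

lemma PolyFn.fgen {k : ℂ → (ι → ℤ) → ℂ} (hk : ∀ ω, PolyFn fun t => k t ω) (τ : ι → ℤ)
    (z : ι → ℂ) : PolyFn fun t => D.fgen (k t) τ z := by
  simp only [Data.fgen, div_eq_mul_inv]
  refine (PolyFn.prod _ fun ω _ => ?_).mul (.const _)
  exact .prod _ fun j _ => ((PolyFn.const _).sub (hk ω)).sub (.const _)

lemma PolyFn.bfun {k : ℂ → (ι → ℤ) → ℂ} (hk : ∀ ω, PolyFn fun t => k t ω)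
    (h : MvPolynomial ι ℂ) (τ : ι → ℤ) (z : ι → ℂ) : PolyFn fun t => D.bfun (k t) h τ z := by
  simp only [Data.bfun]
  exact .sum _ fun s _ => (PolyFn.const _).mul (.prod _ fun i _ => PolyFn.fgen hk _ _)

lemma PolyFn.Sop {k : ℂ → (ι → ℤ) → ℂ} (hk : ∀ ω, PolyFn fun t => k t ω)
    (h : MvPolynomial ι ℂ) (H : ℕ) {F : ℂ → (ι → ℂ) → ℂ} (hF : ∀ z, PolyFn fun t => F t z)
    (z : ι → ℂ) : PolyFn fun t => D.Sop (k t) h H (F t) z := by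
  simp only [Sop_apply, Xop_apply]
  exact .sum _ fun d _ => .sum _ fun τ _ => (PolyFn.bfun hk h τ z).mul (hF _)

lemma PolyFn.adjugate {n : Type*} [Fintype n] [DecidableEq n] {A : ℂ → Matrix n n ℂ}
    (hA : ∀ i j, PolyFn fun t => A t i j) (i j : n) : PolyFn fun t => (A t).adjugate i j := by
  simp only [Matrix.adjugate_apply]
  refine PolyFn.det fun a b => ?_
  by_cases h : a = j
  · subst h
    simpa using PolyFn.const _
  · simpa [Matrix.updateRow_ne h] using hA a b

lemma PolyFn.nodeMat (P : (ι → ℤ) → MvPolynomial ι ℂ) (ρ' ρ : ι → ℂ) (N : ℤ) (i j : D.nodes N) :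
    PolyFn fun t => D.nodeMat P (Data.defo ρ' ρ t) N i j :=
  PolyFn.eval (fun i => (PolyFn.defo ρ' ρ i).add (.const _)) _

section Deformation

variable {ρ' ρ : ι → ℂ} {k : (ι → ℤ) → ℂ}

lemma van_of_exist_uniq (h' : D.InV0 ρ') (hE : D.Exist ρ') (hU : D.Uniq ρ') (hρ : D.InV0 ρ)
    (hk : D.IsK ρ k) : D.Van k := by
  obtain ⟨k', hk'⟩ := h'.exists_isK
  intro h hh τ hτ z hz
  have := PolyFn.eq_zero_of_good h' hU hE hρ (PolyFn.bfun (D := D) (PolyFn.defoK k' k) h τ z)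
    (fun t hg => hg.van (R_eq_Δ h' hU hE) (defoK_isK hk' hk t) h hh τ hτ z hz) 1
  rwa [defoK_one] at this

/-- The polynomial of degree `≤ ℓ(λ)` which takes the value `det M` at `ρ + λ` and vanishes at the
other nodes, where `M` is the matrix of the values of `P` at the nodes of `ρ`. -/
def cramer (D : Data ι) (P : (ι → ℤ) → MvPolynomial ι ℂ) (ρ : ι → ℂ) {N : ℤ} (lam : D.nodes N) :
    MvPolynomial ι ℂ := D.comb P fun μ => (D.nodeMat P ρ N).adjugate lam μ

lemma eval_cramer_node (P : (ι → ℤ) → MvPolynomial ι ℂ) (ρ : ι → ℂ) {N : ℤ} (lam κ : D.nodes N) :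
    eval (ρ + toV κ.1) (D.cramer P ρ lam) = if lam = κ then (D.nodeMat P ρ N).det else 0 := by
  rw [cramer, eval_comb_node]
  have := congrFun (congrFun (Matrix.adjugate_mul (D.nodeMat P ρ N)) lam) κ
  rwa [Matrix.smul_apply, Matrix.one_apply, smul_eq_mul, mul_ite, mul_one, mul_zero] at this

lemma Sop_cramer_eq (h' : D.InV0 ρ') (hE : D.Exist ρ') (hU : D.Uniq ρ') (hρ : D.InV0 ρ)
    (hk : D.IsK ρ k) {P : (ι → ℤ) → MvPolynomial ι ℂ} (hP : D.Fam ρ' P) {h : MvPolynomial ι ℂ}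
    (hh : D.WInv h) {lam : ι → ℤ} (hlam : lam ∈ D.nodes (pairZ D.ell lam)) {z : ι → ℂ}
    (hz : NonInt D.R z) :
    D.Sop k h h.totalDegree (fun y => eval y (D.cramer P ρ ⟨lam, hlam⟩)) z
      = eval (ρ + toV lam) h * eval z (D.cramer P ρ ⟨lam, hlam⟩) := by
  obtain ⟨k', hk'⟩ := h'.exists_isK
  have hQ : ∀ y, PolyFn fun t => eval y (D.cramer P (defo ρ' ρ t) ⟨lam, hlam⟩) := fun y => by
    simp only [cramer, eval_comb]
    exact .sum _ fun μ _ => (PolyFn.adjugate (PolyFn.nodeMat P ρ' ρ _) _ _).mul (.const _)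
  have hs := (PolyFn.Sop (D := D) (PolyFn.defoK k' k) h h.totalDegree hQ z).sub
    ((PolyFn.eval (fun i => (PolyFn.defo ρ' ρ i).add (.const (toV lam i))) h).mul (hQ z))
  have := PolyFn.eq_zero_of_good h' hU hE hρ hs (fun t hg => sub_eq_zero.2 ?_) 1
  · rw [defoK_one, defo_one] at this
    exact sub_eq_zero.1 this
  · refine hg.Sop_eq (R_eq_Δ h' hU hE) (defoK_isK hk' hk t) hh (hP.wInv_comb _)
      (hP.degLe_comb _) (fun κ hκ hle hne => ?_) hz
    have hκ' : κ ∈ D.nodes (pairZ D.ell lam) := mem_nodes.2 ⟨hκ, hle⟩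
    exact (eval_cramer_node P _ ⟨lam, hlam⟩ ⟨κ, hκ'⟩).trans
      (if_neg fun hc => hne (congrArg Subtype.val hc).symm)

lemma Fam.Sop_eq (h' : D.InV0 ρ') (hE : D.Exist ρ') (hU : D.Uniq ρ') (hρ : D.InV0 ρ)
    (hk : D.IsK ρ k) {Q : (ι → ℤ) → MvPolynomial ι ℂ} (hQ : D.Fam ρ Q) {h : MvPolynomial ι ℂ}
    (hh : D.WInv h) {lam : ι → ℤ} (hlam : lam ∈ LamPlus) {z : ι → ℂ} (hz : NonInt D.R z) :
    D.Sop k h h.totalDegree (fun y => eval y (Q lam)) z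
      = eval (ρ + toV lam) h * eval z (Q lam) := by
  obtain ⟨P, hP⟩ := hE.fam
  have hdet := hP.det_ne_zero_of_fam hU hQ
  have hmem : lam ∈ D.nodes (pairZ D.ell lam) := mem_nodes.2 ⟨hlam, le_rfl⟩
  set c := (D.nodeMat P ρ (pairZ D.ell lam)).det with hc
  have hcr : D.cramer P ρ ⟨lam, hmem⟩ - C c * Q lam = 0 := by
    refine uniq_of_det hP hU hdet _ _ ((hP.wInv_comb _).sub ((hQ lam hlam).1.C_mul c))
      ((hP.degLe_comb _).sub ((hQ.degLe hlam).C_mul c)) fun κ hκ hle => ?_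
    have hκ' : κ ∈ D.nodes (pairZ D.ell lam) := mem_nodes.2 ⟨hκ, hle⟩
    rw [map_sub, map_mul, eval_C, (hQ lam hlam).2.2 κ hκ hle,
      eval_cramer_node P ρ ⟨lam, hmem⟩ ⟨κ, hκ'⟩]
    by_cases hne : κ = lam
    · subst hne
      simp [hc]
    · rw [if_neg hne, if_neg fun hc => hne (congrArg Subtype.val hc).symm, mul_zero, sub_zero]
  have key := Sop_cramer_eq h' hE hU hρ hk hP hh hmem hz
  have hF : (fun y => eval y (D.cramer P ρ ⟨lam, hmem⟩)) = c • fun y => eval y (Q lam) := by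
    ext y
    rw [sub_eq_zero.1 hcr, map_mul, eval_C]
    rfl
  rw [hF, sub_eq_zero.1 hcr, map_smul, Pi.smul_apply, smul_eq_mul, map_mul, eval_C] at key
  exact mul_left_cancel₀ (hdet _) (by rw [key]; ring)

end Deformation

/-! ### Algebraic properties of the operators -/

lemma Van.Dop_eq_Sop {k : (ι → ℤ) → ℂ} (hV : D.Van k) {h : MvPolynomial ι ℂ} (hh : D.WInv h)
    {H : ℕ} (hH : h.totalDegree ≤ H) (F : (ι → ℂ) → ℂ) {z : ι → ℂ} (hz : NonInt D.R z) :
    D.Dop k h F z = D.Sop k h H F z := by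
  rw [hV.Dop_eq hh hH F hz, Sop_apply]

lemma Xop_one (k : (ι → ℤ) → ℂ) : D.Xop k 1 0 = 1 := by
  ext F z
  change mulOp 1 F z = F z
  rw [mulOp_apply, map_one, one_mul]

lemma Xop_smul (k : (ι → ℤ) → ℂ) (c : ℂ) (h : MvPolynomial ι ℂ) (d : ℕ) :
    D.Xop k (c • h) d = c • D.Xop k h d := by
  have : mulOp (c • h) = c • mulOp h := by
    ext F z
    simp only [mulOp_apply, LinearMap.smul_apply, Pi.smul_apply, smul_eq_mul, smul_eval, mul_assoc]
  rw [Xop, this, adDiv_smul, Xop]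

lemma Xop_add (k : (ι → ℤ) → ℂ) (h₁ h₂ : MvPolynomial ι ℂ) (d : ℕ) :
    D.Xop k (h₁ + h₂) d = D.Xop k h₁ d + D.Xop k h₂ d := by
  have : mulOp (h₁ + h₂) = mulOp h₁ + mulOp h₂ := by
    ext F z
    simp only [mulOp_apply, LinearMap.add_apply, Pi.add_apply, map_add, add_mul]
  rw [Xop, this, adDiv_add, Xop, Xop]

lemma Xop_mul (k : (ι → ℤ) → ℂ) (h₁ h₂ : MvPolynomial ι ℂ) (d : ℕ) :
    D.Xop k (h₁ * h₂) d
      = ∑ x ∈ Finset.HasAntidiagonal.antidiagonal d, D.Xop k h₁ x.1 * D.Xop k h₂ x.2 := by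
  rw [Xop, mulOp_mul, adDiv_mul]
  rfl

variable {k : (ι → ℤ) → ℂ} {z : ι → ℂ}

lemma Van.Dop_one (hV : D.Van k) (F : (ι → ℂ) → ℂ) (hz : NonInt D.R z) :
    D.Dop k 1 F z = F z := by
  have h1 : D.WInv 1 := fun w _ z => by simp
  rw [hV.Dop_eq h1 (by simp : (1 : MvPolynomial ι ℂ).totalDegree ≤ 0) F hz, zero_add,
    Finset.sum_range_one, Xop_one, Module.End.one_apply]

lemma Van.Dop_smul (hV : D.Van k) (c : ℂ) {h : MvPolynomial ι ℂ} (hh : D.WInv h)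
    (F : (ι → ℂ) → ℂ) (hz : NonInt D.R z) : D.Dop k (c • h) F z = c * D.Dop k h F z := by
  have hch : D.WInv (c • h) := by
    rw [smul_eq_C_mul]
    exact hh.C_mul c
  rw [hV.Dop_eq hch (totalDegree_smul_le c h) F hz, hV.Dop_eq hh le_rfl F hz, Finset.mul_sum]
  simp only [Xop_smul, LinearMap.smul_apply, Pi.smul_apply, smul_eq_mul]

lemma Van.Dop_add (hV : D.Van k) {h₁ h₂ : MvPolynomial ι ℂ} (hh₁ : D.WInv h₁) (hh₂ : D.WInv h₂)
    (F : (ι → ℂ) → ℂ) (hz : NonInt D.R z) :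
    D.Dop k (h₁ + h₂) F z = D.Dop k h₁ F z + D.Dop k h₂ F z := by
  rw [hV.Dop_eq (hh₁.add hh₂) (totalDegree_add h₁ h₂) F hz, hV.Dop_eq hh₁ (le_max_left _ _) F hz,
    hV.Dop_eq hh₂ (le_max_right _ _) F hz, ← Finset.sum_add_distrib]
  simp only [Xop_add, LinearMap.add_apply, Pi.add_apply]

lemma sum_range_antidiagonal {g : ℕ → ℕ → ℂ} {m n : ℕ} (hm : ∀ i j, m < i → g i j = 0)
    (hn : ∀ i j, n < j → g i j = 0) :
    ∑ d ∈ Finset.range (m + n + 1), ∑ x ∈ Finset.HasAntidiagonal.antidiagonal d, g x.1 x.2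
      = ∑ i ∈ Finset.range (m + 1), ∑ j ∈ Finset.range (n + 1), g i j := by
  rw [← Finset.sum_product', ← Finset.sum_fiberwise_of_maps_to
    (s := Finset.range (m + 1) ×ˢ Finset.range (n + 1)) (t := Finset.range (m + n + 1))
    (g := fun x => x.1 + x.2) fun x hx => by
      rw [Finset.mem_product, Finset.mem_range, Finset.mem_range] at hx
      rw [Finset.mem_range]
      omega]
  refine Finset.sum_congr rfl fun d _ => (Finset.sum_subset (fun x hx => ?_) fun x hx hx' => ?_).symm
  · exact Finset.HasAntidiagonal.mem_antidiagonal.2 (Finset.mem_filter.1 hx).2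
  · rw [Finset.HasAntidiagonal.mem_antidiagonal] at hx
    simp only [Finset.mem_filter, Finset.mem_product, Finset.mem_range, not_and] at hx'
    by_cases h1 : m < x.1
    · exact hm _ _ h1
    · exact hn _ _ (by by_contra h2; exact hx' ⟨by omega, by omega⟩ hx)

lemma Van.Dop_mul (hV : D.Van k) (hR : D.R = D.Δ) {h₁ h₂ : MvPolynomial ι ℂ} (hh₁ : D.WInv h₁)
    (hh₂ : D.WInv h₂) (F : (ι → ℂ) → ℂ) (hz : NonInt D.R z) :
    D.Dop k (h₁ * h₂) F z = D.Dop k h₁ (D.Dop k h₂ F) z := by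
  have hX := Xop_mem_diffSub hR k (degLe_totalDegree h₁)
  rw [hV.Dop_eq (hh₁.mul hh₂) (totalDegree_mul h₁ h₂) F hz, hV.Dop_eq hh₁ le_rfl _ hz]
  simp only [Xop_mul, LinearMap.sum_apply, Finset.sum_apply, Module.End.mul_apply]
  rw [sum_range_antidiagonal (g := fun i j => D.Xop k h₁ i (D.Xop k h₂ j F) z)
    (fun i j hi => hV.Xop_eq_zero hh₁ hi _ hz) fun i j hj => ?_]
  · refine Finset.sum_congr rfl fun i _ => ?_
    rw [congr_of_mem_diffSub (hX i) (fun y hy => hV.Dop_eq_Sop hh₂ le_rfl F hy) z hz, Sop,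
      LinearMap.sum_apply, map_sum, Finset.sum_apply]
  · rw [congr_of_mem_diffSub (hX i) (G := 0) (fun y hy => hV.Xop_eq_zero hh₂ hj F hy) z hz, map_zero,
      Pi.zero_apply]

end Data

/-- Theorem 4.9 b, c: assuming axiom C0, for `ρ ∈ V₀` the map
`h ↦ D_h` is a `ℂ`-algebra homomorphism from `P^W` into the algebra of
difference operators with rational coefficients (in particular the operators
`D_h` commute pairwise), and if `ρ` is dominant then `D_h(p_λ) = h(ρ+λ)·p_λ`
for all `h ∈ P^W` and `λ ∈ Λ₊`.  (Operator identities between difference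
operators with rational coefficients are stated at all points `z` avoiding the
integral root hyperplanes `α(z) ∈ ℤ`, which determines them uniquely.) -/
theorem statement18 (D : Data ι) (hC0 : D.C0)
    (ρ : ι → ℂ) (hρ : D.InV0 ρ)
    (k : (ι → ℤ) → ℂ) (hk : D.IsK ρ k) :
    (∀ F : (ι → ℂ) → ℂ, ∀ z : ι → ℂ, (∀ α ∈ D.Δ, ∀ n : ℤ, evalC α z ≠ (n : ℂ)) →
        D.Dop k 1 F z = F z) ∧
    (∀ c : ℂ, ∀ h : MvPolynomial ι ℂ, D.WInv h →
      ∀ F : (ι → ℂ) → ℂ, ∀ z : ι → ℂ, (∀ α ∈ D.Δ, ∀ n : ℤ, evalC α z ≠ (n : ℂ)) →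
        D.Dop k (c • h) F z = c * D.Dop k h F z) ∧
    (∀ h₁ h₂ : MvPolynomial ι ℂ, D.WInv h₁ → D.WInv h₂ →
      ∀ F : (ι → ℂ) → ℂ, ∀ z : ι → ℂ, (∀ α ∈ D.Δ, ∀ n : ℤ, evalC α z ≠ (n : ℂ)) →
        D.Dop k (h₁ + h₂) F z = D.Dop k h₁ F z + D.Dop k h₂ F z ∧
        D.Dop k (h₁ * h₂) F z = D.Dop k h₁ (D.Dop k h₂ F) z ∧
        D.Dop k h₁ (D.Dop k h₂ F) z = D.Dop k h₂ (D.Dop k h₁ F) z) ∧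
    (D.Dominant ρ →
      ∀ pl : (ι → ℤ) → MvPolynomial ι ℂ,
        (∀ lam : ι → ℤ, lam ∈ LamPlus → D.CapelliAt ρ lam (pl lam)) →
      ∀ h : MvPolynomial ι ℂ, D.WInv h →
      ∀ lam : ι → ℤ, lam ∈ LamPlus →
      ∀ z : ι → ℂ, (∀ α ∈ D.Δ, ∀ n : ℤ, evalC α z ≠ (n : ℂ)) →
        D.Dop k h (fun y => eval y (pl lam)) z =
          eval (ρ + toV lam) h * eval z (pl lam)) := by
  obtain ⟨ρ', h', -, -, hC⟩ := hC0
  obtain ⟨hE, hU⟩ := Data.exist_and_uniq_of_C0 hC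
  have hR := Data.R_eq_Δ h' hU hE
  have hV : D.Van k := Data.van_of_exist_uniq h' hE hU hρ hk
  have hN : ∀ z, (∀ α ∈ D.Δ, ∀ n : ℤ, evalC α z ≠ (n : ℂ)) → NonInt D.R z := fun z hz => hR ▸ hz
  refine ⟨fun F z hz => hV.Dop_one F (hN z hz), fun c h hh F z hz => hV.Dop_smul c hh F (hN z hz),
    fun h₁ h₂ hh₁ hh₂ F z hz => ⟨hV.Dop_add hh₁ hh₂ F (hN z hz), hV.Dop_mul hR hh₁ hh₂ F (hN z hz),
      ?_⟩, fun _ pl hpl h hh lam hlam z hz => ?_⟩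
  · rw [← hV.Dop_mul hR hh₁ hh₂ F (hN z hz), mul_comm, hV.Dop_mul hR hh₂ hh₁ F (hN z hz)]
  · rw [hV.Dop_eq_Sop hh le_rfl _ (hN z hz)]
    exact Data.Fam.Sop_eq h' hE hU hρ hk hpl hh hlam (hN z hz)

end Knop

end
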